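/- Let d ≥ 2 and p > p_c. There exists a constant c > 0 such that, Q-almost surely on the event {|C| = +∞}, for all sufficiently large r: |B_r(C)| ≥ c r^d, where B_r(C) = {x ∈ Z^d : D(0,x) ≤ r}. -/

import Mathlib

open MeasureTheory
open scoped ENNReal

namespace Perco

/-- Vertices of the lattice `Z^d`. -/
abbrev Zd (d : ℕ) := Fin d → ℤ

/-- A percolation configuration: each (unordered) edge of the lattice is open or closed.
(Only the values on nearest-neighbour pairs matter.) -/
abbrev Config (d : ℕ) := Sym2 (Zd d) → Bool

/-- Lattice adjacency: `(x,y) ∈ E^d`. -/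
def latAdj {d : ℕ} (x y : Zd d) : Prop := (∑ i, |x i - y i|) = 1

/-- Open adjacency in the configuration `ω`. -/
def openAdj {d : ℕ} (ω : Config d) (x y : Zd d) : Prop :=
  latAdj x y ∧ ω s(x, y) = true

/-- `C`: the open cluster of the origin. -/
def cluster {d : ℕ} (ω : Config d) : Set (Zd d) :=
  {y | Relation.ReflTransGen (openAdj ω) 0 y}

/-- `Q` is the product measure making the edge states i.i.d. Bernoulli(p). -/
def IsBernoulli {d : ℕ} (p : ℝ) (Q : Measure (Config d)) : Prop :=
  IsProbabilityMeasure Q ∧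
    ∀ (s : Finset (Sym2 (Zd d))) (f : Sym2 (Zd d) → Bool),
      Q {ω : Config d | ∀ e ∈ s, ω e = f e} =
        ∏ e ∈ s, (if f e then ENNReal.ofReal p else ENNReal.ofReal (1 - p))

/-- The critical probability `p_c`. -/
noncomputable def pc (d : ℕ) : ℝ :=
  sSup {p : ℝ | 0 ≤ p ∧ p ≤ 1 ∧
    ∀ Q : Measure (Config d), IsBernoulli p Q → Q {ω | (cluster ω).Infinite} = 0}

/-- The box `B_n = [-n,n]^d`. -/
def box (d n : ℕ) : Set (Zd d) := {x | ∀ i, |x i| ≤ (n : ℤ)}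

/-- `C_n`: the connected component of `0` in `C ∩ B_n`. -/
def clusterN {d : ℕ} (ω : Config d) (n : ℕ) : Set (Zd d) :=
  {y | Relation.ReflTransGen
    (fun a b => openAdj ω a b ∧ a ∈ box d n ∧ b ∈ box d n) 0 y}

/-- `A` is connected in the open subgraph. -/
def ConnOpen {d : ℕ} (ω : Config d) (A : Set (Zd d)) : Prop :=
  ∀ x ∈ A, ∀ y ∈ A,
    Relation.ReflTransGen (fun a b => openAdj ω a b ∧ a ∈ A ∧ b ∈ A) x y

/-- `A` is connected in the lattice. -/
def ConnLat {d : ℕ} (A : Set (Zd d)) : Prop :=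
  ∀ x ∈ A, ∀ y ∈ A,
    Relation.ReflTransGen (fun a b => latAdj a b ∧ a ∈ A ∧ b ∈ A) x y

/-- The boundary `∂_{C^g} A` = open lattice edges from `A` to its complement. -/
def bdry {d : ℕ} (ω : Config d) (A : Set (Zd d)) : Set (Zd d × Zd d) :=
  {e | openAdj ω e.1 e.2 ∧ e.1 ∈ A ∧ e.2 ∉ A}

/-- The profile `f_c` (at scale `n`, exponent `γ`). -/
noncomputable def fcut (d : ℕ) (γ c : ℝ) (n : ℕ) (x : ℝ) : ℝ :=
  if x < c * (n : ℝ) ^ γ then 1 else x ^ (1 - 1 / (d : ℝ))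

/-- `ν(x)`: number of open neighbours of `x`. -/
noncomputable def nu {d : ℕ} (ω : Config d) (x : Zd d) : ℕ :=
  Set.ncard {y | openAdj ω x y}

-- Transition kernel of the simple random walk on the open subgraph.
open Classical in
noncomputable def step {d : ℕ} (ω : Config d) (x y : Zd d) : ℝ :=
  if openAdj ω x y then ((nu ω x : ℝ))⁻¹ else 0

/-- Weight of a path of length `n`. -/
noncomputable def pathW {d n : ℕ} (ω : Config d) (γ : Fin (n + 1) → Zd d) : ℝ :=
  ∏ i : Fin n, step ω (γ i.castSucc) (γ i.succ)

/-- `N_n`: number of distinct sites visited by the path. -/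
noncomputable def visits {d n : ℕ} (γ : Fin (n + 1) → Zd d) : ℕ :=
  (Set.range γ).ncard

/-- `P_0^ω(E)`, the probability of a path event for the walk started at 0. -/
noncomputable def PWalk {d : ℕ} (ω : Config d) (n : ℕ)
    (E : (Fin (n + 1) → Zd d) → Prop) : ℝ :=
  ∑' γ : Fin (n + 1) → Zd d,
    Set.indicator {γ | γ 0 = 0 ∧ E γ} (fun γ => pathW ω γ) γ

/-- `E_0^ω(α^{N_n})`. -/
noncomputable def LaplaceN {d : ℕ} (ω : Config d) (α : ℝ) (n : ℕ) : ℝ :=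
  ∑' γ : Fin (n + 1) → Zd d,
    Set.indicator {γ | γ 0 = 0} (fun γ => pathW ω γ * α ^ visits γ) γ

/-- `E_0^ω(α^{N_n} 1_{X_n = 0})`. -/
noncomputable def LaplaceNReturn {d : ℕ} (ω : Config d) (α : ℝ) (n : ℕ) : ℝ :=
  ∑' γ : Fin (n + 1) → Zd d,
    Set.indicator {γ | γ 0 = 0 ∧ γ (Fin.last n) = 0}
      (fun γ => pathW ω γ * α ^ visits γ) γ

/-- Vertices of the wreath product `C^g ≀ Z/2Z` (lamplighter states). -/
abbrev Lamp (d : ℕ) := Zd d × (Zd d →₀ ZMod 2)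

/-- Flip a lamp configuration at one point. -/
noncomputable def flipAt {σ : Type*} (f : σ →₀ ZMod 2) (x : σ) : σ →₀ ZMod 2 :=
  f + Finsupp.single x 1

/-- Transition kernel of the lamplighter walk `Z` with parameter `α`. -/
noncomputable def ptilde {d : ℕ} (ω : Config d) (α : ℝ) (u v : Lamp d) : ℝ :=
  Set.indicator
    {q : Lamp d × Lamp d | ∀ x, x ≠ q.1.1 → x ≠ q.2.1 → q.1.2 x = q.2.2 x}
    (fun q => (if q.2.2 q.1.1 = 0 then α else 1 - α) *
      (if q.2.2 q.2.1 = 0 then α else 1 - α) * step ω q.1.1 q.2.1) (u, v)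

/-- `P̃_o^ω(Z_n = o)`: return probability of the lamplighter walk. -/
noncomputable def ZReturn {d : ℕ} (ω : Config d) (α : ℝ) (n : ℕ) : ℝ :=
  ∑' γ : Fin (n + 1) → Lamp d,
    Set.indicator {γ | γ 0 = (0, 0) ∧ γ (Fin.last n) = (0, 0)}
      (fun γ => ∏ i : Fin n, ptilde ω α (γ i.castSucc) (γ i.succ)) γ

/-- Vertex set of the wreath product over a vertex set `V` of the base. -/
def wVert {d : ℕ} (V : Set (Zd d)) : Set (Lamp d) :=
  {u | u.1 ∈ V ∧ ↑u.2.support ⊆ V}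

/-- Adjacency in the wreath product `C^g ≀ Z/2Z`. -/
def wAdj {d : ℕ} (ω : Config d) (u v : Lamp d) : Prop :=
  (u.1 = v.1 ∧ (∀ x, x ≠ u.1 → u.2 x = v.2 x) ∧ u.2 u.1 ≠ v.2 u.1) ∨
    (u.2 = v.2 ∧ openAdj ω u.1 v.1)

/-- Boundary of `U` in the wreath product `C^g ≀ Z/2Z`. -/
def wBdry {d : ℕ} (ω : Config d) (U : Set (Lamp d)) : Set (Lamp d × Lamp d) :=
  {e | e.1 ∈ U ∧ e.2 ∈ wVert (cluster ω) \ U ∧ wAdj ω e.1 e.2}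

/-- Følner function `Fol_{C_n^g}^{C^g}` (with value `⊤` when no set qualifies). -/
noncomputable def FolC {d : ℕ} (ω : Config d) (n : ℕ) (k : ℝ) : ℝ≥0∞ :=
  sInf {m : ℝ≥0∞ | ∃ A : Set (Zd d), A ⊆ clusterN ω n ∧ A.Nonempty ∧
    ((bdry ω A).ncard : ℝ) / (A.ncard : ℝ) ≤ 1 / k ∧ m = (A.ncard : ℝ≥0∞)}

/-- Følner function `Fol_{C_n^g ≀ Z/2Z}^{C^g ≀ Z/2Z}`. -/
noncomputable def FolW {d : ℕ} (ω : Config d) (n : ℕ) (k : ℝ) : ℝ≥0∞ :=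
  sInf {m : ℝ≥0∞ | ∃ U : Set (Lamp d), U ⊆ wVert (clusterN ω n) ∧ U.Nonempty ∧
    ((wBdry ω U).ncard : ℝ) / (U.ncard : ℝ) ≤ 1 / k ∧ m = (U.ncard : ℝ≥0∞)}

/-- Degree of a configuration `f` in the graph `K_U`. -/
noncomputable def Kdeg {d : ℕ} (U : Set (Lamp d)) (f : Zd d →₀ ZMod 2) : ℕ :=
  Set.ncard {g : Zd d →₀ ZMod 2 | ∃ x : Zd d, (x, f) ∈ U ∧ (x, g) ∈ U ∧ g = flipAt f x}

/-- A point `u = (x,f)` of `U` is bad if `(x, f̄_x) ∉ U`. -/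
def badPt {d : ℕ} (U : Set (Lamp d)) (u : Lamp d) : Prop :=
  (u.1, flipAt u.2 u.1) ∉ U

/-- `D(0,x) ≤ r`: the chemical distance from the origin to `x` is at most `r`. -/
def chemLE {d : ℕ} (ω : Config d) (x : Zd d) (r : ℕ) : Prop :=
  ∃ m ≤ r, ∃ γ : ℕ → Zd d, γ 0 = 0 ∧ γ m = x ∧ ∀ i < m, openAdj ω (γ i) (γ (i + 1))

/-- `B_r(C)`: chemical ball of radius `r` around the origin. -/
def chemBall {d : ℕ} (ω : Config d) (r : ℕ) : Set (Zd d) := {x | chemLE ω x r}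

/-- Lattice connected component of `x` inside a vertex set `V`. -/
def latCompIn {d : ℕ} (V : Set (Zd d)) (x : Zd d) : Set (Zd d) :=
  {y | Relation.ReflTransGen (fun a b => latAdj a b ∧ a ∈ V ∧ b ∈ V) x y}

/-- Open connected component of `x` inside a vertex set `V`. -/
def openCompIn {d : ℕ} (ω : Config d) (V : Set (Zd d)) (x : Zd d) : Set (Zd d) :=
  {y | Relation.ReflTransGen (fun a b => openAdj ω a b ∧ a ∈ V ∧ b ∈ V) x y}

/-- `L_n`: a connected component of the open subgraph inside `B_n` of maximal cardinality. -/
def IsLargestComp {d : ℕ} (ω : Config d) (n : ℕ) (L : Set (Zd d)) : Prop :=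
  (∃ x ∈ box d n, L = openCompIn ω (box d n) x) ∧
    ∀ y ∈ box d n, (openCompIn ω (box d n) y).ncard ≤ L.ncard

/-- `\bar L`: the connected component of `L` in the full open subgraph. -/
def closureOf {d : ℕ} (ω : Config d) (L : Set (Zd d)) : Set (Zd d) :=
  {y | ∃ x ∈ L, Relation.ReflTransGen (openAdj ω) x y}

/-- The boundary `∂_{\bar L_n^g} A`. -/
def bdryBar {d : ℕ} (ω : Config d) (n : ℕ) (L A : Set (Zd d)) : Set (Zd d × Zd d) :=
  {e | openAdj ω e.1 e.2 ∧ e.1 ∈ A ∩ closureOf ω L ∧ e.2 ∈ box d (n + 1) \ A}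

/-- `n(A)`: number of connected components of `B_n − L` containing a component of `A`. -/
noncomputable def nComp {d : ℕ} (n : ℕ) (L A : Set (Zd d)) : ℕ :=
  Set.ncard {P : Set (Zd d) |
    (∃ x ∈ box d n \ L, P = latCompIn (box d n \ L) x) ∧
    ∃ x ∈ A, latCompIn A x ⊆ P}

/-- The killed kernel `P^{B_r(C)}` acting on functions. -/
noncomputable def Pball {d : ℕ} (ω : Config d) (r : ℕ) (f : Zd d → ℝ) : Zd d → ℝ :=
  Set.indicator (chemBall ω r) (fun x =>
    ∑' y : Zd d, Set.indicator (chemBall ω r) (fun y => step ω x y * f y) y)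

/-- The Dirichlet form `ξ(f,f) = ((Id − P^{B_r(C)}) 1_{B_r(C)} f | f)_ν`. -/
noncomputable def dirichletForm {d : ℕ} (ω : Config d) (r : ℕ) (f : Zd d → ℝ) : ℝ :=
  ∑' x : Zd d, (nu ω x : ℝ) * f x *
    (Set.indicator (chemBall ω r) f x - Pball ω r (Set.indicator (chemBall ω r) f) x)

/-- `‖f‖²_{l²(ν)}`. -/
noncomputable def normSq {d : ℕ} (ω : Config d) (f : Zd d → ℝ) : ℝ :=
  ∑' x : Zd d, (nu ω x : ℝ) * f x ^ 2

/-- `λ_1(B_r(C))`: smallest Dirichlet eigenvalue of the killed walk. -/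
noncomputable def lambda1 {d : ℕ} (ω : Config d) (r : ℕ) : ℝ :=
  sInf {t : ℝ | ∃ f : Zd d → ℝ, f ≠ 0 ∧ Function.support f ⊆ chemBall ω r ∧
    t = dirichletForm ω r f / normSq ω f}

section ProductMeasure

variable {ι : Type*}

/-- `A` is determined by the coordinates in `S`. -/
def Det (A : Set (ι → Bool)) (S : Set ι) : Prop :=
  ∀ ω ω' : ι → Bool, (∀ e ∈ S, ω e = ω' e) → (ω ∈ A ↔ ω' ∈ A)

lemma Det.mono {A : Set (ι → Bool)} {S T : Set ι} (h : Det A S) (hST : S ⊆ T) : Det A T :=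
  fun ω ω' hω => h ω ω' fun e he => hω e (hST he)

lemma Det.compl {A : Set (ι → Bool)} {S : Set ι} (h : Det A S) : Det Aᶜ S :=
  fun ω ω' hω => not_congr (h ω ω' hω)

lemma Det.inter {A B : Set (ι → Bool)} {S : Set ι} (h : Det A S) (h' : Det B S) :
    Det (A ∩ B) S :=
  fun ω ω' hω => and_congr (h ω ω' hω) (h' ω ω' hω)

lemma Det.measurableSet {A : Set (ι → Bool)} {S : Set ι} (hS : S.Finite) (h : Det A S) :
    MeasurableSet A := by
  have : Finite S := hS
  have : A = (fun (ω : ι → Bool) (e : S) => ω e) ⁻¹' {a | ∃ ω ∈ A, (fun e : S => ω e) = a} := by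
    ext ω
    constructor
    · intro hω
      exact ⟨ω, hω, rfl⟩
    · rintro ⟨ω', hω', he⟩
      exact (h ω' ω fun e hes => congrFun he ⟨e, hes⟩).1 hω'
  rw [this]
  exact (Set.toFinite _).measurableSet.preimage (by fun_prop)

/-- The Bernoulli law on `Bool`. -/
noncomputable def bern (q : unitInterval) : Measure Bool :=
  ENNReal.ofReal q • Measure.dirac true + ENNReal.ofReal (1 - q) • Measure.dirac false

instance (q : unitInterval) : IsProbabilityMeasure (bern q) := by
  constructor
  have h1 := q.2.1
  have h2 := q.2.2
  simp only [bern, Measure.add_apply, Measure.smul_apply, measure_univ, smul_eq_mul, mul_one]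
  rw [← ENNReal.ofReal_add h1 (by linarith)]
  simp

lemma bern_singleton (q : unitInterval) (b : Bool) :
    bern q {b} = if b then ENNReal.ofReal q else ENNReal.ofReal (1 - q) := by
  cases b <;> simp [bern]

/-- The product of Bernoulli laws. -/
noncomputable def prodM (q : ι → unitInterval) : Measure (ι → Bool) :=
  Measure.infinitePi fun i => bern (q i)

instance (q : ι → unitInterval) : IsProbabilityMeasure (prodM q) := by
  unfold prodM; infer_instance

lemma prodM_cyl (q : ι → unitInterval) (s : Finset ι) (f : ι → Bool) :
    prodM q {ω | ∀ e ∈ s, ω e = f e} =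
      ∏ e ∈ s, (if f e then ENNReal.ofReal (q e) else ENNReal.ofReal (1 - q e)) := by
  have : {ω : ι → Bool | ∀ e ∈ s, ω e = f e} = Set.pi s fun e => {f e} := by
    ext; simp [Set.mem_pi]
  rw [this, prodM, Measure.infinitePi_pi _ (fun _ _ => MeasurableSet.singleton _)]
  exact Finset.prod_congr rfl fun e _ => bern_singleton _ _

lemma eq_prodM (q : ι → unitInterval) (μ : Measure (ι → Bool)) (h : ∀ (s : Finset ι) (f : ι → Bool),
    μ {ω | ∀ e ∈ s, ω e = f e} =
      ∏ e ∈ s, (if f e then ENNReal.ofReal (q e) else ENNReal.ofReal (1 - q e))) :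
    μ = prodM q := by
  refine (Measure.isProjectiveLimit_infinitePi fun i => bern (q i)).unique ?_ |>.symm
  intro s
  refine Measure.ext_of_singleton fun a => ?_
  classical
  rw [Measure.map_apply (by fun_prop) (MeasurableSet.singleton _), Measure.pi_singleton]
  set f : ι → Bool := fun i => if hi : i ∈ s then a ⟨i, hi⟩ else false with hf
  have hset : s.restrict (π := fun _ => Bool) ⁻¹' {a} = {ω : ι → Bool | ∀ e ∈ s, ω e = f e} := by
    ext ω
    have : s.restrict ω = a ↔ ∀ e ∈ s, ω e = f e := by
      rw [funext_iff, Subtype.forall]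
      refine forall_congr' fun e => forall_congr' fun he => ?_
      simp [hf, he]
    exact this
  rw [hset, h, ← Finset.prod_coe_sort]
  refine Finset.prod_congr rfl fun e _ => ?_
  rw [bern_singleton]
  simp [hf]

lemma det_measurable_iSup {A : Set (ι → Bool)} {S : Set ι} (hA : MeasurableSet A) (h : Det A S) :
    MeasurableSet[⨆ i ∈ S, MeasurableSpace.comap (fun ω : ι → Bool => ω i) inferInstance] A := by
  classical
  let r : (ι → Bool) → (ι → Bool) := fun ω i => if i ∈ S then ω i else false
  have hr : A = r ⁻¹' A := by
    ext ω
    refine h ω (r ω) fun e he => ?_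
    simp [r, he]
  rw [hr]
  refine (show @Measurable _ _ (⨆ i ∈ S, MeasurableSpace.comap (fun ω : ι → Bool => ω i)
    inferInstance) _ r from ?_) hA
  refine @measurable_pi_lambda _ _ _ (_) _ r fun i => ?_
  by_cases hi : i ∈ S
  · simp only [r, hi, if_true]
    refine Measurable.mono (comap_measurable _) ?_ le_rfl
    exact le_iSup₂ (f := fun i _ => MeasurableSpace.comap (fun ω : ι → Bool => ω i) inferInstance) i hi
  · simp only [r, hi, if_false]
    exact @measurable_const _ _ _ (_) _

lemma indep_det (q : ι → unitInterval) {A B : Set (ι → Bool)} {S T : Set ι}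
    (hA : MeasurableSet A) (hB : MeasurableSet B) (hAS : Det A S) (hBT : Det B T)
    (hST : Disjoint S T) : (prodM q).real (A ∩ B) = (prodM q).real A * (prodM q).real B := by
  have h0 : ProbabilityTheory.iIndepFun (fun i (ω : ι → Bool) => ω i) (prodM q) :=
    ProbabilityTheory.iIndepFun_infinitePi (X := fun _ b => b) (fun _ => measurable_id)
  have := ProbabilityTheory.indep_iSup_of_disjoint
    (m := fun i => MeasurableSpace.comap (fun ω : ι → Bool => ω i) inferInstance)
    (fun i => (measurable_pi_apply i).comap_le) h0 hST
  rw [ProbabilityTheory.Indep_iff] at this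
  have := this A B (det_measurable_iSup hA hAS) (det_measurable_iSup hB hBT)
  simp only [Measure.real, this, ENNReal.toReal_mul]

lemma indep_family (q : ι → unitInterval) {κ : Type*} {A : Set (ι → Bool)} {E : κ → Set (ι → Bool)}
    {S : Set ι} {T : κ → Set ι} (hA : MeasurableSet A) (hAS : Det A S)
    (hE : ∀ k, MeasurableSet (E k)) (hET : ∀ k, Det (E k) (T k)) (N : Finset κ)
    (hd : ∀ k ∈ N, Disjoint S (T k)) (hp : (N : Set κ).PairwiseDisjoint T) :
    (prodM q).real (A ∩ {ω | ∀ k ∈ N, ω ∈ E k}) =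
      (prodM q).real A * ∏ k ∈ N, (prodM q).real (E k) := by
  classical
  induction N using Finset.induction_on with
  | empty => simp
  | insert k N hk ih =>
    have h1 : A ∩ {ω | ∀ j ∈ insert k N, ω ∈ E j} = (A ∩ {ω | ∀ j ∈ N, ω ∈ E j}) ∩ E k := by
      ext ω; simp; tauto
    rw [Finset.prod_insert hk, h1, indep_det q (S := S ∪ ⋃ j ∈ N, T j) (T := T k) _ (hE k) _ (hET k),
      ih (fun j hj => hd j (by simp [hj])) (hp.subset (by simp))]
    · ring
    · rw [Set.disjoint_union_left]
      refine ⟨hd k (by simp), ?_⟩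
      simp only [Set.disjoint_iUnion_left]
      intro j hj
      exact hp (by simp [hj]) (by simp) (by rintro rfl; exact hk hj)
    · refine hA.inter ?_
      have : {ω | ∀ j ∈ N, ω ∈ E j} = ⋂ j ∈ N, E j := by ext; simp
      rw [this]
      exact Finset.measurableSet_biInter _ fun j _ => hE j
    · refine (hAS.mono Set.subset_union_left).inter ?_
      intro ω ω' hω
      refine forall_congr' fun j => forall_congr' fun hj => hET j ω ω' fun e he => hω e ?_
      exact Or.inr (Set.mem_biUnion (show j ∈ (N : Set κ) from hj) he)

lemma fiber_le {Ω β : Type*} [MeasurableSpace Ω] [Countable β] {μ : Measure Ω} [IsFiniteMeasure μ]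
    (X : Ω → β) (hX : ∀ b, MeasurableSet (X ⁻¹' {b})) {A B : Set Ω} {c c' : ℝ} (hc : 0 ≤ c)
    (hc' : 0 ≤ c')
    (h : ∀ b, c * μ.real (A ∩ X ⁻¹' {b}) ≤ c' * μ.real (B ∩ X ⁻¹' {b})) :
    c * μ.real A ≤ c' * μ.real B := by
  have key : ∀ A : Set Ω, μ A = ∑' b, μ (A ∩ X ⁻¹' {b}) := by
    intro A
    have := tsum_measure_preimage_singleton (μ := μ.restrict A) (s := (Set.univ : Set β))
      Set.countable_univ (f := X) (fun y _ => hX y)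
    rw [Set.preimage_univ, Measure.restrict_apply_univ, tsum_univ (fun b => (μ.restrict A) (X ⁻¹' {b}))]
      at this
    rw [← this]
    exact tsum_congr fun b => by rw [Measure.restrict_apply (hX b), Set.inter_comm]
  have hh : ENNReal.ofReal c * μ A ≤ ENNReal.ofReal c' * μ B := by
    rw [key A, key B, ← ENNReal.tsum_mul_left, ← ENNReal.tsum_mul_left]
    refine ENNReal.tsum_le_tsum fun b => ?_
    have := ENNReal.ofReal_le_ofReal (h b)
    rwa [ENNReal.ofReal_mul hc, ENNReal.ofReal_mul hc', ofReal_measureReal, ofReal_measureReal]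
      at this
  have := ENNReal.toReal_mono (by finiteness) hh
  simpa [ENNReal.toReal_mul, hc, hc', Measure.real] using this

section RandomFamily

variable (q : ι → unitInterval) {κ : Type*} {G : Set (ι → Bool)}
  {E : κ → Set (ι → Bool)} {S : Set ι} {T : κ → Set ι}

lemma random_family_eq
    (hG : MeasurableSet G) (hGS : Det G S) (hE : ∀ k, MeasurableSet (E k))
    (hET : ∀ k, Det (E k) (T k)) (N : (ι → Bool) → Finset κ)
    (hN : ∀ b, MeasurableSet (N ⁻¹' {b})) (hNS : ∀ b, Det (N ⁻¹' {b}) S)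
    (hd : ∀ ω ∈ G, ∀ k ∈ N ω, Disjoint S (T k))
    (hp : ∀ ω ∈ G, (N ω : Set κ).PairwiseDisjoint T)
    (b : Finset κ) :
    (prodM q).real (G ∩ {ω | ∀ k ∈ N ω, ω ∉ E k} ∩ N ⁻¹' {b}) =
      (prodM q).real (G ∩ N ⁻¹' {b}) * ∏ k ∈ b, (1 - (prodM q).real (E k)) := by
  rcases (G ∩ N ⁻¹' {b}).eq_empty_or_nonempty with h0 | ⟨ω₀, hω₀, hb⟩
  · have : G ∩ {ω | ∀ k ∈ N ω, ω ∉ E k} ∩ N ⁻¹' {b} = ∅ := by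
      rw [← Set.subset_empty_iff, ← h0]
      exact fun ω h => ⟨h.1.1, h.2⟩
    rw [this, h0]; simp
  · have hb : N ω₀ = b := hb
    have h1 : G ∩ {ω | ∀ k ∈ N ω, ω ∉ E k} ∩ N ⁻¹' {b} =
        (G ∩ N ⁻¹' {b}) ∩ {ω | ∀ k ∈ b, ω ∈ (E k)ᶜ} := by
      ext ω
      simp only [Set.mem_inter_iff, Set.mem_ofPred_eq, Set.mem_preimage, Set.mem_singleton_iff,
        Set.mem_compl_iff]
      constructor
      · rintro ⟨⟨h1, h2⟩, h3⟩
        exact ⟨⟨h1, h3⟩, by rwa [← h3]⟩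
      · rintro ⟨⟨h1, h3⟩, h2⟩
        exact ⟨⟨h1, by rwa [h3]⟩, h3⟩
    rw [h1, indep_family q (hG.inter (hN b)) (hGS.inter (hNS b)) (fun k => (hE k).compl)
      (fun k => (hET k).compl) b (fun k hk => hd ω₀ hω₀ k (hb ▸ hk)) (hb ▸ hp ω₀ hω₀)]
    congr 1
    exact Finset.prod_congr rfl fun k _ => probReal_compl_eq_one_sub (hE k)

lemma random_family_le [Countable κ]
    (hG : MeasurableSet G) (hGS : Det G S) (hE : ∀ k, MeasurableSet (E k))
    (hET : ∀ k, Det (E k) (T k)) (N : (ι → Bool) → Finset κ)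
    (hN : ∀ b, MeasurableSet (N ⁻¹' {b})) (hNS : ∀ b, Det (N ⁻¹' {b}) S)
    (hd : ∀ ω ∈ G, ∀ k ∈ N ω, Disjoint S (T k))
    (hp : ∀ ω ∈ G, (N ω : Set κ).PairwiseDisjoint T)
    {ρ : ℝ} (hρ0 : 0 ≤ ρ) (hρ1 : ρ ≤ 1)
    (hEρ : ∀ k, ρ ≤ (prodM q).real (E k)) (t : ℕ) :
    (prodM q).real (G ∩ {ω | t ≤ (N ω).card ∧ ∀ k ∈ N ω, ω ∉ E k}) ≤
      (1 - ρ) ^ t * (prodM q).real G := by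
  rw [← one_mul ((prodM q).real _)]
  refine fiber_le N hN zero_le_one (pow_nonneg (by linarith) t) fun b => ?_
  rw [one_mul]
  by_cases hb : t ≤ b.card
  · have h1 : G ∩ {ω | t ≤ (N ω).card ∧ ∀ k ∈ N ω, ω ∉ E k} ∩ N ⁻¹' {b} ⊆
        G ∩ {ω | ∀ k ∈ N ω, ω ∉ E k} ∩ N ⁻¹' {b} := fun ω h => ⟨⟨h.1.1, h.1.2.2⟩, h.2⟩
    refine (measureReal_mono h1).trans ?_
    rw [random_family_eq q hG hGS hE hET N hN hNS hd hp, mul_comm]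
    refine mul_le_mul_of_nonneg_right ?_ measureReal_nonneg
    calc ∏ k ∈ b, (1 - (prodM q).real (E k)) ≤ ∏ k ∈ b, (1 - ρ) :=
          Finset.prod_le_prod (fun k _ => by linarith [measureReal_le_one (μ := prodM q) (s := E k)])
            fun k _ => by linarith [hEρ k]
      _ = (1 - ρ) ^ b.card := by simp
      _ ≤ (1 - ρ) ^ t := pow_le_pow_of_le_one (by linarith) (by linarith) hb
  · have : G ∩ {ω | t ≤ (N ω).card ∧ ∀ k ∈ N ω, ω ∉ E k} ∩ N ⁻¹' {b} = ∅ := by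
      rw [← Set.subset_empty_iff]
      rintro ω ⟨⟨_, h, _⟩, h2⟩
      rw [Set.mem_preimage, Set.mem_singleton_iff] at h2
      exact hb (h2 ▸ h)
    rw [this]
    simp only [measureReal_empty]
    exact mul_nonneg (pow_nonneg (by linarith) t) measureReal_nonneg

lemma random_family_ge [Countable κ]
    (hG : MeasurableSet G) (hGS : Det G S) (hE : ∀ k, MeasurableSet (E k))
    (hET : ∀ k, Det (E k) (T k)) (N : (ι → Bool) → Finset κ)
    (hN : ∀ b, MeasurableSet (N ⁻¹' {b})) (hNS : ∀ b, Det (N ⁻¹' {b}) S)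
    (hd : ∀ ω ∈ G, ∀ k ∈ N ω, Disjoint S (T k))
    (hp : ∀ ω ∈ G, (N ω : Set κ).PairwiseDisjoint T)
    {ρ : ℝ} (hρ0 : 0 ≤ ρ) (hρ1 : ρ ≤ 1)
    (hEρ : ∀ k, (prodM q).real (E k) ≤ ρ) (t : ℕ) :
    (1 - ρ) ^ t * (prodM q).real (G ∩ {ω | (N ω).card ≤ t}) ≤
      (prodM q).real (G ∩ {ω | ∀ k ∈ N ω, ω ∉ E k}) := by
  rw [← one_mul ((prodM q).real (G ∩ {ω | ∀ k ∈ N ω, ω ∉ E k}))]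
  refine fiber_le N hN (pow_nonneg (by linarith) t) zero_le_one fun b => ?_
  rw [one_mul, random_family_eq q hG hGS hE hET N hN hNS hd hp]
  by_cases hb : b.card ≤ t
  · rw [mul_comm]
    refine mul_le_mul (measureReal_mono fun ω h => ⟨h.1.1, h.2⟩) ?_
      (pow_nonneg (by linarith) t) measureReal_nonneg
    calc (1 - ρ) ^ t ≤ (1 - ρ) ^ b.card := pow_le_pow_of_le_one (by linarith) (by linarith) hb
      _ = ∏ k ∈ b, (1 - ρ) := by simp
      _ ≤ _ := Finset.prod_le_prod (fun k _ => by linarith) fun k _ => by linarith [hEρ k]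
  · have : G ∩ {ω | (N ω).card ≤ t} ∩ N ⁻¹' {b} = ∅ := by
      rw [← Set.subset_empty_iff]
      rintro ω ⟨⟨_, h⟩, h2⟩
      rw [Set.mem_preimage, Set.mem_singleton_iff] at h2
      exact hb (h2 ▸ h)
    rw [this]
    simp only [measureReal_empty, mul_zero]
    exact mul_nonneg measureReal_nonneg (Finset.prod_nonneg fun k _ => by
      linarith [measureReal_le_one (μ := prodM q) (s := E k)])

end RandomFamily

end ProductMeasure

section ProductMeasure

variable {ι : Type*}

lemma prodM_map_inj {ι' : Type*} (q : ι → unitInterval) {σ : ι' → ι} (hσ : Function.Injective σ) :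
    (prodM q).map (fun ω i => ω (σ i)) = prodM (q ∘ σ) :=
  Measure.map_infinitePi_infinitePi_of_inj (P := fun i => bern (q i)) hσ

lemma prodM_real_eq (q : ι → unitInterval) (e : ι) (b : Bool) :
    (prodM q).real {ω | ω e = b} = if b then (q e : ℝ) else 1 - q e := by
  have := prodM_cyl q {e} (fun _ => b)
  simp only [Finset.mem_singleton, forall_eq, Finset.prod_singleton] at this
  rw [Measure.real, this]
  have h1 := (q e).2.1
  have h2 := (q e).2.2
  cases b <;> simp [h1, h2]

lemma det_coord (e : ι) (b : Bool) : Det {ω : ι → Bool | ω e = b} {e} := by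
  intro ω ω' h
  simp [h e rfl]

lemma measurableSet_coord (e : ι) (b : Bool) : MeasurableSet {ω : ι → Bool | ω e = b} :=
  (det_coord e b).measurableSet (Set.finite_singleton e)

lemma prodM_map_or {J κ : Type*} [Fintype κ] (p p' ε : unitInterval)
    (h : (1 - p : ℝ) = (1 - p') * (1 - ε) ^ Fintype.card κ) :
    (prodM (fun i : Option κ × J => if i.1 = none then p' else ε)).map
      (fun ω e => decide (∃ k, ω (k, e) = true)) = prodM fun _ => p := by
  classical
  set q : Option κ × J → unitInterval := fun i => if i.1 = none then p' else ε with hq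
  set F : (Option κ × J → Bool) → J → Bool := fun ω e => decide (∃ k, ω (k, e) = true) with hF
  have hdet : ∀ e b, Det {ω | F ω e = b} (Set.univ ×ˢ {e}) := by
    intro e b ω ω' hω
    have : F ω e = F ω' e := by
      simp only [hF]
      congr 1
      exact propext (exists_congr fun k => by rw [hω (k, e) ⟨trivial, rfl⟩])
    change F ω e = b ↔ F ω' e = b
    rw [this]
  have hfin : ∀ e : J, ((Set.univ : Set (Option κ)) ×ˢ ({e} : Set J)).Finite := fun e =>
    Set.finite_univ.prod (Set.finite_singleton e)
  have hmeas : ∀ e b, MeasurableSet {ω | F ω e = b} := fun e b => (hdet e b).measurableSet (hfin e)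
  have hFm : Measurable F := by
    refine measurable_pi_lambda _ fun e => ?_
    exact measurable_to_countable' fun b => hmeas e b
  have hfalse : ∀ e, (prodM q).real {ω | F ω e = false} = 1 - p := by
    intro e
    have h1 : {ω | F ω e = false} = Set.univ ∩ {ω | ∀ i ∈ (Finset.univ.map
        ⟨fun k : Option κ => (k, e), fun a b hab => (Prod.ext_iff.1 hab).1⟩), ω ∈ {ω | ω i = false}} := by
      ext ω
      simp only [hF, Set.mem_ofPred_eq, decide_eq_false_iff_not, Finset.mem_map, Finset.mem_univ,
        true_and, Set.univ_inter, forall_exists_index, forall_apply_eq_imp_iff]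
      simp only [Bool.not_eq_true, not_exists]
      rfl
    rw [h1, indep_family q (S := ∅) (T := fun i => {i}) MeasurableSet.univ (fun _ _ _ => Iff.rfl)
      (fun i => measurableSet_coord i false) (fun i => det_coord i false) _ (by simp)
      (by intro a _ b _ hab; simpa using hab)]
    rw [Finset.prod_map]
    change (prodM q).real Set.univ * ∏ k : Option κ, (prodM q).real {ω | ω (k, e) = false} = _
    simp only [prodM_real_eq, Fintype.prod_option]
    simp [hq, h]
  symm
  refine (eq_prodM _ _ fun s f => ?_).symm
  rw [Measure.map_apply hFm]
  swap
  · have : {ω : J → Bool | ∀ e ∈ s, ω e = f e} = ⋂ e ∈ s, {ω | ω e = f e} := by ext; simp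
    rw [this]
    exact Finset.measurableSet_biInter _ fun e _ => measurableSet_coord e _
  have h2 : F ⁻¹' {ω : J → Bool | ∀ e ∈ s, ω e = f e} =
      Set.univ ∩ {ω | ∀ e ∈ s, ω ∈ {ω | F ω e = f e}} := by ext; simp
  have h3 := indep_family q (S := ∅) (T := fun e => Set.univ ×ˢ {e}) MeasurableSet.univ
    (fun _ _ _ => Iff.rfl) (fun e => hmeas e (f e)) (fun e => hdet e (f e)) s (by simp)
    (by
      intro a _ b _ hab
      rw [Function.onFun, Set.disjoint_left]
      rintro ⟨x, y⟩ ⟨_, h1⟩ ⟨_, h2⟩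
      exact hab (h1.symm.trans h2))
  rw [← h2] at h3
  have h4 : ∀ e, (prodM q).real {ω | F ω e = f e} = if f e then (p : ℝ) else 1 - p := by
    intro e
    cases hfe : f e
    · simpa using hfalse e
    · have : {ω | F ω e = true} = {ω | F ω e = false}ᶜ := by ext; simp
      rw [this, probReal_compl_eq_one_sub (hmeas e false), hfalse e]
      simp
  simp only [h4, probReal_univ, one_mul] at h3
  rw [← ofReal_measureReal, h3, ENNReal.ofReal_prod_of_nonneg]
  · exact Finset.prod_congr rfl fun e _ => by split_ifs <;> rfl
  · intro e _
    split_ifs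
    · exact p.2.1
    · linarith [p.2.2]

/-- Increasing events. -/
def Incr (A : Set (ι → Bool)) : Prop := ∀ ω ω', ω ∈ A → (∀ e, ω e = true → ω' e = true) → ω' ∈ A

lemma prodM_real_eq_sum (q : ι → unitInterval) {A : Set (ι → Bool)} {S : Finset ι}
    [DecidableEq ι] (hA : Det A S) [DecidablePred (· ∈ A)] :
    (prodM q).real A = ∑ a : S → Bool, (∏ e, if a e then (q e : ℝ) else 1 - q e) *
      (if (fun i => if h : i ∈ S then a ⟨i, h⟩ else false) ∈ A then 1 else 0) := by
  set ext : (S → Bool) → ι → Bool := fun a i => if h : i ∈ S then a ⟨i, h⟩ else false with hext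
  have h1 : A = (S.restrict (π := fun _ => Bool)) ⁻¹' {a | ext a ∈ A} := by
    ext ω
    refine hA ω _ fun e he => ?_
    have he' : e ∈ S := he
    simp [hext, he']
  have h2 : (prodM q).real A = ((prodM q).map (S.restrict (π := fun _ => Bool))).real
      (({a | ext a ∈ A} : Set (S → Bool)).toFinset : Set (S → Bool)) := by
    rw [Set.coe_toFinset, measureReal_def, measureReal_def, Measure.map_apply (by fun_prop)
      (Set.toFinite _).measurableSet, ← h1]
  rw [h2, prodM, Measure.infinitePi_map_restrict, ← sum_measureReal_singleton, Finset.sum_filter_of_ne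
    (p := fun _ => True) (by simp) |>.symm]
  rw [Finset.filter_true, ← Finset.sum_subset (Finset.subset_univ
    ({a | ext a ∈ A} : Set (S → Bool)).toFinset)]
  · refine Finset.sum_congr rfl fun a ha => ?_
    have ha' : ext a ∈ A := by simpa using ha
    rw [if_pos ha', mul_one, measureReal_def, Measure.pi_singleton, ENNReal.toReal_prod]
    refine Finset.prod_congr rfl fun e _ => ?_
    rw [bern_singleton]
    have h1 := (q e).2.1
    have h2 := (q e).2.2
    split_ifs
    · simp [h1]
    · simp [h2]
  · intro a _ ha
    have ha' : ext a ∉ A := by simpa using ha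
    rw [if_neg ha', mul_zero]

lemma harris_incr (q : ι → unitInterval) {A B : Set (ι → Bool)} {S : Finset ι}
    (hA : Det A S) (hB : Det B S) (hAi : Incr A) (hBi : Incr B) :
    (prodM q).real A * (prodM q).real B ≤ (prodM q).real (A ∩ B) := by
  classical
  have h1 : ∑ a : S → Bool, (∏ e, if a e then (q e : ℝ) else 1 - q e) = 1 := by
    have := prodM_real_eq_sum q (A := Set.univ) (S := S) (fun _ _ _ => Iff.rfl)
    simpa using this.symm
  rw [prodM_real_eq_sum q hA, prodM_real_eq_sum q hB, prodM_real_eq_sum q (hA.inter hB)]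
  have hext : ∀ a b : S → Bool, a ≤ b → ∀ i : ι, (if h : i ∈ S then a ⟨i, h⟩ else false) = true →
      (if h : i ∈ S then b ⟨i, h⟩ else false) = true := by
    intro a b hab i
    split_ifs with hi
    · exact fun h => (hab ⟨i, hi⟩) h
    · simp
  have key := fkg (α := S → Bool)
    (μ := fun a => ∏ e, if a e then (q e : ℝ) else 1 - q e)
    (f := fun a => if (fun i => if h : i ∈ S then a ⟨i, h⟩ else false) ∈ A then (1 : ℝ) else 0)
    (g := fun a => if (fun i => if h : i ∈ S then a ⟨i, h⟩ else false) ∈ B then (1 : ℝ) else 0)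
    ?_ ?_ ?_ ?_ ?_ ?_
  · rw [h1, one_mul] at key
    refine key.trans (le_of_eq (Finset.sum_congr rfl fun a _ => ?_))
    congr 1
    by_cases h2 : (fun i => if h : i ∈ S then a ⟨i, h⟩ else false) ∈ A <;>
      by_cases h3 : (fun i => if h : i ∈ S then a ⟨i, h⟩ else false) ∈ B <;>
      simp only [h2, h3, Set.mem_inter_iff, if_true, if_false, and_true, and_false, mul_one,
        mul_zero]
  · intro a
    refine Finset.prod_nonneg fun e _ => ?_
    have h1 := (q e).2.1
    have h2 := (q e).2.2
    split_ifs <;> simp [h1, h2]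
  · intro a; dsimp; split_ifs <;> simp
  · intro a; dsimp; split_ifs <;> simp
  · intro a b hab
    dsimp
    split_ifs with h1 h2
    · rfl
    · exact absurd (hAi _ _ h1 (hext a b hab)) h2
    · simp
    · rfl
  · intro a b hab
    dsimp
    split_ifs with h1 h2
    · rfl
    · exact absurd (hBi _ _ h1 (hext a b hab)) h2
    · simp
    · rfl
  · intro a b
    rw [← Finset.prod_mul_distrib, ← Finset.prod_mul_distrib]
    refine le_of_eq (Finset.prod_congr rfl fun e _ => ?_)
    rw [Pi.inf_apply, Pi.sup_apply]
    cases a e <;> cases b e <;> simp [mul_comm]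

lemma harris_incr_compl (q : ι → unitInterval) {κ : Type*} (N : Finset κ) {A : κ → Set (ι → Bool)}
    {S : Finset ι} (hA : ∀ k, Det (A k) S) (hAi : ∀ k, Incr (A k)) :
    ∏ k ∈ N, (1 - (prodM q).real (A k)) ≤ 1 - (prodM q).real {ω | ∃ k ∈ N, ω ∈ A k} := by
  classical
  induction N using Finset.induction_on with
  | empty => simp
  | insert k N hk ih =>
    have hm : ∀ {A : Set (ι → Bool)}, Det A S → MeasurableSet A := fun h =>
      h.measurableSet S.finite_toSet
    set B := {ω | ∃ j ∈ N, ω ∈ A j} with hB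
    have hBd : Det B S := by
      intro ω ω' h
      exact exists_congr fun j => and_congr_right fun _ => hA j ω ω' h
    have hBi : Incr B := fun ω ω' ⟨j, hj, h⟩ h' => ⟨j, hj, hAi j ω ω' h h'⟩
    have h1 : {ω | ∃ j ∈ insert k N, ω ∈ A j} = A k ∪ B := by
      ext ω; simp [hB]
    have h2 := measureReal_union_add_inter (μ := prodM q) (s := A k) (hm hBd)
    have h3 := harris_incr q (hA k) hBd (hAi k) hBi
    rw [Finset.prod_insert hk, h1]
    have h4 : (prodM q).real (A k) ≤ 1 := measureReal_le_one
    nlinarith [mul_le_mul_of_nonneg_left ih (show 0 ≤ 1 - (prodM q).real (A k) by linarith)]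

end ProductMeasure

section Basics

variable {d : ℕ}

lemma latAdj_symm {x y : Zd d} (h : latAdj x y) : latAdj y x := by
  unfold latAdj at *
  rw [← h]
  exact Finset.sum_congr rfl fun i _ => abs_sub_comm _ _

lemma latAdj.abs_sub_le {x y : Zd d} (h : latAdj x y) (i : Fin d) : |x i - y i| ≤ 1 := by
  rw [← h]
  exact Finset.single_le_sum (f := fun i => |x i - y i|) (fun _ _ => abs_nonneg _)
    (Finset.mem_univ i)

lemma latAdj.ne {x y : Zd d} (h : latAdj x y) : x ≠ y := by
  rintro rfl
  simp [latAdj] at h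

lemma openAdj_symm {ω : Config d} {x y : Zd d} (h : openAdj ω x y) : openAdj ω y x :=
  ⟨latAdj_symm h.1, by rw [Sym2.eq_swap]; exact h.2⟩

/-- Open adjacency inside a vertex set. -/
def inAdj (ω : Config d) (S : Set (Zd d)) (a b : Zd d) : Prop := openAdj ω a b ∧ a ∈ S ∧ b ∈ S

/-- Connection by an open path inside `S`. -/
def conn (ω : Config d) (S : Set (Zd d)) (x y : Zd d) : Prop :=
  x ∈ S ∧ Relation.ReflTransGen (inAdj ω S) x y

lemma conn.refl {ω : Config d} {S : Set (Zd d)} {x : Zd d} (h : x ∈ S) : conn ω S x x := ⟨h, .refl⟩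

lemma conn.mem {ω : Config d} {S : Set (Zd d)} {x y : Zd d} (h : conn ω S x y) : y ∈ S := by
  obtain ⟨hx, h⟩ := h
  rcases Relation.ReflTransGen.cases_tail h with h | ⟨_, _, h⟩
  · exact h ▸ hx
  · exact h.2.2

lemma conn.trans {ω : Config d} {S : Set (Zd d)} {x y z : Zd d} (h : conn ω S x y)
    (h' : conn ω S y z) : conn ω S x z := ⟨h.1, h.2.trans h'.2⟩

lemma conn.tail {ω : Config d} {S : Set (Zd d)} {x y z : Zd d} (h : conn ω S x y)
    (h' : openAdj ω y z) (hz : z ∈ S) : conn ω S x z := ⟨h.1, h.2.tail ⟨h', h.mem, hz⟩⟩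

lemma conn.symm {ω : Config d} {S : Set (Zd d)} {x y : Zd d} (h : conn ω S x y) :
    conn ω S y x := by
  refine ⟨h.mem, ?_⟩
  have : Std.Symm (inAdj ω S) := ⟨fun a b hab => ⟨openAdj_symm hab.1, hab.2.2, hab.2.1⟩⟩
  exact (Relation.ReflTransGen.stdSymm (r := inAdj ω S)).symm _ _ h.2

lemma conn.mono {ω : Config d} {S T : Set (Zd d)} {x y : Zd d} (h : conn ω S x y) (hST : S ⊆ T) :
    conn ω T x y := ⟨hST h.1, h.2.lift id fun _ _ h => ⟨h.1, hST h.2.1, hST h.2.2⟩⟩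

/-- The lattice edges inside a vertex set. -/
def edgesIn (S : Set (Zd d)) : Set (Sym2 (Zd d)) :=
  {e | ∃ a b, e = s(a, b) ∧ latAdj a b ∧ a ∈ S ∧ b ∈ S}

lemma mem_edgesIn {S : Set (Zd d)} {a b : Zd d} :
    s(a, b) ∈ edgesIn S ↔ latAdj a b ∧ a ∈ S ∧ b ∈ S := by
  constructor
  · rintro ⟨a', b', h, h1, h2, h3⟩
    rcases Sym2.eq_iff.1 h with ⟨rfl, rfl⟩ | ⟨rfl, rfl⟩
    · exact ⟨h1, h2, h3⟩
    · exact ⟨latAdj_symm h1, h3, h2⟩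
  · rintro ⟨h1, h2, h3⟩
    exact ⟨a, b, rfl, h1, h2, h3⟩

lemma edgesIn_finite {S : Set (Zd d)} (hS : S.Finite) : (edgesIn S).Finite := by
  refine ((hS.prod hS).image fun x => s(x.1, x.2)).subset ?_
  rintro e ⟨a, b, rfl, _, ha, hb⟩
  exact ⟨(a, b), ⟨ha, hb⟩, rfl⟩

lemma edgesIn_ncard_le {S : Set (Zd d)} (hS : S.Finite) : (edgesIn S).ncard ≤ S.ncard * S.ncard := by
  rw [← Set.ncard_prod]
  refine le_trans (Set.ncard_le_ncard ?_ ((hS.prod hS).image _))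
    (Set.ncard_image_le (f := fun x : Zd d × Zd d => s(x.1, x.2)) (hS.prod hS))
  rintro e ⟨a, b, rfl, _, ha, hb⟩
  exact ⟨(a, b), ⟨ha, hb⟩, rfl⟩

lemma conn.congr {ω ω' : Config d} {S : Set (Zd d)} {x y : Zd d} (h : conn ω S x y)
    (hω : ∀ e ∈ edgesIn S, ω e = true → ω' e = true) : conn ω' S x y :=
  ⟨h.1, h.2.lift id fun _ _ hab => ⟨⟨hab.1.1, hω _ (mem_edgesIn.2 ⟨hab.1.1, hab.2⟩) hab.1.2⟩, hab.2⟩⟩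

lemma conn_congr {ω ω' : Config d} {S : Set (Zd d)} {x y : Zd d}
    (hω : ∀ e ∈ edgesIn S, ω e = ω' e) : conn ω S x y ↔ conn ω' S x y :=
  ⟨fun h => h.congr fun e he => by simp [hω e he], fun h => h.congr fun e he => by simp [hω e he]⟩

lemma det_conn (S : Set (Zd d)) (x y : Zd d) : Det {ω | conn ω S x y} (edgesIn S) :=
  fun _ _ h => conn_congr h

/-- A path leaving `S` has a first exit edge. -/
lemma exists_exit {ω : Config d} {R S : Set (Zd d)} {x y : Zd d} (h : conn ω R x y) (hx : x ∈ S)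
    (hy : y ∉ S) : ∃ a b, conn ω (R ∩ S) x a ∧ openAdj ω a b ∧ b ∈ R ∧ b ∉ S := by
  obtain ⟨hxR, h⟩ := h
  induction h with
  | refl => exact absurd hx hy
  | @tail b c hb hbc ih =>
    by_cases hbS : b ∈ S
    · clear ih
      by_cases hall : conn ω (R ∩ S) x b
      · exact ⟨b, c, hall, hbc.1, hbc.2.2, hy⟩
      · have : ∀ z, Relation.ReflTransGen (inAdj ω R) x z → conn ω (R ∩ S) x z ∨
            ∃ a b, conn ω (R ∩ S) x a ∧ openAdj ω a b ∧ b ∈ R ∧ b ∉ S := by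
          intro z hz
          induction hz with
          | refl => exact Or.inl ⟨⟨hxR, hx⟩, .refl⟩
          | @tail u v _ huv ih =>
            rcases ih with ih | ih
            · by_cases hv : v ∈ S
              · exact Or.inl (ih.tail huv.1 ⟨huv.2.2, hv⟩)
              · exact Or.inr ⟨u, v, ih, huv.1, huv.2.2, hv⟩
            · exact Or.inr ih
        exact (this b hb).resolve_left hall
    · exact ih hbS

/-- The box of radius `m` centred at `q`. -/
def bx (q : Zd d) (m : ℕ) : Set (Zd d) := {x | ∀ i, |x i - q i| ≤ m}

lemma bx_eq (q : Zd d) (m : ℕ) : bx q m = Set.Icc (fun i => q i - m) (fun i => q i + m) := by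
  ext x
  simp only [bx, Set.mem_ofPred_eq, Set.mem_Icc, Pi.le_def, abs_le, ← forall_and]
  exact forall_congr' fun i => by constructor <;> rintro ⟨h1, h2⟩ <;> constructor <;> linarith

lemma bx_finite (q : Zd d) (m : ℕ) : (bx q m).Finite := by
  rw [bx_eq]; exact Set.finite_Icc _ _

lemma bx_ncard (q : Zd d) (m : ℕ) : (bx q m).ncard = (2 * m + 1) ^ d := by
  classical
  rw [bx_eq, ← Finset.coe_Icc, Set.ncard_coe_finset, Pi.card_Icc]
  simp only [Int.card_Icc]
  rw [Finset.prod_congr rfl (g := fun _ => 2 * m + 1) fun i _ => by omega]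
  simp

lemma mem_bx_self (q : Zd d) (m : ℕ) : q ∈ bx q m := by intro i; simp

lemma bx_mono (q : Zd d) {m n : ℕ} (h : m ≤ n) : bx q m ⊆ bx q n :=
  fun x hx i => (hx i).trans (by exact_mod_cast h)

lemma exists_bx_of_finite {S : Set (Zd d)} (hS : S.Finite) : ∃ n, S ⊆ bx 0 n := by
  induction S, hS using Set.Finite.induction_on with
  | empty => exact ⟨0, by simp⟩
  | @insert x S _ _ ih =>
    obtain ⟨n, hn⟩ := ih
    refine ⟨n + ∑ i, (x i).natAbs, ?_⟩
    rintro y (rfl | hy)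
    · intro i
      have := Finset.single_le_sum (f := fun i => (y i).natAbs) (fun _ _ => Nat.zero_le _)
        (Finset.mem_univ i)
      simp only [Pi.zero_apply, sub_zero] at *
      have h2 : ((y i).natAbs : ℤ) ≤ ((∑ i, (y i).natAbs : ℕ) : ℤ) := by exact_mod_cast this
      rw [Int.natCast_natAbs] at h2
      push_cast at *
      linarith
    · exact bx_mono 0 (by omega) (hn hy)

/-- All lattice edges inside `S` are open. -/
def full (ω : Config d) (S : Set (Zd d)) : Prop := ∀ e ∈ edgesIn S, ω e = true

lemma latAdj_add_single (x : Zd d) (i : Fin d) {s : ℤ} (hs : |s| = 1) :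
    latAdj x (x + Pi.single i s) := by
  unfold latAdj
  rw [Finset.sum_eq_single i]
  · simp [hs]
  · intro j _ hj
    simp [hj]
  · simp

/-- Boxes are connected. -/
lemma conn_of_full_Icc {ω : Config d} {a b : Zd d} (h : full ω (Set.Icc a b)) {x y : Zd d}
    (hx : x ∈ Set.Icc a b) (hy : y ∈ Set.Icc a b) : conn ω (Set.Icc a b) x y := by
  generalize hk : ∑ i, (x i - y i).natAbs = k
  induction k generalizing x with
  | zero =>
    have : x = y := by
      ext i
      have := (Finset.sum_eq_zero_iff.1 hk) i (Finset.mem_univ i)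
      omega
    exact this ▸ conn.refl hx
  | succ k ih =>
    obtain ⟨i, _, hi⟩ : ∃ i ∈ Finset.univ, (x i - y i).natAbs ≠ 0 := by
      by_contra hcon
      push Not at hcon
      rw [Finset.sum_eq_zero hcon] at hk
      omega
    set s : ℤ := if x i < y i then 1 else -1 with hs
    have hs1 : |s| = 1 := by rw [hs]; split_ifs <;> simp
    set z := x + Pi.single i s with hz
    have hzi : z i = x i + s := by simp [hz]
    have hzj : ∀ j, j ≠ i → z j = x j := fun j hj => by simp [hz, hj]
    have hzm : z ∈ Set.Icc a b := by
      rw [Set.mem_Icc, Pi.le_def, Pi.le_def] at *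
      refine ⟨fun j => ?_, fun j => ?_⟩ <;> by_cases hj : j = i
      · subst hj
        have h1 := hx.1 j; have h2 := hy.1 j
        rw [hzi, hs]; split_ifs <;> omega
      · rw [hzj j hj]; exact hx.1 j
      · subst hj
        have h1 := hx.2 j; have h2 := hy.2 j
        rw [hzi, hs]; split_ifs <;> omega
      · rw [hzj j hj]; exact hx.2 j
    have hsum : ∑ i, (z i - y i).natAbs = k := by
      rw [← Finset.add_sum_erase _ _ (Finset.mem_univ i)] at hk ⊢
      rw [Finset.sum_congr rfl (g := fun j => (x j - y j).natAbs) fun j hj => by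
        rw [hzj j (Finset.ne_of_mem_erase hj)]]
      have : (z i - y i).natAbs + 1 = (x i - y i).natAbs := by
        rw [hzi, hs]; split_ifs <;> omega
      omega
    have h2 := ih hzm hsum
    have hadj : latAdj x z := latAdj_add_single x i hs1
    have h3 : openAdj ω x z := ⟨hadj, h _ (mem_edgesIn.2 ⟨hadj, hx, hzm⟩)⟩
    exact ((conn.refl hx).tail h3 hzm).trans h2

lemma conn_of_full_bx {ω : Config d} {q : Zd d} {m : ℕ} (h : full ω (bx q m)) {x y : Zd d}
    (hx : x ∈ bx q m) (hy : y ∈ bx q m) : conn ω (bx q m) x y := by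
  rw [bx_eq] at *
  exact conn_of_full_Icc h hx hy

/-- The open cluster of a vertex. -/
def clus (ω : Config d) (x : Zd d) : Set (Zd d) := {y | conn ω Set.univ x y}

lemma conn_univ {ω : Config d} {x y : Zd d} :
    conn ω Set.univ x y ↔ Relation.ReflTransGen (openAdj ω) x y := by
  constructor
  · exact fun h => h.2.lift id fun _ _ h => h.1
  · exact fun h => ⟨trivial, h.lift id fun _ _ h => ⟨h, trivial, trivial⟩⟩

lemma clus_zero (ω : Config d) : clus ω 0 = cluster ω := by
  ext y; exact conn_univ

lemma conn_univ_iff {ω : Config d} {x y : Zd d} :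
    conn ω Set.univ x y ↔ ∃ n, conn ω (bx 0 n) x y := by
  constructor
  · rintro ⟨_, h⟩
    induction h with
    | refl =>
      obtain ⟨n, hn⟩ := exists_bx_of_finite (Set.finite_singleton x)
      exact ⟨n, conn.refl (hn rfl)⟩
    | @tail b c _ hbc ih =>
      obtain ⟨n, hn⟩ := ih
      obtain ⟨k, hk⟩ := exists_bx_of_finite (Set.finite_singleton c)
      exact ⟨n + k, (hn.mono (bx_mono 0 (by omega))).tail hbc.1 (bx_mono 0 (by omega) (hk rfl))⟩
  · rintro ⟨n, h⟩
    exact h.mono (Set.subset_univ _)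

lemma measurableSet_conn_bx (n : ℕ) (x y : Zd d) : MeasurableSet {ω | conn ω (bx 0 n) x y} :=
  (det_conn _ x y).measurableSet (edgesIn_finite (bx_finite 0 n))

lemma measurableSet_conn (x y : Zd d) : MeasurableSet {ω : Config d | conn ω Set.univ x y} := by
  simp_rw [conn_univ_iff, Set.ofPred_exists]
  exact MeasurableSet.iUnion fun n => measurableSet_conn_bx n x y

lemma infinite_iff_forall_bx {S : Set (Zd d)} : S.Infinite ↔ ∀ n, ∃ y ∈ S, y ∉ bx 0 n := by
  constructor
  · intro h n
    by_contra hcon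
    push Not at hcon
    exact h ((bx_finite 0 n).subset hcon)
  · intro h hfin
    obtain ⟨n, hn⟩ := exists_bx_of_finite hfin
    obtain ⟨y, hy, hyn⟩ := h n
    exact hyn (hn hy)

lemma measurableSet_clus_infinite (x : Zd d) : MeasurableSet {ω | (clus ω x).Infinite} := by
  simp_rw [infinite_iff_forall_bx, Set.ofPred_forall]
  refine MeasurableSet.iInter fun n => ?_
  have : {ω : Config d | ∃ y ∈ clus ω x, y ∉ bx 0 n} =
      ⋃ y, ⋃ (_ : y ∉ bx 0 n), {ω : Config d | conn ω Set.univ x y} := by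
    ext ω; simp [clus, and_comm]
  rw [this]
  exact MeasurableSet.iUnion fun y => MeasurableSet.iUnion fun _ => measurableSet_conn x y

/-- Changing finitely many edges preserves the existence of an infinite cluster. -/
lemma exists_infinite_of_agree {ω ω' : Config d} {s : Finset (Sym2 (Zd d))}
    (h : ∀ e ∉ s, ω e = ω' e) {x : Zd d} (hx : (clus ω x).Infinite) :
    ∃ x', (clus ω' x').Infinite := by
  by_contra hcon
  push Not at hcon
  refine hx ?_
  set V : Set (Zd d) := {x} ∪ ⋃ e ∈ s, {z | z ∈ e} with hV
  have hVf : V.Finite := by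
    refine (Set.finite_singleton x).union (s.finite_toSet.biUnion fun e _ => ?_)
    classical
    exact (e.toFinset.finite_toSet).subset fun z hz => by
      simpa [Sym2.mem_toFinset] using hz
  refine (hVf.biUnion fun z _ => hcon z).subset ?_
  rintro y ⟨_, hy⟩
  induction hy with
  | refl => exact Set.mem_biUnion (show x ∈ V from Or.inl rfl) (conn.refl trivial)
  | @tail b c _ hbc ih =>
    simp only [Set.mem_iUnion] at ih
    obtain ⟨z, hz, hzb⟩ := ih
    by_cases he : s(b, c) ∈ s
    · refine Set.mem_biUnion (show c ∈ V from Or.inr ?_) (conn.refl trivial)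
      exact Set.mem_biUnion he (Sym2.mem_mk_right b c)
    · refine Set.mem_biUnion hz (conn.tail hzb ⟨hbc.1.1, ?_⟩ trivial)
      rw [← h _ he]
      exact hbc.1.2

lemma zero_one (q : Sym2 (Zd d) → unitInterval)
    (h : prodM q {ω | ∃ x, (clus ω x).Infinite} ≠ 0) :
    prodM q {ω | ∃ x, (clus ω x).Infinite} = 1 := by
  set I := {ω : Config d | ∃ x, (clus ω x).Infinite} with hI
  have hIm : MeasurableSet I := by
    rw [hI]
    simp_rw [Set.ofPred_exists]
    exact MeasurableSet.iUnion fun x => measurableSet_clus_infinite x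
  have key : (prodM q I)⁻¹ • (prodM q).restrict I = prodM q := by
    refine eq_prodM q _ fun s f => ?_
    rw [← prodM_cyl]
    set C := {ω : Config d | ∀ e ∈ s, ω e = f e} with hC
    have hCd : Det C s := fun ω ω' hω => forall_congr' fun e => forall_congr' fun he => by
      rw [hω e he]
    have hCm : MeasurableSet C := hCd.measurableSet s.finite_toSet
    have hId : Det I (sᶜ : Set (Sym2 (Zd d))) := fun ω ω' hω =>
      ⟨fun ⟨x, hx⟩ => exists_infinite_of_agree (s := s) (fun e he => hω e he) hx,
        fun ⟨x, hx⟩ => exists_infinite_of_agree (s := s) (fun e he => (hω e he).symm) hx⟩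
    have := indep_det q hCm hIm hCd hId disjoint_compl_right
    rw [Measure.smul_apply, Measure.restrict_apply hCm, smul_eq_mul, ← ofReal_measureReal (s := C ∩ I),
      this, ENNReal.ofReal_mul measureReal_nonneg, ofReal_measureReal, ofReal_measureReal, mul_comm,
      mul_assoc, ENNReal.mul_inv_cancel h (measure_ne_top _ _), mul_one]
  have := congrArg (fun μ => μ I) key
  simp only [Measure.smul_apply, Measure.restrict_apply_self, smul_eq_mul] at this
  rw [ENNReal.inv_mul_cancel h (measure_ne_top _ _)] at this
  exact this.symm

end Basics

section Symmetry

variable {d : ℕ}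

/-- The action of a permutation of the vertices on configurations. -/
def act (g : Zd d ≃ Zd d) (ω : Config d) : Config d := fun e => ω (e.map g)

lemma measurable_act (g : Zd d ≃ Zd d) : Measurable (act g) :=
  measurable_pi_lambda _ fun _ => measurable_pi_apply _

lemma map_act (p : unitInterval) (g : Zd d ≃ Zd d) :
    (prodM fun _ : Sym2 (Zd d) => p).map (act g) = prodM fun _ => p := by
  exact prodM_map_inj (fun _ => p) (Sym2.map.injective g.injective)

lemma measure_le_act (p : unitInterval) (g : Zd d ≃ Zd d) {A B : Set (Config d)}
    (h : ∀ ω ∈ A, act g ω ∈ B) :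
    (prodM fun _ : Sym2 (Zd d) => p).real A ≤ (prodM fun _ : Sym2 (Zd d) => p).real B := by
  refine ENNReal.toReal_mono (measure_ne_top _ _) ?_
  calc _ ≤ (prodM fun _ : Sym2 (Zd d) => p) (act g ⁻¹' B) := measure_mono h
    _ ≤ ((prodM fun _ : Sym2 (Zd d) => p).map (act g)) B :=
        Measure.le_map_apply (measurable_act g).aemeasurable B
    _ = _ := by rw [map_act]

/-- `g` preserves lattice adjacency. -/
def LatAut (g : Zd d ≃ Zd d) : Prop := ∀ x y, latAdj (g x) (g y) ↔ latAdj x y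

lemma openAdj_act {g : Zd d ≃ Zd d} (hg : LatAut g) {ω : Config d} {x y : Zd d} :
    openAdj (act g ω) x y ↔ openAdj ω (g x) (g y) := by
  unfold openAdj
  rw [hg]
  rfl

lemma conn_act {g : Zd d ≃ Zd d} (hg : LatAut g) {ω : Config d} {S S' : Set (Zd d)} {x y : Zd d}
    (hS : ∀ x ∈ S, g x ∈ S') (h : conn (act g ω) S x y) : conn ω S' (g x) (g y) :=
  ⟨hS _ h.1, h.2.lift g fun _ _ hab => ⟨(openAdj_act hg).1 hab.1, hS _ hab.2.1, hS _ hab.2.2⟩⟩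

lemma act_symm_act (g : Zd d ≃ Zd d) (ω : Config d) : act g.symm (act g ω) = ω := by
  ext e
  simp [act, Sym2.map_map]

lemma LatAut.symm {g : Zd d ≃ Zd d} (hg : LatAut g) : LatAut g.symm := by
  intro x y
  rw [← hg]; simp

lemma conn_act_iff {g : Zd d ≃ Zd d} (hg : LatAut g) {ω : Config d} {S S' : Set (Zd d)} {x y : Zd d}
    (hS : ∀ x, x ∈ S ↔ g x ∈ S') : conn (act g ω) S x y ↔ conn ω S' (g x) (g y) := by
  refine ⟨conn_act hg fun x hx => (hS x).1 hx, fun h => ?_⟩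
  rw [← act_symm_act g ω] at h
  have := conn_act hg.symm (S' := S) (fun x hx => by rw [hS]; simpa using hx) h
  simpa using this

/-- Translations. -/
def trans (q : Zd d) : Zd d ≃ Zd d := Equiv.addRight q

@[simp] lemma trans_apply (q x : Zd d) : trans q x = x + q := rfl

lemma latAut_trans (q : Zd d) : LatAut (trans q) := by
  intro x y
  simp [latAdj]

/-- Signed permutations of the coordinates. -/
def sperm (τ : Equiv.Perm (Fin d)) (σ : Fin d → ℤˣ) : Zd d ≃ Zd d where
  toFun x j := σ j * x (τ j)
  invFun y j := σ (τ.symm j) * y (τ.symm j)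
  left_inv x := by
    ext j
    simp [← mul_assoc, ← Units.val_mul]
  right_inv x := by
    ext j
    simp [← mul_assoc, ← Units.val_mul]

lemma sperm_apply (τ : Equiv.Perm (Fin d)) (σ : Fin d → ℤˣ) (x : Zd d) (j : Fin d) :
    sperm τ σ x j = σ j * x (τ j) := rfl

lemma abs_units (σ : ℤˣ) (a : ℤ) : |(σ : ℤ) * a| = |a| := by
  rcases Int.units_eq_one_or σ with h | h <;> simp [h]

lemma units_mul_self (σ : ℤˣ) (a : ℤ) : (σ : ℤ) * ((σ : ℤ) * a) = a := by
  rcases Int.units_eq_one_or σ with h | h <;> simp [h]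

lemma latAut_sperm (τ : Equiv.Perm (Fin d)) (σ : Fin d → ℤˣ) : LatAut (sperm τ σ) := by
  intro x y
  simp only [latAdj, sperm_apply, ← mul_sub, abs_units]
  rw [Equiv.sum_comp τ (fun i => |x i - y i|)]

end Symmetry

section Reach

variable {d : ℕ}

open Classical in
/-- Points of the sphere of radius `n` connected to the box of radius `m` inside the box of
radius `n`. -/
noncomputable def reach (m n : ℕ) (ω : Config d) : Finset (Zd d) :=
  (bx_finite 0 n).toFinset.filter fun x =>
    (∃ i, |x i| = n) ∧ ∃ z ∈ bx (0 : Zd d) m, conn ω (bx 0 n) z x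

lemma mem_reach {m n : ℕ} {ω : Config d} {x : Zd d} : x ∈ reach m n ω ↔
    x ∈ bx 0 n ∧ (∃ i, |x i| = n) ∧ ∃ z ∈ bx (0 : Zd d) m, conn ω (bx 0 n) z x := by
  simp [reach]

lemma reach_congr {m n : ℕ} {ω ω' : Config d} (h : ∀ e ∈ edgesIn (bx 0 n), ω e = ω' e) :
    reach m n ω = reach m n ω' := by
  ext x
  simp only [mem_reach, conn_congr h]

lemma reach_mono {m n : ℕ} {ω ω' : Config d} (h : ∀ e, ω e = true → ω' e = true) :
    reach m n ω ⊆ reach m n ω' := by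
  intro x
  simp only [mem_reach]
  exact fun ⟨h1, h2, z, h3, h4⟩ => ⟨h1, h2, z, h3, h4.congr fun e _ => h e⟩

lemma det_reach (m n : ℕ) (P : Finset (Zd d) → Prop) :
    Det {ω | P (reach m n ω)} (edgesIn (bx 0 n)) := by
  intro ω ω' h
  change P _ ↔ P _
  rw [reach_congr h]

lemma measurableSet_reach (m n : ℕ) (P : Finset (Zd d) → Prop) :
    MeasurableSet {ω | P (reach m n ω)} :=
  (det_reach m n P).measurableSet (edgesIn_finite (bx_finite 0 n))

lemma exists_reach_of_exit {m n : ℕ} (hmn : m ≤ n) {ω : Config d} {R : Set (Zd d)} {z y : Zd d}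
    (hz : z ∈ bx 0 m) (h : conn ω R z y) (hy : y ∉ bx 0 n) :
    ∃ a ∈ reach m n ω, ∃ b ∉ bx 0 n, openAdj ω a b := by
  obtain ⟨a, b, h1, h2, _, h4⟩ := exists_exit h (bx_mono 0 hmn hz) hy
  have ha : a ∈ bx 0 n := h1.mem.2
  refine ⟨a, ?_, b, h4, h2⟩
  rw [mem_reach]
  refine ⟨ha, ?_, z, hz, h1.mono Set.inter_subset_right⟩
  simp only [bx, Set.mem_ofPred_eq, not_forall] at h4
  obtain ⟨i, hi⟩ := h4
  refine ⟨i, ?_⟩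
  have h5 := h2.1.abs_sub_le i
  have h6 := ha i
  simp only [Pi.zero_apply, sub_zero] at hi h6
  rw [abs_le] at h5 h6
  rw [abs_le, not_and_or] at hi
  rcases hi with hi | hi
  · rw [abs_of_nonpos (by omega)]; omega
  · rw [abs_of_nonneg (by omega)]; omega

lemma reach_nonempty_succ {m n : ℕ} (hmn : m ≤ n) {ω : Config d}
    (h : (reach m (n + 1) ω).Nonempty) : ∃ a ∈ reach m n ω, ∃ b ∉ bx 0 n, openAdj ω a b := by
  obtain ⟨x, hx⟩ := h
  obtain ⟨_, ⟨i, hi⟩, z, hz, hc⟩ := mem_reach.1 hx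
  refine exists_reach_of_exit hmn hz hc fun hx' => ?_
  have := hx' i
  simp only [Pi.zero_apply, sub_zero] at this
  rw [hi] at this
  push_cast at this
  omega

lemma reach_nonempty_of_infinite {m n : ℕ} (hmn : m ≤ n) {ω : Config d} {z : Zd d}
    (hz : z ∈ bx 0 m) (h : (clus ω z).Infinite) : (reach m n ω).Nonempty := by
  obtain ⟨y, hy, hyn⟩ := infinite_iff_forall_bx.1 h n
  obtain ⟨a, ha, _⟩ := exists_reach_of_exit hmn hz hy hyn
  exact ⟨a, ha⟩

variable (p : unitInterval)

lemma prob_few_le {m n : ℕ} (hmn : m ≤ n) (L : ℕ) :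
    (1 - p : ℝ) ^ (3 ^ d * L) * (prodM fun _ => p).real {ω : Config d |
      (reach m n ω).Nonempty ∧ (reach m n ω).card ≤ L} ≤
    (prodM fun _ => p).real {ω : Config d | (reach m n ω).Nonempty} -
      (prodM fun _ => p).real {ω : Config d | (reach m (n + 1) ω).Nonempty} := by
  classical
  set q : Sym2 (Zd d) → unitInterval := fun _ => p with hq
  set G := {ω : Config d | (reach m n ω).Nonempty ∧ (reach m n ω).card ≤ L} with hG
  let Nf : Finset (Zd d) → Finset (Sym2 (Zd d)) := fun X => X.biUnion fun a =>
    ((bx_finite a 1).toFinset.filter fun b => b ∉ bx 0 n).image fun b => s(a, b)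
  have hNcard : ∀ X : Finset (Zd d), (Nf X).card ≤ 3 ^ d * X.card := by
    intro X
    rw [mul_comm]
    refine Finset.card_biUnion_le_card_mul _ _ _ fun a _ => ?_
    refine Finset.card_image_le.trans ((Finset.card_filter_le _ _).trans ?_)
    rw [← Set.ncard_eq_toFinset_card _ (bx_finite a 1), bx_ncard]
  have hp0 := p.2.1
  have hp1 := p.2.2
  have key := random_family_ge q (G := G) (E := fun e => {ω | ω e = true})
    (S := edgesIn (bx 0 n)) (T := fun e => {e})
    (measurableSet_reach m n fun X => X.Nonempty ∧ X.card ≤ L)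
    (det_reach m n fun X => X.Nonempty ∧ X.card ≤ L)
    (fun e => measurableSet_coord e true) (fun e => det_coord e true) (fun ω => Nf (reach m n ω))
    (fun b => measurableSet_reach m n fun X => Nf X = b)
    (fun b => det_reach m n fun X => Nf X = b) ?_ ?_ (ρ := p) hp0 hp1 ?_ (3 ^ d * L)
  · have h1 : G ∩ {ω | (Nf (reach m n ω)).card ≤ 3 ^ d * L} = G := by
      rw [Set.inter_eq_left]
      exact fun ω hω => (hNcard _).trans (Nat.mul_le_mul_left _ hω.2)
    rw [h1] at key
    refine key.trans ?_
    rw [le_sub_iff_add_le, ← measureReal_union _ (measurableSet_reach m (n + 1) _)]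
    · refine measureReal_mono ?_
      rintro ω (⟨hω, _⟩ | hω)
      · exact hω.1
      · obtain ⟨a, ha, _⟩ := reach_nonempty_succ hmn hω
        exact ⟨a, ha⟩
    · rw [Set.disjoint_left]
      rintro ω ⟨_, h2⟩ h3
      obtain ⟨a, ha, b, hb, hab⟩ := reach_nonempty_succ hmn h3
      refine h2 s(a, b) ?_ hab.2
      simp only [Nf, Finset.mem_biUnion, Finset.mem_image, Finset.mem_filter,
        Set.Finite.mem_toFinset]
      exact ⟨a, ha, b, ⟨fun i => by rw [abs_sub_comm]; exact_mod_cast hab.1.abs_sub_le i, hb⟩, rfl⟩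
  · intro ω _ e he
    simp only [Nf, Finset.mem_biUnion, Finset.mem_image, Finset.mem_filter] at he
    obtain ⟨a, _, b, ⟨_, hb⟩, rfl⟩ := he
    rw [Set.disjoint_singleton_right, mem_edgesIn]
    exact fun h => hb h.2.2
  · intro ω _ a _ b _ hab
    simpa using hab
  · intro e
    rw [prodM_real_eq]
    simp [hq]

/-- No infinite cluster meets the box of radius `m`. -/
def NoInf (d m : ℕ) : Set (Config d) := {ω | ∀ x ∈ bx 0 m, ¬ (clus ω x).Infinite}

lemma measurableSet_NoInf (m : ℕ) : MeasurableSet (NoInf d m) := by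
  have : NoInf d m = ⋂ x, ⋂ (_ : x ∈ bx 0 m), {ω | (clus ω x).Infinite}ᶜ := by
    ext ω; simp [NoInf]
  rw [this]
  exact MeasurableSet.iInter fun x => MeasurableSet.iInter fun _ =>
    (measurableSet_clus_infinite x).compl

lemma exists_NoInf_le (hinf : prodM (fun _ => p) {ω : Config d | ∃ x, (clus ω x).Infinite} = 1)
    {ε : ℝ} (hε : 0 < ε) : ∃ m, (prodM fun _ => p).real (NoInf d m) ≤ ε := by
  have hanti : Antitone (NoInf d) := fun m n hmn ω hω x hx => hω x (bx_mono 0 hmn hx)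
  have h0 : prodM (fun _ => p) (⋂ m, NoInf d m) = 0 := by
    have h1 : (⋂ m, NoInf d m) ⊆ {ω : Config d | ∃ x, (clus ω x).Infinite}ᶜ := by
      rintro ω hω ⟨x, hx⟩
      obtain ⟨m, hm⟩ := exists_bx_of_finite (Set.finite_singleton x)
      exact Set.mem_iInter.1 hω m x (hm rfl) hx
    refine measure_mono_null h1 ?_
    rw [prob_compl_eq_zero_iff, hinf]
    simp_rw [Set.ofPred_exists]
    exact MeasurableSet.iUnion fun x => measurableSet_clus_infinite x
  have h2 := tendsto_measure_iInter_atTop (μ := prodM fun _ => p)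
    (fun m => (measurableSet_NoInf (d := d) m).nullMeasurableSet) hanti ⟨0, measure_ne_top _ _⟩
  rw [h0] at h2
  have h3 := (ENNReal.tendsto_toReal ENNReal.zero_ne_top).comp h2
  obtain ⟨m, hm⟩ := (h3.eventually (gt_mem_nhds (show (0 : ENNReal).toReal < ε by simpa))).exists
  exact ⟨m, le_of_lt hm⟩

lemma exists_few_le (hp : (p : ℝ) < 1) (m L : ℕ) {ε : ℝ} (hε : 0 < ε) : ∃ n₀, ∀ n ≥ n₀,
    (prodM fun _ => p).real {ω : Config d | (reach m n ω).card ≤ L} ≤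
      (prodM fun _ => p).real (NoInf d m) + ε := by
  set a : ℕ → ℝ := fun k => (prodM fun _ => p).real {ω : Config d | (reach m (m + k) ω).Nonempty}
    with ha
  have hanti : Antitone a := by
    refine antitone_nat_of_succ_le fun k => measureReal_mono fun ω hω => ?_
    obtain ⟨a, ha, _⟩ := reach_nonempty_succ (Nat.le_add_right m k) hω
    exact ⟨a, ha⟩
  have hlim := tendsto_atTop_ciInf hanti ⟨0, by rintro _ ⟨k, rfl⟩; exact measureReal_nonneg⟩
  have hdiff : Filter.Tendsto (fun k => a k - a (k + 1)) Filter.atTop (nhds 0) := by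
    have := hlim.sub (hlim.comp (Filter.tendsto_add_atTop_nat 1))
    simpa using this
  have hc : 0 < (1 - p : ℝ) ^ (3 ^ d * L) := pow_pos (by linarith) _
  obtain ⟨k₀, hk₀⟩ := (hdiff.eventually (gt_mem_nhds (mul_pos hc hε))).exists_forall_of_atTop
  refine ⟨m + k₀, fun n hn => ?_⟩
  obtain ⟨k, rfl⟩ := Nat.exists_eq_add_of_le (show m ≤ n by omega)
  have h1 := (prob_few_le p (d := d) (Nat.le_add_right m k) L).trans_lt (hk₀ k (by omega))
  have h2 := lt_of_mul_lt_mul_left h1 hc.le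
  have h3 : {ω : Config d | (reach m (m + k) ω).card ≤ L} ⊆ NoInf d m ∪
      {ω : Config d | (reach m (m + k) ω).Nonempty ∧ (reach m (m + k) ω).card ≤ L} := by
    intro ω hω
    by_cases h : ω ∈ NoInf d m
    · exact Or.inl h
    · right
      simp only [NoInf, Set.mem_ofPred_eq, not_forall, not_not] at h
      obtain ⟨x, hx, hx'⟩ := h
      exact ⟨reach_nonempty_of_infinite (Nat.le_add_right m k) hx hx', hω⟩
  exact (measureReal_mono h3).trans ((measureReal_union_le _ _).trans (by linarith))

/-- A face-orthant of the sphere of radius `n`. -/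
def piece (n : ℕ) (i : Fin d) (σ : Fin d → ℤˣ) : Set (Zd d) :=
  {x | σ i * x i = n ∧ ∀ j, 0 ≤ σ j * x j}

open Classical in
/-- Reached points in a face-orthant. -/
noncomputable def reachP (m n : ℕ) (i : Fin d) (σ : Fin d → ℤˣ) (ω : Config d) : Finset (Zd d) :=
  (reach m n ω).filter (· ∈ piece n i σ)

lemma card_reach_le {m n L : ℕ} {ω : Config d} (h : ∀ i σ, (reachP m n i σ ω).card ≤ L) :
    (reach m n ω).card ≤ Fintype.card (Fin d × (Fin d → ℤˣ)) * L := by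
  classical
  have : reach m n ω ⊆ Finset.univ.biUnion fun x : Fin d × (Fin d → ℤˣ) => reachP m n x.1 x.2 ω := by
    intro x hx
    obtain ⟨_, ⟨i, hi⟩, _⟩ := mem_reach.1 hx
    simp only [Finset.mem_biUnion, Finset.mem_univ, true_and, reachP, Finset.mem_filter]
    have hσ : ∀ j, ((if 0 ≤ x j then 1 else -1 : ℤˣ) : ℤ) * x j = |x j| := by
      intro j
      split_ifs with h
      · simp [abs_of_nonneg h]
      · simp [abs_of_nonpos (not_le.1 h).le]
    refine ⟨(i, fun j => if 0 ≤ x j then 1 else -1), hx, ?_, fun j => ?_⟩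
    · rw [hσ, hi]
    · rw [hσ]; exact abs_nonneg _
  exact (Finset.card_le_card this).trans (Finset.card_biUnion_le_card_mul _ _ _ fun x _ => h _ _)

lemma reachP_symm (m n L : ℕ) (i i' : Fin d) (σ σ' : Fin d → ℤˣ) :
    (prodM fun _ => p).real {ω : Config d | L < (reachP m n i σ ω).card} ≤
    (prodM fun _ => p).real {ω : Config d | L < (reachP m n i' σ' ω).card} := by
  set τ := Equiv.swap i i' with hτ
  set g : Zd d ≃ Zd d := sperm τ fun j => σ j * σ' (τ j) with hg
  have hga : LatAut g := latAut_sperm _ _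
  have hgv : ∀ x j, (σ j : ℤ) * g x j = σ' (τ j) * x (τ j) := by
    intro x j
    rw [hg, sperm_apply, Units.val_mul, mul_assoc, units_mul_self]
  have hgabs : ∀ x j, |g x j| = |x (τ j)| := fun x j => by rw [hg, sperm_apply, abs_units]
  have hbx : ∀ k x, x ∈ bx 0 k ↔ g x ∈ bx 0 k := by
    intro k x
    simp only [bx, Set.mem_ofPred_eq, Pi.zero_apply, sub_zero, hgabs]
    exact (τ.forall_congr_right (q := fun j => |x j| ≤ (k : ℤ))).symm
  have hpc : ∀ x, g x ∈ piece n i σ ↔ x ∈ piece n i' σ' := by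
    intro x
    simp only [piece, Set.mem_ofPred_eq, hgv]
    refine and_congr (by simp [hτ]) (τ.forall_congr_right (q := fun j => 0 ≤ (σ' j : ℤ) * x j))
  refine measure_le_act p g fun ω hω => ?_
  change L < _
  refine lt_of_lt_of_le hω ?_
  refine Finset.card_le_card_of_injOn g.symm ?_ g.symm.injective.injOn
  intro x hx
  simp only [reachP, Finset.coe_filter, Set.mem_ofPred_eq, mem_reach] at hx ⊢
  obtain ⟨⟨h1, ⟨k, hk⟩, z, hz, hc⟩, h2⟩ := hx
  obtain ⟨x, rfl⟩ := g.surjective x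
  obtain ⟨z, rfl⟩ := g.surjective z
  rw [Equiv.symm_apply_apply]
  refine ⟨⟨(hbx _ _).2 h1, ⟨τ k, by rw [← hgabs]; exact hk⟩, z, (hbx _ _).2 hz,
    (conn_act_iff hga (hbx n)).2 hc⟩, (hpc x).1 h2⟩

lemma exists_reachP_le (hp : (p : ℝ) < 1) {ε : ℝ} (hε : 0 < ε) (i : Fin d) :
    ∃ ε' > 0, ∀ m, (prodM fun _ => p).real (NoInf d m) ≤ ε' → ∀ L, ∃ n₀, ∀ n ≥ n₀, ∀ i σ,
      (prodM fun _ => p).real {ω : Config d | (reachP m n i σ ω).card ≤ L} ≤ ε := by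
  classical
  set M := Fintype.card (Fin d × (Fin d → ℤˣ)) with hM
  have : Nonempty (Fin d × (Fin d → ℤˣ)) := ⟨(i, 1)⟩
  have hM0 : M ≠ 0 := Fintype.card_ne_zero
  refine ⟨ε ^ M / 2, by positivity, fun m hm L => ?_⟩
  obtain ⟨n₀, hn₀⟩ := exists_few_le p (d := d) hp m (M * L) (ε := ε ^ M / 2) (by positivity)
  refine ⟨n₀, fun n hn i₀ σ₀ => ?_⟩
  have h1 := hn₀ n hn
  let A : Fin d × (Fin d → ℤˣ) → Set (Config d) := fun x => {ω | L < (reachP m n x.1 x.2 ω).card}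
  have hAd : ∀ k, Det (A k) (edgesIn_finite (bx_finite (0 : Zd d) n)).toFinset := by
    intro k
    rw [Set.Finite.coe_toFinset]
    exact det_reach m n fun X => L < (X.filter (· ∈ piece n k.1 k.2)).card
  have hAi : ∀ k, Incr (A k) := by
    intro k ω ω' h h'
    exact lt_of_lt_of_le h (Finset.card_le_card (Finset.filter_subset_filter _ (reach_mono h')))
  have hAm : ∀ k, MeasurableSet (A k) := fun k => (hAd k).measurableSet (Finset.finite_toSet _)
  have h2 := harris_incr_compl (fun _ => p) Finset.univ hAd hAi
  have h3 : ∀ k, (prodM fun _ => p).real (A k) = (prodM fun _ => p).real (A (i₀, σ₀)) := fun k =>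
    le_antisymm (reachP_symm p m n L _ _ _ _) (reachP_symm p m n L _ _ _ _)
  simp only [h3, Finset.prod_const, Finset.card_univ, ← hM, Finset.mem_univ, true_and] at h2
  have hUm : MeasurableSet {ω | ∃ k, ω ∈ A k} := by
    simp_rw [Set.ofPred_exists]
    exact MeasurableSet.iUnion hAm
  rw [← probReal_compl_eq_one_sub hUm, ← probReal_compl_eq_one_sub (hAm _)] at h2
  have h4 : {ω | ∃ k, ω ∈ A k}ᶜ ⊆ {ω : Config d | (reach m n ω).card ≤ M * L} := by
    intro ω hω
    refine card_reach_le fun i σ => ?_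
    by_contra hcon
    exact hω ⟨(i, σ), not_le.1 hcon⟩
  have h5 : (prodM fun _ => p).real (A (i₀, σ₀))ᶜ ^ M ≤ ε ^ M :=
    h2.trans ((measureReal_mono h4).trans (by linarith))
  have h6 := (pow_le_pow_iff_left₀ measureReal_nonneg hε.le hM0).1 h5
  refine le_trans (le_of_eq ?_) h6
  congr 1
  ext ω
  simp [A]

end Reach

section Seeds

variable {d : ℕ}

lemma prodM_real_true {ι : Type*} (q : ι → unitInterval) (s : Finset ι) :
    (prodM q).real {ω | ∀ e ∈ s, ω e = true} = ∏ e ∈ s, (q e : ℝ) := by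
  rw [measureReal_def, prodM_cyl q s fun _ => true]
  simp only [if_true, ENNReal.toReal_prod]
  exact Finset.prod_congr rfl fun e _ => ENNReal.toReal_ofReal (q e).2.1

/-- The slab beyond the face of the box of radius `n` around `q`, in direction `σ i • e_i`,
restricted to the orthant given by `σ` in the other directions. -/
def Tset (q : Zd d) (n m : ℕ) (i : Fin d) (σ : Fin d → ℤˣ) : Set (Zd d) :=
  {x | ((n + 1 : ℤ) ≤ σ i * (x i - q i) ∧ σ i * (x i - q i) ≤ n + 2 * m + 1) ∧
    ∀ j, j ≠ i → 0 ≤ (σ j : ℤ) * (x j - q j) ∧ (σ j : ℤ) * (x j - q j) ≤ n}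

/-- The box of radius `m` around `q` is connected to a fully open box of the same size
in the adjacent slab. -/
def goodA (q : Zd d) (n m : ℕ) (i : Fin d) (σ : Fin d → ℤˣ) (ω : Config d) : Prop :=
  ∃ y, bx y m ⊆ Tset q n m i σ ∧ full ω (bx y m) ∧
    ∃ z ∈ bx q m, conn ω (bx q n ∪ Tset q n m i σ) z y

/-- The centre of the seed attached to a point `w` of the sphere. -/
def seedC (n m : ℕ) (i : Fin d) (σ : Fin d → ℤˣ) (w : Zd d) : Zd d := fun j =>
  if j = i then σ i * (n + 1 + m) else σ j * max (m : ℤ) (min (σ j * w j) (n - m))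

variable {n m : ℕ} {i : Fin d} {σ : Fin d → ℤˣ}

lemma bx_seedC_subset (hmn : 2 * m ≤ n) (w : Zd d) : bx (seedC n m i σ w) m ⊆ Tset 0 n m i σ := by
  intro x hx
  have key : ∀ j, |(σ j : ℤ) * x j - σ j * seedC n m i σ w j| ≤ m := by
    intro j; rw [← mul_sub, abs_units]; exact hx j
  simp only [Tset, Set.mem_ofPred_eq, Pi.zero_apply, sub_zero]
  constructor
  · have := key i
    simp only [seedC, if_true, units_mul_self] at this
    rw [abs_le] at this
    constructor <;> linarith
  · intro j hj
    have := key j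
    simp only [seedC, if_neg hj, units_mul_self] at this
    rw [abs_le] at this
    omega

lemma add_single_mem_bx_seedC (hmn : 2 * m ≤ n) {w : Zd d} (hw : w ∈ piece n i σ)
    (hw' : w ∈ bx 0 n) : w + Pi.single i (σ i : ℤ) ∈ bx (seedC n m i σ w) m := by
  intro j
  rw [← abs_units (σ j)]
  by_cases hj : j = i
  · subst hj
    simp only [Pi.add_apply, Pi.single_eq_same, seedC, if_true, mul_sub, mul_add, units_mul_self,
      hw.1]
    have := units_mul_self (σ j) 1
    rw [mul_one] at this
    rw [this, abs_le]
    omega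
  · simp only [Pi.add_apply, Pi.single_eq_of_ne hj, seedC, if_neg hj, mul_sub, mul_add,
      units_mul_self, add_zero]
    have h1 := hw.2 j
    have h2 := hw' j
    rw [Pi.zero_apply, sub_zero, ← abs_units (σ j)] at h2
    rw [abs_le] at h2 ⊢
    omega

lemma bx_seedC_disjoint {w w' : Zd d} (hw : w ∈ piece n i σ) (hw' : w' ∈ piece n i σ)
    (hwn : w ∈ bx 0 n) (hwn' : w' ∈ bx 0 n)
    (hc : ∀ j, (w j : ZMod (4 * m + 1)) = w' j) (hne : w ≠ w') :
    Disjoint (bx (seedC n m i σ w) m) (bx (seedC n m i σ w') m) := by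
  obtain ⟨j, hj⟩ := Function.ne_iff.1 hne
  have hji : j ≠ i := by
    rintro rfl
    apply hj
    have := hw.1.trans hw'.1.symm
    exact mul_left_cancel₀ (σ j).ne_zero this
  have hdvd : ((4 * m + 1 : ℕ) : ℤ) ∣ σ j * w j - σ j * w' j := by
    rw [← mul_sub]
    refine Dvd.dvd.mul_left ?_ _
    rw [← ZMod.intCast_zmod_eq_zero_iff_dvd]
    simp [hc j]
  have hne' : σ j * w j - σ j * w' j ≠ 0 := by
    rw [← mul_sub]
    exact mul_ne_zero (σ j).ne_zero (sub_ne_zero.2 hj)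
  have habs := Int.le_of_dvd (abs_pos.2 hne') ((dvd_abs _ _).2 hdvd)
  rw [Set.disjoint_left]
  intro x hx hx'
  have h1 := hx j
  have h2 := hx' j
  rw [← abs_units (σ j), mul_sub, seedC, if_neg hji, units_mul_self] at h1 h2
  have h3 := hw.2 j
  have h4 := hw'.2 j
  have h5 := hwn j
  have h6 := hwn' j
  rw [Pi.zero_apply, sub_zero, ← abs_units (σ j)] at h5 h6
  push_cast at habs
  rw [abs_le] at h1 h2 h5 h6
  rw [le_abs] at habs
  omega

/-- The edges which make the seed attached to `w` occupied and connected to `w`. -/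
def seedE (n m : ℕ) (i : Fin d) (σ : Fin d → ℤˣ) (w : Zd d) : Set (Sym2 (Zd d)) :=
  insert s(w, w + Pi.single i (σ i : ℤ)) (edgesIn (bx (seedC n m i σ w) m))

lemma seedE_finite (w : Zd d) : (seedE n m i σ w).Finite :=
  (edgesIn_finite (bx_finite _ _)).insert _

lemma seedE_ncard_le (w : Zd d) : (seedE n m i σ w).ncard ≤ (2 * m + 1) ^ (2 * d) + 1 := by
  refine (Set.ncard_insert_le _ _).trans ?_
  have := edgesIn_ncard_le (bx_finite (seedC n m i σ w) m)
  rw [bx_ncard, ← pow_add, ← two_mul] at this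
  omega

lemma goodA_of_seedE (hmn : 2 * m ≤ n) {ω : Config d} {w : Zd d} (hw : w ∈ reachP m n i σ ω)
    (h : ∀ e ∈ seedE n m i σ w, ω e = true) : goodA 0 n m i σ ω := by
  classical
  obtain ⟨hw1, hw2⟩ := Finset.mem_filter.1 hw
  obtain ⟨hwn, _, z, hz, hc⟩ := mem_reach.1 hw1
  have hfull : full ω (bx (seedC n m i σ w) m) := fun e he => h e (Set.mem_insert_of_mem _ he)
  have hsub := bx_seedC_subset (i := i) (σ := σ) hmn w
  have hmem := add_single_mem_bx_seedC hmn hw2 hwn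
  refine ⟨_, hsub, hfull, z, hz, ?_⟩
  refine ((hc.mono Set.subset_union_left).tail ⟨latAdj_add_single w i ?_,
    h _ (Set.mem_insert _ _)⟩ (Or.inr (hsub hmem))).trans ?_
  · rw [← mul_one ((σ i : ℤ)), abs_units]; rfl
  · exact (conn_of_full_bx hfull hmem (mem_bx_self _ _)).mono
      (hsub.trans Set.subset_union_right)

lemma goodA_trans {q : Zd d} {ω : Config d} (h : goodA 0 n m i σ (act (trans q) ω)) :
    goodA q n m i σ ω := by
  have hT : ∀ x, x ∈ Tset 0 n m i σ ↔ trans q x ∈ Tset q n m i σ := by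
    intro x
    simp [Tset]
  have hb : ∀ k y x, x ∈ bx y k ↔ trans q x ∈ bx (trans q y) k := by
    intro k y x
    simp [bx]
  have h0 : trans q 0 = q := by simp
  obtain ⟨y, h1, h2, z, h3, h4⟩ := h
  refine ⟨trans q y, ?_, ?_, trans q z, ?_, ?_⟩
  · intro x hx
    obtain ⟨x, rfl⟩ := (trans q).surjective x
    exact (hT x).1 (h1 ((hb _ _ _).2 hx))
  · rintro e ⟨a, b, rfl, hab, ha, hb'⟩
    obtain ⟨a, rfl⟩ := (trans q).surjective a
    obtain ⟨b, rfl⟩ := (trans q).surjective b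
    have := h2 s(a, b) (mem_edgesIn.2 ⟨(latAut_trans q _ _).1 hab, (hb _ _ _).2 ha, (hb _ _ _).2 hb'⟩)
    exact this
  · have := (hb m 0 z).1 h3
    rwa [h0] at this
  · refine conn_act (latAut_trans q) (fun x hx => ?_) h4
    rcases hx with hx | hx
    · left
      have := (hb n 0 x).1 hx
      rwa [h0] at this
    · exact Or.inr ((hT x).1 hx)

lemma exists_goodA (p : unitInterval) (hp0 : 0 < (p : ℝ)) (hp1 : (p : ℝ) < 1) (hd : 0 < d)
    (hinf : prodM (fun _ => p) {ω : Config d | ∃ x, (clus ω x).Infinite} = 1)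
    {ε : ℝ} (hε : 0 < ε) (K : ℕ) :
    ∃ m n : ℕ, K * (m + 1) ≤ n ∧ ∀ q i σ,
      (prodM fun _ => p).real {ω : Config d | ¬ goodA q n m i σ ω} ≤ ε := by
  classical
  obtain ⟨ε', hε', hA⟩ := exists_reachP_le (d := d) p hp1 (half_pos hε) ⟨0, hd⟩
  obtain ⟨m, hm⟩ := exists_NoInf_le (d := d) p hinf hε'
  set M := Fintype.card (Fin d → ZMod (4 * m + 1)) with hM
  set ρ : ℝ := (p : ℝ) ^ ((2 * m + 1) ^ (2 * d) + 1) with hρ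
  have hρ0 : 0 < ρ := pow_pos hp0 _
  have hρ1 : ρ ≤ 1 := pow_le_one₀ hp0.le hp1.le
  obtain ⟨t, ht⟩ : ∃ t : ℕ, M * (1 - ρ) ^ t ≤ ε / 2 := by
    have := (tendsto_pow_atTop_nhds_zero_of_lt_one (r := 1 - ρ) (by linarith)
      (by linarith)).const_mul (M : ℝ)
    rw [mul_zero] at this
    obtain ⟨t, ht⟩ := (this.eventually (gt_mem_nhds (half_pos hε))).exists
    exact ⟨t, ht.le⟩
  obtain ⟨n₀, hn₀⟩ := hA m hm (M * t)
  set n := max n₀ (max (K * (m + 1)) (2 * m)) with hn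
  have hmn : 2 * m ≤ n := by omega
  refine ⟨m, n, by omega, fun q i σ => ?_⟩
  refine (measure_le_act p (trans q) (A := {ω : Config d | ¬ goodA q n m i σ ω})
    (B := {ω : Config d | ¬ goodA 0 n m i σ ω}) fun ω hω h => hω (goodA_trans h)).trans ?_
  let cl : Zd d → (Fin d → ZMod (4 * m + 1)) := fun w j => w j
  let N : (Fin d → ZMod (4 * m + 1)) → Config d → Finset (Zd d) := fun r ω =>
    (reachP m n i σ ω).filter fun w => cl w = r
  let E : Zd d → Set (Config d) := fun w => {ω | ∀ e ∈ seedE n m i σ w, ω e = true}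
  have hEdet : ∀ w, Det (E w) (seedE n m i σ w) := fun w ω ω' h =>
    forall₂_congr fun e he => by rw [h e he]
  have hN : ∀ r ω w, w ∈ N r ω → w ∈ bx 0 n ∧ w ∈ piece n i σ ∧ cl w = r := by
    intro r ω w hw
    obtain ⟨h1, h2⟩ := Finset.mem_filter.1 hw
    obtain ⟨h1, h3⟩ := Finset.mem_filter.1 h1
    exact ⟨(mem_reach.1 h1).1, h3, h2⟩
  have hsub : {ω : Config d | ¬ goodA 0 n m i σ ω} ⊆ {ω | (reachP m n i σ ω).card ≤ M * t} ∪
      ⋃ r ∈ (Finset.univ : Finset (Fin d → ZMod (4 * m + 1))),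
        {ω | t ≤ (N r ω).card ∧ ∀ w ∈ N r ω, ω ∉ E w} := by
    intro ω hω
    by_cases hc : (reachP m n i σ ω).card ≤ M * t
    · exact Or.inl hc
    · right
      obtain ⟨r, _, hr⟩ := Finset.exists_lt_card_fiber_of_mul_lt_card_of_maps_to
        (s := reachP m n i σ ω) (t := Finset.univ) (f := cl) (n := t)
        (fun _ _ => Finset.mem_univ _) (by rw [Finset.card_univ, ← hM]; omega)
      simp only [Set.mem_iUnion]
      exact ⟨r, Finset.mem_univ _, hr.le, fun w hw hE =>
        hω (goodA_of_seedE hmn (Finset.mem_filter.1 hw).1 hE)⟩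
  refine (measureReal_mono hsub).trans ((measureReal_union_le _ _).trans ?_)
  have hbound : ∀ r, (prodM fun _ => p).real {ω | t ≤ (N r ω).card ∧ ∀ w ∈ N r ω, ω ∉ E w} ≤
      (1 - ρ) ^ t := by
    intro r
    have := random_family_le (fun _ => p) (G := Set.univ) (E := E) (S := edgesIn (bx 0 n))
      (T := seedE n m i σ) MeasurableSet.univ (fun _ _ _ => Iff.rfl)
      (fun w => (hEdet w).measurableSet (seedE_finite w)) hEdet (N r)
      (fun b => measurableSet_reach m n fun X =>
        ((X.filter (· ∈ piece n i σ)).filter fun w => cl w = r) = b)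
      (fun b => det_reach m n fun X =>
        ((X.filter (· ∈ piece n i σ)).filter fun w => cl w = r) = b) ?_ ?_ hρ0.le hρ1 ?_ t
    · simpa using this
    · intro ω _ w hw
      obtain ⟨h1, h2, _⟩ := hN r ω w hw
      have hb := add_single_mem_bx_seedC hmn h2 h1
      have hout : ∀ x ∈ bx (seedC n m i σ w) m, x ∉ bx 0 n := by
        intro x hx hx'
        have h3 := (bx_seedC_subset hmn w hx).1.1
        have h4 := hx' i
        rw [← abs_units (σ i), abs_le] at h4
        simp only [Pi.zero_apply, sub_zero] at h3 h4
        linarith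
      rw [Set.disjoint_left]
      rintro e he (rfl | ⟨a, b, rfl, _, ha, _⟩)
      · exact hout _ hb (mem_edgesIn.1 he).2.2
      · exact hout _ ha (mem_edgesIn.1 he).2.1
    · intro ω _ w hw w' hw' hne
      obtain ⟨h1, h2, h3⟩ := hN r ω w hw
      obtain ⟨h1', h2', h3'⟩ := hN r ω w' hw'
      have hdis := bx_seedC_disjoint h2 h2' h1 h1'
        (fun j => congrFun (h3.trans h3'.symm) j) hne
      have hout : ∀ u v, u ∈ bx 0 n → u ∉ bx (seedC n m i σ v) m := by
        intro u v hx' hx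
        have h3 := (bx_seedC_subset hmn v hx).1.1
        have h4 := hx' i
        rw [← abs_units (σ i), abs_le] at h4
        simp only [Pi.zero_apply, sub_zero] at h3 h4
        linarith
      have hb := add_single_mem_bx_seedC hmn h2 h1
      have hb' := add_single_mem_bx_seedC hmn h2' h1'
      change Disjoint (seedE n m i σ w) (seedE n m i σ w')
      rw [Set.disjoint_left]
      rintro e (rfl | ⟨a, b, rfl, _, ha, hab⟩) (he | he)
      · rcases Sym2.eq_iff.1 he with ⟨h, _⟩ | ⟨h, _⟩
        · exact hne h
        · exact hout w w' h1 (h ▸ hb')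
      · exact hout w w' h1 (mem_edgesIn.1 he).2.1
      · rcases Sym2.eq_iff.1 he with ⟨h, _⟩ | ⟨_, h⟩
        · exact hout w' w h1' (h ▸ ha)
        · exact hout w' w h1' (h ▸ hab)
      · exact Set.disjoint_left.1 hdis ha (mem_edgesIn.1 he).2.1
    · intro w
      have h1 : E w = {ω | ∀ e ∈ (seedE_finite (n := n) (m := m) (i := i) (σ := σ) w).toFinset,
          ω e = true} := by
        ext ω; simp [E]
      rw [h1, prodM_real_true, Finset.prod_const, ← Set.ncard_eq_toFinset_card _ (seedE_finite w)]
      exact pow_le_pow_of_le_one hp0.le hp1.le (seedE_ncard_le w)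
  have h2 : (prodM fun _ => p).real
      (⋃ r ∈ (Finset.univ : Finset (Fin d → ZMod (4 * m + 1))),
        {ω | t ≤ (N r ω).card ∧ ∀ w ∈ N r ω, ω ∉ E w}) ≤ M * (1 - ρ) ^ t := by
    refine (measureReal_biUnion_finset_le _ _).trans ((Finset.sum_le_sum fun r _ => hbound r).trans ?_)
    simp [hM]
  linarith [hn₀ n (by omega) i σ]

end Seeds

section Grow

variable {d : ℕ} {κ : Type*}

/-- The base configuration. -/
def base (ω : Option κ × Sym2 (Zd d) → Bool) : Config d := fun e => ω (none, e)

/-- The parameters of the base configuration and of the sprinkled layers. -/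
def layerQ (p' ε' : unitInterval) : Option κ × Sym2 (Zd d) → unitInterval :=
  fun i => if i.1 = none then p' else ε'

lemma Tset_subset_bx (q : Zd d) (n m : ℕ) (i : Fin d) (σ : Fin d → ℤˣ) :
    Tset q n m i σ ⊆ bx q (n + 2 * m + 1) := by
  intro x hx j
  rw [← abs_units (σ j), abs_le]
  push_cast
  by_cases hj : j = i
  · subst hj
    have := hx.1
    omega
  · have := hx.2 j hj
    omega

lemma zone_finite (q : Zd d) (n m : ℕ) (i : Fin d) (σ : Fin d → ℤˣ) :
    (bx q n ∪ Tset q n m i σ).Finite :=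
  (bx_finite q n).union ((bx_finite q _).subset (Tset_subset_bx q n m i σ))

/-- The region explored around a seed. -/
noncomputable def zone (q : Zd d) (n m : ℕ) (i : Fin d) (σ : Fin d → ℤˣ) : Finset (Zd d) :=
  (zone_finite q n m i σ).toFinset

lemma mem_zone {q : Zd d} {n m : ℕ} {i : Fin d} {σ : Fin d → ℤˣ} {x : Zd d} :
    x ∈ zone q n m i σ ↔ x ∈ bx q n ∨ x ∈ Tset q n m i σ := by simp [zone]

open Classical in
/-- The vertices of `Z` outside `V` reached from `V` by an edge open in the layer `k` followed by a
path open in the base configuration. -/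
noncomputable def grow (ω : Option κ × Sym2 (Zd d) → Bool) (k : κ) (V Z : Finset (Zd d)) :
    Finset (Zd d) :=
  Z.filter fun w => ∃ u ∈ V, ∃ v ∈ Z, v ∉ V ∧ latAdj u v ∧ ω (some k, s(u, v)) = true ∧
    conn (base ω) ((Z : Set (Zd d)) \ V) v w

lemma mem_grow {ω : Option κ × Sym2 (Zd d) → Bool} {k : κ} {V Z : Finset (Zd d)} {w : Zd d} :
    w ∈ grow ω k V Z ↔ ∃ u ∈ V, ∃ v ∈ Z, v ∉ V ∧ latAdj u v ∧ ω (some k, s(u, v)) = true ∧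
      conn (base ω) ((Z : Set (Zd d)) \ V) v w := by
  classical
  simp only [grow, Finset.mem_filter, and_iff_right_iff_imp]
  rintro ⟨u, _, v, _, _, _, _, h⟩
  exact h.mem.1

/-- The exploration finds a new seed. -/
def growOK (q : Zd d) (n m : ℕ) (i : Fin d) (σ : Fin d → ℤˣ) (W : Finset (Zd d)) : Prop :=
  ∃ y, bx y m ⊆ Tset q n m i σ ∧ bx y m ⊆ W

/-- The coordinates on which the growth depends. -/
def freshE (k : κ) (V Z : Finset (Zd d)) : Set (Option κ × Sym2 (Zd d)) :=
  {e | (∃ f ∈ edgesIn ((Z : Set (Zd d)) \ V), e = (none, f)) ∨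
    ∃ u ∈ V, ∃ v ∈ Z, v ∉ V ∧ latAdj u v ∧ e = (some k, s(u, v))}

lemma freshE_finite (k : κ) (V Z : Finset (Zd d)) : (freshE k V Z).Finite := by
  refine (((edgesIn_finite (Z.finite_toSet.sdiff (t := (V : Set (Zd d))))).image fun f => (none, f)).union
    ((V.finite_toSet.prod Z.finite_toSet).image fun x => (some k, s(x.1, x.2)))).subset ?_
  rintro e (⟨f, hf, rfl⟩ | ⟨u, hu, v, hv, _, _, rfl⟩)
  · exact Or.inl ⟨f, hf, rfl⟩
  · exact Or.inr ⟨(u, v), ⟨hu, hv⟩, rfl⟩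

lemma grow_congr {ω ω' : Option κ × Sym2 (Zd d) → Bool} {k : κ} {V Z : Finset (Zd d)}
    (h : ∀ e ∈ freshE k V Z, ω e = ω' e) : grow ω k V Z = grow ω' k V Z := by
  ext w
  simp only [mem_grow]
  refine exists_congr fun u => and_congr_right fun hu => exists_congr fun v => and_congr_right
    fun hv => and_congr_right fun hvV => and_congr_right fun huv => ?_
  have : conn (base ω) ((Z : Set (Zd d)) \ V) v w ↔ conn (base ω') ((Z : Set (Zd d)) \ V) v w :=
    conn_congr fun e he => h _ (Or.inl ⟨e, he, rfl⟩)
  rw [h _ (Or.inr ⟨u, hu, v, hv, hvV, huv, rfl⟩), this]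

lemma det_grow (k : κ) (V Z : Finset (Zd d)) (P : Finset (Zd d) → Prop) :
    Det {ω | P (grow ω k V Z)} (freshE k V Z) := by
  intro ω ω' h
  change P _ ↔ P _
  rw [grow_congr h]

lemma map_base (p' ε' : unitInterval) :
    (prodM (layerQ (d := d) (κ := κ) p' ε')).map base = prodM fun _ => p' := by
  exact prodM_map_inj (layerQ (d := d) (κ := κ) p' ε')
    (σ := fun e => ((none : Option κ), e)) (Prod.mk_right_injective _)

lemma measurable_base : Measurable (base (d := d) (κ := κ)) :=
  measurable_pi_lambda _ fun _ => measurable_pi_apply _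

variable (p' ε' : unitInterval)

lemma growFail_le (hp1 : (p' : ℝ) < 1) {q : Zd d} {n m : ℕ} {i : Fin d}
    {σ : Fin d → ℤˣ} {V : Finset (Zd d)} (hV : bx q m ⊆ V)
    (hVT : Disjoint (V : Set (Zd d)) (Tset q n m i σ)) (k : κ) (t : ℕ) :
    (prodM (layerQ (d := d) p' ε')).real
      {ω | ¬ growOK q n m i σ (grow ω k V (zone q n m i σ))} ≤
    ((1 - p' : ℝ) ^ t)⁻¹ * (prodM fun _ => p').real {ω : Config d | ¬ goodA q n m i σ ω} +
      (1 - ε') ^ t := by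
  classical
  set μ := prodM (layerQ (d := d) (κ := κ) p' ε') with hμ
  set Z := zone q n m i σ with hZ
  let good : Config d → Zd d → Prop := fun ω v => ∃ y, bx y m ⊆ Tset q n m i σ ∧
    ∀ w ∈ bx y m, conn ω ((Z : Set (Zd d)) \ V) v w
  let N : Config d → Finset (Sym2 (Zd d)) := fun ω =>
    ((V ×ˢ Z).filter fun x => x.2 ∉ V ∧ latAdj x.1 x.2 ∧ good ω x.2).image fun x => s(x.1, x.2)
  have hmemN : ∀ ω e, e ∈ N ω ↔ ∃ u v, u ∈ V ∧ v ∈ Z ∧ v ∉ V ∧ latAdj u v ∧ good ω v ∧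
      e = s(u, v) := by
    intro ω e
    simp only [N, Finset.mem_image, Finset.mem_filter, Finset.mem_product, Prod.exists]
    constructor
    · rintro ⟨u, v, ⟨⟨h1, h2⟩, h3, h4, h5⟩, rfl⟩
      exact ⟨u, v, h1, h2, h3, h4, h5, rfl⟩
    · rintro ⟨u, v, h1, h2, h3, h4, h5, rfl⟩
      exact ⟨u, v, ⟨⟨h1, h2⟩, h3, h4, h5⟩, rfl⟩
  have hTZ : Tset q n m i σ ⊆ (Z : Set (Zd d)) \ V := fun x hx =>
    ⟨mem_zone.2 (Or.inr hx), fun hx' => Set.disjoint_left.1 hVT hx' hx⟩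
  set S : Set (Option κ × Sym2 (Zd d)) := {e | ∃ f ∈ edgesIn ((Z : Set (Zd d)) \ V), e = (none, f)}
    with hS
  have hSfin : S.Finite := ((edgesIn_finite (Z.finite_toSet.sdiff)).image
    fun f => ((none : Option κ), f)).subset fun e ⟨f, hf, he⟩ => ⟨f, hf, he.symm⟩
  have hNcongr : ∀ ω ω' : Option κ × Sym2 (Zd d) → Bool, (∀ e ∈ S, ω e = ω' e) →
      N (base ω) = N (base ω') := by
    intro ω ω' h
    ext e
    simp only [hmemN, good]
    have : ∀ v w, conn (base ω) ((Z : Set (Zd d)) \ V) v w ↔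
        conn (base ω') ((Z : Set (Zd d)) \ V) v w :=
      fun v w => conn_congr fun e he => h _ ⟨e, he, rfl⟩
    simp only [this]
  have hNdet : ∀ b, Det ((fun ω : Option κ × Sym2 (Zd d) → Bool => N (base ω)) ⁻¹' {b}) S := by
    intro b ω ω' h
    change N (base ω) = b ↔ N (base ω') = b
    rw [hNcongr ω ω' h]
  have hdis : ∀ (o : Option κ) (ω : Option κ × Sym2 (Zd d) → Bool), ∀ e ∈ N (base ω),
      Disjoint S {(o, e)} := by
    intro o ω e he
    rw [Set.disjoint_singleton_right]
    rintro ⟨f, hf, hef⟩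
    obtain ⟨u, v, hu, _, _, _, _, rfl⟩ := (hmemN _ _).1 he
    obtain ⟨_, rfl⟩ := Prod.mk.inj hef
    exact (mem_edgesIn.1 hf).2.1.2 hu
  have hpair : ∀ (o : Option κ) (s : Finset (Sym2 (Zd d))),
      (s : Set (Sym2 (Zd d))).PairwiseDisjoint fun e => ({(o, e)} : Set (Option κ × Sym2 (Zd d))) := by
    intro o s a _ b _ hab
    simpa [Function.onFun] using hab
  have h1 := random_family_ge (layerQ (d := d) (κ := κ) p' ε') (G := Set.univ)
    (E := fun e => {ω | ω (none, e) = true}) (S := S) (T := fun e => {(none, e)})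
    MeasurableSet.univ (fun _ _ _ => Iff.rfl) (fun e => measurableSet_coord (none, e) true)
    (fun e => det_coord (none, e) true) (fun ω => N (base ω))
    (fun b => (hNdet b).measurableSet hSfin) hNdet (fun ω _ => hdis none ω)
    (fun ω _ => hpair none _) p'.2.1 p'.2.2 (fun e => by rw [prodM_real_eq]; simp [layerQ]) t
  have h2 := random_family_le (layerQ (d := d) (κ := κ) p' ε') (G := Set.univ)
    (E := fun e => {ω | ω (some k, e) = true}) (S := S) (T := fun e => {(some k, e)})
    MeasurableSet.univ (fun _ _ _ => Iff.rfl) (fun e => measurableSet_coord (some k, e) true)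
    (fun e => det_coord (some k, e) true) (fun ω => N (base ω))
    (fun b => (hNdet b).measurableSet hSfin) hNdet (fun ω _ => hdis (some k) ω)
    (fun ω _ => hpair (some k) _) ε'.2.1 ε'.2.2
    (fun e => by rw [prodM_real_eq]; simp [layerQ]) t
  simp only [Set.univ_inter, probReal_univ, mul_one] at h1 h2
  have h3 : μ.real {ω | ∀ e ∈ N (base ω), ω ∉ {ω | ω (none, e) = true}} ≤
      (prodM fun _ => p').real {ω : Config d | ¬ goodA q n m i σ ω} := by
    refine ENNReal.toReal_mono (measure_ne_top _ _) ?_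
    rw [← map_base (κ := κ) p' ε']
    refine (measure_mono ?_).trans (Measure.le_map_apply measurable_base.aemeasurable _)
    rintro ω hω ⟨y, hyT, hfull, z, hz, hc⟩
    have hyV : y ∈ (V : Set (Zd d))ᶜ := (hTZ (hyT (mem_bx_self y m))).2
    obtain ⟨a, b, h1, h2, h3, h4⟩ := exists_exit hc.symm hyV (fun h => h (hV hz))
    have hZV : (bx q n ∪ Tset q n m i σ) ∩ (V : Set (Zd d))ᶜ = (Z : Set (Zd d)) \ V := by
      ext x
      simp [hZ, mem_zone]
    rw [hZV] at h1
    rw [Set.mem_compl_iff, not_not] at h4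
    refine hω s(b, a) ((hmemN _ _).2 ⟨b, a, h4, h1.mem.1, h1.mem.2, latAdj_symm h2.1, ⟨y, hyT, ?_⟩,
      rfl⟩) (openAdj_symm h2).2
    intro w hw
    exact h1.symm.trans ((conn_of_full_bx hfull (mem_bx_self y m) hw).mono (hyT.trans hTZ))
  have h4 : {ω | ¬ growOK q n m i σ (grow ω k V Z)} ⊆ {ω | (N (base ω)).card ≤ t} ∪
      {ω | t ≤ (N (base ω)).card ∧ ∀ e ∈ N (base ω), ω ∉ {ω | ω (some k, e) = true}} := by
    intro ω hω
    by_cases hc : (N (base ω)).card ≤ t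
    · exact Or.inl hc
    · refine Or.inr ⟨by omega, fun e he hopen => hω ?_⟩
      obtain ⟨u, v, hu, hv, hvV, huv, ⟨y, hy, hyc⟩, rfl⟩ := (hmemN _ _).1 he
      exact ⟨y, hy, fun w hw => mem_grow.2 ⟨u, hu, v, hv, hvV, huv, hopen, hyc w hw⟩⟩
  refine (measureReal_mono h4).trans ((measureReal_union_le _ _).trans ?_)
  refine add_le_add ?_ h2
  rw [← div_eq_inv_mul, le_div_iff₀' (pow_pos (by linarith) t)]
  exact h1.trans h3

lemma exists_growFail_le (hp0 : 0 < (p' : ℝ)) (hp1 : (p' : ℝ) < 1) (hε' : 0 < (ε' : ℝ)) (hd : 0 < d)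
    (hinf : prodM (fun _ => p') {ω : Config d | ∃ x, (clus ω x).Infinite} = 1)
    {ε : ℝ} (hε : 0 < ε) (K : ℕ) :
    ∃ m n : ℕ, K * (m + 1) ≤ n ∧ ∀ q i σ (V : Finset (Zd d)) (k : κ), bx q m ⊆ V →
      Disjoint (V : Set (Zd d)) (Tset q n m i σ) →
      (prodM (layerQ (d := d) p' ε')).real
        {ω | ¬ growOK q n m i σ (grow ω k V (zone q n m i σ))} ≤ ε := by
  obtain ⟨t, ht⟩ : ∃ t : ℕ, (1 - ε' : ℝ) ^ t ≤ ε / 2 := by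
    obtain ⟨t, ht⟩ := ((tendsto_pow_atTop_nhds_zero_of_lt_one (r := 1 - (ε' : ℝ))
      (by linarith [ε'.2.2]) (by linarith)).eventually (gt_mem_nhds (half_pos hε))).exists
    exact ⟨t, ht.le⟩
  have hpt : 0 < (1 - p' : ℝ) ^ t := pow_pos (by linarith) t
  obtain ⟨m, n, hmn, h⟩ := exists_goodA p' hp0 hp1 hd hinf
    (ε := (1 - p' : ℝ) ^ t * (ε / 2)) (by positivity) K
  refine ⟨m, n, hmn, fun q i σ V k hV hVT => ?_⟩
  refine (growFail_le p' ε' hp1 hV hVT k t).trans ?_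
  have := mul_le_mul_of_nonneg_left (h q i σ) (inv_nonneg.2 hpt.le)
  rw [inv_mul_cancel_left₀ hpt.ne'] at this
  linarith

end Grow

section Explore

/-- An exploration instruction: a layer, the centre of the seed, a direction and signs. -/
abbrev Ins (κ : Type*) (d : ℕ) := κ × Zd d × Fin d × (Fin d → ℤˣ)

/-- The outcome of a job: idle, or the possible instruction and the possible resulting datum. -/
abbrev Out (κ : Type*) (d : ℕ) (D : Type*) := Option (Option (Ins κ d) × Option D)

/-- The latest outcome of a job in a history. -/
def look {J X : Type*} [DecidableEq J] : List (J × Option X) → J → Option X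
  | [], _ => none
  | (j', o) :: h, j => if j = j' then o else look h j

/-- An exploration scheme: `ctrl` selects the instruction of each job from the previous outcomes. -/
structure Plan (κ J D : Type*) (d : ℕ) where
  ctrl : J → (J → Out κ d D) → Option (D × Option (Ins κ d))
  upd : D → Zd d → D
  V0 : Finset (Zd d)
  n : ℕ
  m : ℕ

/-- The explored vertices and the history. -/
abbrev St (κ J D : Type*) (d : ℕ) := Finset (Zd d) × List (J × Out κ d D)

variable {d : ℕ} {κ J D : Type*}

/-- The region of an instruction. -/
noncomputable def Plan.izone (P : Plan κ J D d) (I : Ins κ d) : Finset (Zd d) :=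
  zone I.2.1 P.n P.m I.2.2.1 I.2.2.2

/-- Success of an instruction. -/
def Plan.success (P : Plan κ J D d) (I : Ins κ d) (W : Finset (Zd d)) : Prop :=
  growOK I.2.1 P.n P.m I.2.2.1 I.2.2.2 W

open Classical in
/-- The datum produced by an instruction. -/
noncomputable def Plan.result (P : Plan κ J D d) (I : Ins κ d) (x : D) (W : Finset (Zd d)) :
    Option D :=
  if h : P.success I W then some (P.upd x h.choose) else none

open Classical in
/-- One step of the exploration. -/
noncomputable def Plan.adv [DecidableEq J] (P : Plan κ J D d) (j : J) (s : St κ J D d)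
    (ω : Option κ × Sym2 (Zd d) → Bool) : St κ J D d :=
  match P.ctrl j (look s.2) with
  | none => (s.1, (j, none) :: s.2)
  | some (x, none) => (s.1, (j, some (none, some x)) :: s.2)
  | some (x, some I) => (s.1 ∪ grow ω I.1 s.1 (P.izone I),
      (j, some (some I, P.result I x (grow ω I.1 s.1 (P.izone I)))) :: s.2)

/-- The exploration of a list of jobs, the head being processed last. -/
noncomputable def Plan.run [DecidableEq J] (P : Plan κ J D d) : List J → (Option κ × Sym2 (Zd d) → Bool) → St κ J D d
  | [], _ => (P.V0, [])
  | j :: l, ω => P.adv j (P.run l ω) ω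

variable (P : Plan κ J D d)

lemma Plan.adv_cases [DecidableEq J] (j : J) (s : St κ J D d) (ω : Option κ × Sym2 (Zd d) → Bool) :
    (P.ctrl j (look s.2) = none ∧ P.adv j s ω = (s.1, (j, none) :: s.2)) ∨
    (∃ x, P.ctrl j (look s.2) = some (x, none) ∧
      P.adv j s ω = (s.1, (j, some (none, some x)) :: s.2)) ∨
    ∃ x I, P.ctrl j (look s.2) = some (x, some I) ∧
      P.adv j s ω = (s.1 ∪ grow ω I.1 s.1 (P.izone I),
        (j, some (some I, P.result I x (grow ω I.1 s.1 (P.izone I)))) :: s.2) := by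
  unfold Plan.adv
  rcases h : P.ctrl j (look s.2) with _ | ⟨x, _ | I⟩
  · exact Or.inl ⟨rfl, rfl⟩
  · exact Or.inr (Or.inl ⟨x, rfl, rfl⟩)
  · exact Or.inr (Or.inr ⟨x, I, rfl, rfl⟩)

lemma Plan.adv_some [DecidableEq J] {j : J} {s : St κ J D d} {x : D} {I : Ins κ d}
    (hc : P.ctrl j (look s.2) = some (x, some I)) (ω : Option κ × Sym2 (Zd d) → Bool) :
    P.adv j s ω = (s.1 ∪ grow ω I.1 s.1 (P.izone I),
      (j, some (some I, P.result I x (grow ω I.1 s.1 (P.izone I)))) :: s.2) := by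
  simp [Plan.adv, hc]

lemma Plan.result_eq_some {I : Ins κ d} {x x' : D} {W : Finset (Zd d)}
    (h : P.result I x W = some x') :
    ∃ y, bx y P.m ⊆ Tset I.2.1 P.n P.m I.2.2.1 I.2.2.2 ∧ bx y P.m ⊆ W ∧ x' = P.upd x y := by
  unfold Plan.result at h
  split_ifs at h with hs
  exact ⟨hs.choose, hs.choose_spec.1, hs.choose_spec.2, (Option.some.inj h).symm⟩

lemma Plan.result_eq_none {I : Ins κ d} {x : D} {W : Finset (Zd d)} :
    P.result I x W = none ↔ ¬ P.success I W := by
  unfold Plan.result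
  split_ifs with hs <;> simp [hs]

/-- The instructions in a history. -/
def insOf (h : List (J × Out κ d D)) : List (Ins κ d) := h.filterMap fun x => x.2.bind Prod.fst

lemma mem_insOf {h : List (J × Out κ d D)} {I : Ins κ d} :
    I ∈ insOf h ↔ ∃ j o, (j, some (some I, o)) ∈ h := by
  simp only [insOf, List.mem_filterMap, Prod.exists]
  constructor
  · rintro ⟨j, _ | ⟨_ | I', o⟩, h1, h2⟩ <;> simp at h2
    exact ⟨j, o, h2 ▸ h1⟩
  · rintro ⟨j, o, h1⟩
    exact ⟨j, _, h1, rfl⟩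

/-- The coordinates on which the exploration depends. -/
def Plan.usedE (s : St κ J D d) : Set (Option κ × Sym2 (Zd d)) :=
  {e | (∃ a ∈ s.1, ∃ b, latAdj a b ∧ e = (none, s(a, b))) ∨
    ∃ I ∈ insOf s.2, ∃ u ∈ s.1, ∃ v ∈ P.izone I, e = (some I.1, s(u, v))}

lemma Plan.usedE_mono {s s' : St κ J D d} (h1 : s.1 ⊆ s'.1) (h2 : insOf s.2 ⊆ insOf s'.2) :
    P.usedE s ⊆ P.usedE s' := by
  rintro e (⟨a, ha, b, hb, rfl⟩ | ⟨I, hI, u, hu, v, hv, rfl⟩)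
  · exact Or.inl ⟨a, h1 ha, b, hb, rfl⟩
  · exact Or.inr ⟨I, h2 hI, u, h1 hu, v, hv, rfl⟩

lemma Plan.usedE_finite (s : St κ J D d) : (P.usedE s).Finite := by
  have h1 : (⋃ a ∈ s.1, (fun b => ((none : Option κ), s(a, b))) '' bx a 1).Finite :=
    s.1.finite_toSet.biUnion fun a _ => (bx_finite a 1).image _
  have h2 : (⋃ I ∈ {I | I ∈ insOf s.2}, ⋃ u ∈ s.1,
      (fun v => (some I.1, s(u, v))) '' (P.izone I : Set (Zd d))).Finite :=
    (List.finite_toSet _).biUnion fun I _ => s.1.finite_toSet.biUnion fun u _ =>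
      (P.izone I).finite_toSet.image _
  refine (h1.union h2).subset ?_
  rintro e (⟨a, ha, b, hb, rfl⟩ | ⟨I, hI, u, hu, v, hv, rfl⟩)
  · left
    simp only [Set.mem_iUnion]
    exact ⟨a, ha, b, fun i => by rw [abs_sub_comm]; exact_mod_cast hb.abs_sub_le i, rfl⟩
  · right
    simp only [Set.mem_iUnion]
    exact ⟨I, hI, u, hu, v, hv, rfl⟩

lemma Plan.le_adv [DecidableEq J] (j : J) (s : St κ J D d) (ω : Option κ × Sym2 (Zd d) → Bool) :
    s.1 ⊆ (P.adv j s ω).1 ∧ insOf s.2 ⊆ insOf (P.adv j s ω).2 := by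
  rcases P.adv_cases j s ω with ⟨_, h⟩ | ⟨x, _, h⟩ | ⟨x, I, _, h⟩ <;> rw [h]
  · exact ⟨subset_rfl, by simp [insOf]⟩
  · exact ⟨subset_rfl, by simp [insOf]⟩
  · exact ⟨Finset.subset_union_left, by simp [insOf]⟩

/-- The exploration is determined by the coordinates it uses. -/
lemma Plan.run_congr [DecidableEq J] (l : List J) {ω ω' : Option κ × Sym2 (Zd d) → Bool}
    (h : ∀ e ∈ P.usedE (P.run l ω), ω e = ω' e) : P.run l ω' = P.run l ω := by
  induction l with
  | nil => rfl
  | cons j l ih =>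
    have hle := P.le_adv j (P.run l ω) ω
    have h1 := ih fun e he => h e (P.usedE_mono hle.1 hle.2 he)
    change P.adv j (P.run l ω') ω' = P.adv j (P.run l ω) ω
    rw [h1]
    replace h : ∀ e ∈ P.usedE (P.adv j (P.run l ω) ω), ω e = ω' e := h
    generalize P.run l ω = s at *
    rcases hc : P.ctrl j (look s.2) with _ | ⟨x, _ | I⟩
    · simp [Plan.adv, hc]
    · simp [Plan.adv, hc]
    · have hadv : ∀ ω, P.adv j s ω = (s.1 ∪ grow ω I.1 s.1 (P.izone I),
        (j, some (some I, P.result I x (grow ω I.1 s.1 (P.izone I)))) :: s.2) := by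
        intro ω; simp [Plan.adv, hc]
      suffices grow ω' I.1 s.1 (P.izone I) = grow ω I.1 s.1 (P.izone I) by
        rw [hadv, hadv, this]
      rw [hadv] at h
      set W := grow ω I.1 s.1 (P.izone I) with hW
      have hlay : ∀ u ∈ s.1, ∀ v ∈ P.izone I, ω (some I.1, s(u, v)) = ω' (some I.1, s(u, v)) :=
        fun u hu v hv => h _ (Or.inr ⟨I, by simp [insOf], u, Finset.mem_union_left _ hu, v, hv, rfl⟩)
      have hbase : ∀ a ∈ W, ∀ b, latAdj a b → ω (none, s(a, b)) = ω' (none, s(a, b)) :=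
        fun a ha b hab => h _ (Or.inl ⟨a, Finset.mem_union_right _ ha, b, hab, rfl⟩)
      ext w
      constructor
      · intro hw
        obtain ⟨u, hu, v, hv, hvV, huv, ho, hvZ, hc⟩ := mem_grow.1 hw
        have hvW : v ∈ W := mem_grow.2 ⟨u, hu, v, hv, hvV, huv, by rw [hlay u hu v hv]; exact ho,
          conn.refl hvZ⟩
        clear hw
        induction hc with
        | refl => exact hvW
        | @tail a b _ hab ih =>
          obtain ⟨u', hu', v', hv', hvV', huv', ho', hc'⟩ := mem_grow.1 ih
          refine mem_grow.2 ⟨u', hu', v', hv', hvV', huv', ho', hc'.tail ⟨hab.1.1, ?_⟩ hab.2.2⟩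
          change ω (none, s(a, b)) = true
          rw [hbase a ih b hab.1.1]
          exact hab.1.2
      · intro hw
        obtain ⟨u, hu, v, hv, hvV, huv, ho, hvZ, hc⟩ := mem_grow.1 hw
        have hvW : v ∈ W := mem_grow.2 ⟨u, hu, v, hv, hvV, huv, ho, conn.refl hvZ⟩
        have hvW' : v ∈ grow ω' I.1 s.1 (P.izone I) :=
          mem_grow.2 ⟨u, hu, v, hv, hvV, huv, by rw [← hlay u hu v hv]; exact ho, conn.refl hvZ⟩
        suffices w ∈ W ∧ w ∈ grow ω' I.1 s.1 (P.izone I) from this.2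
        clear hw
        induction hc with
        | refl => exact ⟨hvW, hvW'⟩
        | @tail a b _ hab ih =>
          obtain ⟨u1, hu1, v1, hv1, hvV1, huv1, ho1, hc1⟩ := mem_grow.1 ih.1
          obtain ⟨u', hu', v', hv', hvV', huv', ho', hc'⟩ := mem_grow.1 ih.2
          refine ⟨mem_grow.2 ⟨u1, hu1, v1, hv1, hvV1, huv1, ho1, hc1.tail hab.1 hab.2.2⟩,
            mem_grow.2 ⟨u', hu', v', hv', hvV', huv', ho', hc'.tail ⟨hab.1.1, ?_⟩ hab.2.2⟩⟩
          change ω' (none, s(a, b)) = true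
          rw [← hbase a ih.1 b hab.1.1]
          exact hab.1.2

lemma Plan.det_run [DecidableEq J] (l : List J) (st : St κ J D d) :
    Det {ω | P.run l ω = st} (P.usedE st) := by
  intro ω ω' h
  constructor
  · rintro rfl
    exact P.run_congr l h
  · rintro rfl
    exact P.run_congr l fun e he => (h e he).symm

lemma Plan.measurableSet_run [DecidableEq J] (l : List J) (st : St κ J D d) :
    MeasurableSet {ω | P.run l ω = st} :=
  (P.det_run l st).measurableSet (P.usedE_finite st)

lemma Plan.V0_subset [DecidableEq J] (l : List J) (ω : Option κ × Sym2 (Zd d) → Bool) : P.V0 ⊆ (P.run l ω).1 := by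
  induction l with
  | nil => exact subset_rfl
  | cons j l ih => exact ih.trans (P.le_adv j _ ω).1

lemma Plan.run_snd_cons [DecidableEq J] (j : J) (l : List J) (ω : Option κ × Sym2 (Zd d) → Bool) :
    ∃ o, (P.run (j :: l) ω).2 = (j, o) :: (P.run l ω).2 := by
  rcases P.adv_cases j (P.run l ω) ω with ⟨_, h⟩ | ⟨x, _, h⟩ | ⟨x, I, _, h⟩ <;>
    exact ⟨_, congrArg Prod.snd h⟩

lemma Plan.map_fst_run [DecidableEq J] (l : List J) (ω : Option κ × Sym2 (Zd d) → Bool) :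
    (P.run l ω).2.map Prod.fst = l := by
  induction l with
  | nil => rfl
  | cons j l ih =>
    obtain ⟨o, ho⟩ := P.run_snd_cons j l ω
    rw [ho, List.map_cons, ih]

lemma mem_of_look [DecidableEq J] {X : Type*} {h : List (J × Option X)} {j : J} {x : X}
    (hx : look h j = some x) : (j, some x) ∈ h := by
  induction h with
  | nil => simp [look] at hx
  | cons a h ih =>
    obtain ⟨j', o⟩ := a
    unfold look at hx
    split_ifs at hx with hj
    · subst hj hx
      exact List.mem_cons_self
    · exact List.mem_cons_of_mem _ (ih hx)

lemma look_of_mem [DecidableEq J] {X : Type*} {h : List (J × Option X)} (hn : (h.map Prod.fst).Nodup) {j : J}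
    {o : Option X} (hx : (j, o) ∈ h) : look h j = o := by
  induction h with
  | nil => simp at hx
  | cons a h ih =>
    obtain ⟨j', o'⟩ := a
    rw [List.map_cons, List.nodup_cons] at hn
    unfold look
    rcases List.mem_cons.1 hx with hx | hx
    · cases hx
      simp
    · rw [if_neg, ih hn.2 hx]
      intro hjj
      exact hn.1 (List.mem_map.2 ⟨(j, o), hx, hjj⟩)

/-- Lists of jobs processed by nondecreasing keys, without repetition. -/
def Ordered (key : J → ℕ) (l : List J) : Prop :=
  l.Pairwise fun j j' => key j' ≤ key j ∧ j ≠ j'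

lemma Ordered.nodup {key : J → ℕ} {l : List J} (h : Ordered key l) : l.Nodup :=
  List.Pairwise.imp (fun h => h.2) h

lemma Ordered.tail {key : J → ℕ} {j : J} {l : List J} (h : Ordered key (j :: l)) : Ordered key l :=
  (List.pairwise_cons.1 h).2

/-- A scheme is valid if each instruction starts from an explored seed, aims at an unexplored
region, and meets only regions of strictly smaller keys and of different layers. -/
def Plan.Valid [DecidableEq J] (key : J → ℕ) (O : Set (Zd d)) : Prop :=
  ∀ j l ω x I, Ordered key (j :: l) → P.ctrl j (look (P.run l ω).2) = some (x, some I) →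
    bx I.2.1 P.m ⊆ ((P.run l ω).1 : Set (Zd d)) ∧
    Disjoint ((P.run l ω).1 : Set (Zd d)) (Tset I.2.1 P.n P.m I.2.2.1 I.2.2.2) ∧
    (∀ I' ∈ insOf (P.run l ω).2, I'.1 = I.1 → Disjoint (P.izone I') (P.izone I)) ∧
    (P.izone I : Set (Zd d)) ⊆ O ∧
    ∀ j' I' o, (j', some (some I', o)) ∈ (P.run l ω).2 →
      ∀ x ∈ P.izone I', ∀ y ∈ P.izone I, latAdj x y ∨ x = y → key j' < key j

variable {P}

lemma Plan.Valid.disjoint_fresh [DecidableEq J] {key : J → ℕ} {O : Set (Zd d)} (hP : P.Valid key O) {j : J}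
    {l : List J} {ω : Option κ × Sym2 (Zd d) → Bool} {x : D} {I : Ins κ d}
    (hl : Ordered key (j :: l)) (hc : P.ctrl j (look (P.run l ω).2) = some (x, some I)) :
    Disjoint (P.usedE (P.run l ω)) (freshE I.1 (P.run l ω).1 (P.izone I)) := by
  obtain ⟨_, _, h3, _⟩ := hP j l ω x I hl hc
  rw [Set.disjoint_left]
  rintro e (⟨a, ha, b, hb, rfl⟩ | ⟨I', hI', u, hu, v, hv, rfl⟩) (⟨f, hf, he⟩ | ⟨u', hu', v', hv', hvV', huv', he⟩)
  · obtain rfl : s(a, b) = f := (Prod.ext_iff.1 he).2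
    exact (mem_edgesIn.1 hf).2.1.2 ha
  · simp at he
  · simp at he
  · obtain ⟨hk, he⟩ := Prod.ext_iff.1 he
    replace hk : I'.1 = I.1 := Option.some.inj hk
    replace he : s(u, v) = s(u', v') := he
    rcases Sym2.eq_iff.1 he with ⟨rfl, rfl⟩ | ⟨rfl, rfl⟩
    · exact Finset.disjoint_left.1 (h3 I' hI' hk) hv hv'
    · exact hvV' hu

/-- The initial region is open. -/
def Plan.H0 (P : Plan κ J D d) : Set (Option κ × Sym2 (Zd d) → Bool) := {ω | full (base ω) P.V0}

lemma Plan.det_H0 (st : St κ J D d) (h : P.V0 ⊆ st.1) : Det P.H0 (P.usedE st) := by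
  intro ω ω' hω
  refine forall_congr' fun e => forall_congr' fun he => ?_
  obtain ⟨a, b, rfl, hab, ha, hb⟩ := he
  change ω _ = true ↔ ω' _ = true
  rw [hω _ (Or.inl ⟨a, h ha, b, hab, rfl⟩)]

lemma Plan.measurableSet_H0 : MeasurableSet P.H0 :=
  (Plan.det_H0 (P := P) ((P.V0, []) : St κ J D d) subset_rfl).measurableSet (P.usedE_finite _)

/-- The probability that given jobs all fail is exponentially small. -/
lemma Plan.Valid.fail_le [DecidableEq J] [Countable κ] [Countable J] [Countable D] {p' ε' : unitInterval}
    {key : J → ℕ} {O : Set (Zd d)} (hP : P.Valid key O) {ε : ℝ} (hε0 : 0 ≤ ε)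
    (hε : ∀ q i σ (V : Finset (Zd d)) (k : κ), bx q P.m ⊆ V →
      Disjoint (V : Set (Zd d)) (Tset q P.n P.m i σ) →
      (prodM (layerQ (d := d) p' ε')).real
        {ω | ¬ growOK q P.n P.m i σ (grow ω k V (zone q P.n P.m i σ))} ≤ ε)
    (l : List J) (hl : Ordered key l) (S : Finset J) (hS : ∀ j ∈ S, j ∈ l) :
    (prodM (layerQ (d := d) p' ε')).real
      (P.H0 ∩ {ω | ∀ j ∈ S, ∃ I, look (P.run l ω).2 j = some (some I, none)}) ≤
      ε ^ S.card * (prodM (layerQ (d := d) p' ε')).real P.H0 := by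
  set μ := prodM (layerQ (d := d) (κ := κ) p' ε') with hμ
  induction l generalizing S with
  | nil =>
    obtain rfl : S = ∅ := Finset.eq_empty_of_forall_notMem fun j hj => by simpa using hS j hj
    simp
  | cons j l ih =>
    have hlook : ∀ ω, ∀ j' ≠ j, look (P.run (j :: l) ω).2 j' = look (P.run l ω).2 j' := by
      intro ω j' hj'
      obtain ⟨o, ho⟩ := P.run_snd_cons j l ω
      rw [ho, look, if_neg hj']
    by_cases hj : j ∈ S
    swap
    · refine le_of_eq_of_le ?_ (ih hl.tail S fun j' hj' => (List.mem_cons.1 (hS j' hj')).resolve_left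
        fun h => hj (h ▸ hj'))
      congr 1
      ext ω
      refine and_congr_right fun _ => forall₂_congr fun j' hj' => ?_
      rw [hlook ω j' fun h => hj (h ▸ hj')]
    have ih' := ih hl.tail (S.erase j) fun j' hj' =>
      (List.mem_cons.1 (hS j' (Finset.mem_of_mem_erase hj'))).resolve_left (Finset.ne_of_mem_erase hj')
    rw [← Finset.card_erase_add_one hj, pow_succ', mul_assoc]
    refine le_trans ?_ (mul_le_mul_of_nonneg_left ih' hε0)
    rw [← one_mul (μ.real _)]
    refine fiber_le (fun ω => P.run l ω) (P.measurableSet_run l) zero_le_one hε0 fun st => ?_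
    rw [one_mul]
    by_cases hst : ∃ ω0, P.run l ω0 = st
    swap
    · push Not at hst
      have : (fun ω => P.run l ω) ⁻¹' {st} = ∅ := Set.eq_empty_of_forall_notMem fun ω hω => hst ω hω
      simp [this]
    obtain ⟨ω0, hω0⟩ := hst
    by_cases hE : ∀ j' ∈ S.erase j, ∃ I, look st.2 j' = some (some I, none)
    swap
    · refine le_of_eq_of_le (b := 0) ?_ (by positivity)
      convert measureReal_empty (μ := μ) using 2
      refine Set.eq_empty_of_forall_notMem fun ω ⟨⟨_, hω⟩, h⟩ => hE fun j' hj' => ?_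
      obtain ⟨I, hI⟩ := hω j' (Finset.mem_of_mem_erase hj')
      rw [hlook ω j' (Finset.ne_of_mem_erase hj')] at hI
      obtain rfl : P.run l ω = st := h
      exact ⟨I, hI⟩
    have hB : (P.H0 ∩ {ω | ∀ j' ∈ S.erase j, ∃ I, look (P.run l ω).2 j' = some (some I, none)}) ∩
        (fun ω => P.run l ω) ⁻¹' {st} = P.H0 ∩ {ω | P.run l ω = st} := by
      ext ω
      constructor
      · rintro ⟨⟨h1, _⟩, h2⟩
        exact ⟨h1, h2⟩
      · rintro ⟨h1, rfl⟩
        exact ⟨⟨h1, hE⟩, rfl⟩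
    rw [hB]
    by_cases hc : ∃ x I, P.ctrl j (look st.2) = some (x, some I)
    swap
    · refine le_of_eq_of_le (b := 0) ?_ (by positivity)
      convert measureReal_empty (μ := μ) using 2
      refine Set.eq_empty_of_forall_notMem fun ω ⟨⟨_, hω⟩, h⟩ => ?_
      obtain rfl : P.run l ω = st := h
      obtain ⟨I, hI⟩ := hω j hj
      rcases P.adv_cases j (P.run l ω) ω with ⟨_, h⟩ | ⟨x, _, h⟩ | ⟨x, I, h, _⟩
      · change look (P.adv j (P.run l ω) ω).2 j = _ at hI
        simp [h, look] at hI
      · change look (P.adv j (P.run l ω) ω).2 j = _ at hI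
        simp [h, look] at hI
      · exact hc ⟨x, I, h⟩
    obtain ⟨x, I, hc⟩ := hc
    subst hω0
    have hv := hP j l ω0 x I hl hc
    have hd := hP.disjoint_fresh hl hc
    have hV0 := P.V0_subset l ω0
    generalize P.run l ω0 = st at *
    have hfd := det_grow I.1 st.1 (P.izone I) fun W => ¬ P.success I W
    calc μ.real _ ≤ μ.real ((P.H0 ∩ {ω | P.run l ω = st}) ∩
          {ω | ¬ P.success I (grow ω I.1 st.1 (P.izone I))}) := by
          refine measureReal_mono ?_
          rintro ω ⟨⟨h1, h2⟩, h3⟩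
          obtain rfl : P.run l ω = st := h3
          refine ⟨⟨h1, rfl⟩, ?_⟩
          obtain ⟨I', hI'⟩ := h2 j hj
          change look (P.adv j (P.run l ω) ω).2 j = _ at hI'
          rw [P.adv_some hc] at hI'
          simp only [look, if_true, Option.some.injEq, Prod.mk.injEq] at hI'
          exact P.result_eq_none.1 hI'.2
      _ = μ.real (P.H0 ∩ {ω | P.run l ω = st}) *
          μ.real {ω | ¬ P.success I (grow ω I.1 st.1 (P.izone I))} :=
          indep_det _ (Plan.measurableSet_H0.inter (P.measurableSet_run l st))
            (hfd.measurableSet (freshE_finite _ _ _))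
            ((P.det_H0 st hV0).inter (P.det_run l st)) hfd hd
      _ ≤ μ.real (P.H0 ∩ {ω | P.run l ω = st}) * ε :=
          mul_le_mul_of_nonneg_left (hε _ _ _ _ _ hv.1 hv.2.1) (by positivity)
      _ = _ := mul_comm _ _

end Explore

section Ball

variable {d : ℕ}

/-- The ball for the chemical distance inside `O`. -/
def ball (χ : Config d) (O : Set (Zd d)) (x : Zd d) : ℕ → Set (Zd d)
  | 0 => {x}
  | n + 1 => ball χ O x n ∪ {y | y ∈ O ∧ ∃ z ∈ ball χ O x n, openAdj χ z y}

lemma ball_mono (χ : Config d) (O : Set (Zd d)) (x : Zd d) : Monotone (ball χ O x) :=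
  monotone_nat_of_le_succ fun _ => Set.subset_union_left

lemma ball_conn {χ : Config d} {O : Set (Zd d)} {x : Zd d} {S : Finset (Zd d)}
    (hS : (S : Set (Zd d)) ⊆ O) {a b : Zd d} {n : ℕ} (ha : a ∈ ball χ O x n)
    (h : conn χ S a b) : b ∈ ball χ O x (n + S.card) := by
  classical
  have key : ∀ k, k + 1 ≤ (S.filter (· ∈ ball χ O x (n + k))).card ∨ b ∈ ball χ O x (n + k) := by
    intro k
    induction k with
    | zero =>
      left
      exact Finset.card_pos.2 ⟨a, Finset.mem_filter.2 ⟨h.1, ha⟩⟩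
    | succ k ih =>
      rcases ih with ih | ih
      swap
      · exact Or.inr (ball_mono χ O x (by omega) ih)
      by_cases hc : ∀ y ∈ S, y ∈ ball χ O x (n + (k + 1)) → y ∈ ball χ O x (n + k)
      · right
        obtain ⟨_, h⟩ := h
        induction h with
        | refl => exact ball_mono χ O x (by omega) ha
        | @tail u v _ huv ih' =>
          exact Or.inr ⟨hS huv.2.2, u, hc u huv.2.1 ih', huv.1⟩
      · push Not at hc
        obtain ⟨y, hy, h1, h2⟩ := hc
        left
        refine Nat.succ_le_of_lt (lt_of_le_of_lt ih (Finset.card_lt_card ⟨?_, ?_⟩))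
        · exact Finset.monotone_filter_right _ fun z _ hz => ball_mono χ O x (by omega) hz
        · intro hsub
          exact h2 (Finset.mem_filter.1 (hsub (Finset.mem_filter.2 ⟨hy, h1⟩))).2
  refine (key S.card).resolve_left fun h => ?_
  have := Finset.card_filter_le S (· ∈ ball χ O x (n + S.card))
  omega

end Ball

section Explore

variable {d : ℕ} {κ J D : Type*} [DecidableEq J] {P : Plan κ J D d}

/-- Explored vertices are within a chemical distance controlled by the key of their job. -/
lemma Plan.Valid.dist_le {key : J → ℕ} {O : Set (Zd d)} (hP : P.Valid key O) {Zc N0 : ℕ}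
    (hZ : ∀ I, (P.izone I).card ≤ Zc) {χ : Config d} {ω : Option κ × Sym2 (Zd d) → Bool}
    (hχ : ∀ o e, ω (o, e) = true → χ e = true) {x0 : Zd d}
    (hN0 : (P.V0 : Set (Zd d)) ⊆ ball χ O x0 N0) (l : List J) (hl : Ordered key l) :
    ∀ x ∈ (P.run l ω).1, x ∈ ball χ O x0 N0 ∨ ∃ j I o, (j, some (some I, o)) ∈ (P.run l ω).2 ∧
      x ∈ P.izone I ∧ x ∈ ball χ O x0 (N0 + (Zc + 1) * (key j + 1)) := by
  classical
  induction l with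
  | nil => exact fun x hx => Or.inl (hN0 hx)
  | cons j l ih =>
    replace ih := ih hl.tail
    intro x hx
    change x ∈ (P.adv j (P.run l ω) ω).1 at hx
    change _ ∨ ∃ j' I o, (j', some (some I, o)) ∈ (P.adv j (P.run l ω) ω).2 ∧ _
    rcases P.adv_cases j (P.run l ω) ω with ⟨_, h⟩ | ⟨y, _, h⟩ | ⟨y, I, hc, h⟩
    · rw [h] at hx ⊢
      rcases ih x hx with ih | ⟨j', I, o, h1, h2⟩
      · exact Or.inl ih
      · exact Or.inr ⟨j', I, o, List.mem_cons_of_mem _ h1, h2⟩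
    · rw [h] at hx ⊢
      rcases ih x hx with ih | ⟨j', I, o, h1, h2⟩
      · exact Or.inl ih
      · exact Or.inr ⟨j', I, o, List.mem_cons_of_mem _ h1, h2⟩
    rw [h] at hx ⊢
    rcases Finset.mem_union.1 hx with hx | hx
    · rcases ih x hx with ih | ⟨j', I, o, h1, h2⟩
      · exact Or.inl ih
      · exact Or.inr ⟨j', I, o, List.mem_cons_of_mem _ h1, h2⟩
    right
    obtain ⟨u, hu, v, hv, hvV, huv, ho, hconn⟩ := mem_grow.1 hx
    obtain ⟨_, _, _, hO, hkey⟩ := hP j l ω y I hl hc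
    have hu' : u ∈ ball χ O x0 (N0 + (Zc + 1) * key j) := by
      rcases ih u hu with ih | ⟨j', I', o, h1, h2, h3⟩
      · exact ball_mono χ O x0 (by omega) ih
      · have := hkey j' I' o h1 u h2 v hv (Or.inl huv)
        exact ball_mono χ O x0 (by gcongr; omega) h3
    have hv' : v ∈ ball χ O x0 (N0 + (Zc + 1) * key j + 1) :=
      Or.inr ⟨hO hv, u, hu', huv, hχ _ _ ho⟩
    have hS : ((P.izone I \ (P.run l ω).1 : Finset (Zd d)) : Set (Zd d)) ⊆ O :=
      fun z hz => hO (Finset.mem_sdiff.1 hz).1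
    have hx' := ball_conn (χ := χ) hS hv' (b := x) (by
      rw [Finset.coe_sdiff]
      exact hconn.congr fun e _ he => hχ _ _ he)
    have hxZ : x ∈ P.izone I := hconn.mem.1
    refine ⟨j, I, _, List.mem_cons_self, hxZ, ball_mono χ O x0 ?_ hx'⟩
    have := Finset.card_le_card (Finset.sdiff_subset (s := P.izone I) (t := (P.run l ω).1))
    have := hZ I
    nlinarith

end Explore

section Steering

variable {d : ℕ}

/-- The length of a step of the exploration. -/
def stepLen (n m : ℕ) : ℤ := n + m + 1

/-- The coarse lattice spacing. -/
def spacing (d n m : ℕ) : ℤ := (2 * d + 40) * stepLen n m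

/-- The current state of a tube: direction, arrival direction, starting point, current point. -/
abbrev Datum (d : ℕ) := Fin d × Fin d × Zd d × Zd d

open Classical in
/-- The direction of the step number `s` of a tube around the axis through `w`. -/
noncomputable def sdir (n : ℕ) (w : Zd d) (s : ℕ) (i : Fin d) (q : Zd d) : Fin d :=
  if h : ∃ j : Fin d, s = 4 + 2 * j ∧ j ≠ i ∧ (n : ℤ) < |q j - w j| then h.choose else i

/-- The signs of the step number `s` of a tube around the axis through `w`. -/
def ssgn (w : Zd d) (s : ℕ) (i a : Fin d) (c q : Zd d) (l : Fin d) : ℤˣ :=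
  if l = i then 1 else
  if s < 4 then (if l = a ∧ s < 2 then 1 else if q l < c l then 1 else -1)
  else if w l < q l then -1 else 1

lemma sdir_cases (n : ℕ) (w : Zd d) (s : ℕ) (i : Fin d) (q : Zd d) :
    sdir n w s i q = i ∨ (s = 4 + 2 * (sdir n w s i q : ℕ) ∧ sdir n w s i q ≠ i ∧
      (n : ℤ) < |q (sdir n w s i q) - w (sdir n w s i q)|) := by
  unfold sdir
  split_ifs with h
  · exact Or.inr h.choose_spec
  · exact Or.inl rfl

lemma sdir_eq (n : ℕ) (w : Zd d) {s : ℕ} {i : Fin d} {q : Zd d} {j : Fin d} (hs : s = 4 + 2 * (j : ℕ))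
    (hj : j ≠ i) (h : (n : ℤ) < |q j - w j|) : sdir n w s i q = j := by
  rcases sdir_cases n w s i q with h' | ⟨h', _⟩
  · exfalso
    unfold sdir at h'
    have hex : ∃ j : Fin d, s = 4 + 2 * j ∧ j ≠ i ∧ (n : ℤ) < |q j - w j| := ⟨j, hs, hj, h⟩
    rw [dif_pos hex] at h'
    exact hex.choose_spec.2.1 h'
  · exact Fin.ext (by omega)

/-- The possible positions of the new seed. -/
def Disp (n m : ℕ) (q y : Zd d) (D : Fin d) (σ : Fin d → ℤˣ) : Prop :=
  σ D * (y D - q D) = stepLen n m ∧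
    ∀ l, l ≠ D → (m : ℤ) ≤ σ l * (y l - q l) ∧ (σ l : ℤ) * (y l - q l) ≤ n - m

lemma disp_of_subset {n m : ℕ} {q y : Zd d} {D : Fin d} {σ : Fin d → ℤˣ}
    (h : bx y m ⊆ Tset q n m D σ) : Disp n m q y D σ := by
  have h1 := h (show (fun l => y l + m) ∈ bx y m from fun l => by simp)
  have h2 := h (show (fun l => y l - m) ∈ bx y m from fun l => by simp)
  refine ⟨?_, fun l hl => ?_⟩
  · have h1 := h1.1
    have h2 := h2.1
    unfold stepLen
    rcases Int.units_eq_one_or (σ D) with hs | hs <;> simp only [hs, Units.val_one, Units.val_neg] at * <;>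
      omega
  · have h1 := h1.2 l hl
    have h2 := h2.2 l hl
    rcases Int.units_eq_one_or (σ l) with hs | hs <;> simp only [hs, Units.val_one, Units.val_neg] at * <;>
      omega

/-- The invariants of a tube before its step number `s`. -/
structure TubeInv (n m s : ℕ) (i a : Fin d) (c w q : Zd d) : Prop where
  start : ∀ j, -(n : ℤ) ≤ c j - w j ∧ c j - w j ≤ n
  start_a : c a - w a ≤ m
  zero : s = 0 → q = c
  early : s ≤ 4 → q i = c i + s * stepLen n m
  near : s ≤ 4 → ∀ j, j ≠ i → j ≠ a → -(n : ℤ) ≤ q j - c j ∧ q j - c j ≤ n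
  one : s = 1 → ∀ j, j ≠ i → j ≠ a → q j ≤ c j
  near_a : s ≤ 4 → a ≠ i → -(n : ℤ) ≤ q a - c a ∧ q a - c a ≤ 2 * n - 2 * m
  one_a : s = 1 → a ≠ i → m ≤ q a - c a ∧ q a - c a ≤ n - m
  late : 4 ≤ s → ∀ j, j ≠ i → -(2 * n : ℤ) ≤ q j - w j ∧ q j - w j ≤ 2 * n
  small : ∀ j, j ≠ i → 4 + 2 * (j : ℕ) < s → -(n : ℤ) ≤ q j - w j ∧ q j - w j ≤ n
  late_i : 4 ≤ s → c i + 4 * stepLen n m ≤ q i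
  up : s ≤ 4 + 2 * d → q i ≤ c i + s * stepLen n m
  final_up : 4 + 2 * d ≤ s → q i ≤ w i + spacing d n m + m
  final : 4 + 2 * d ≤ s → c i + 4 * stepLen n m + (s - 4 - 2 * d) * stepLen n m ≤ q i ∨
    w i + spacing d n m - n ≤ q i

lemma TubeInv.of_center {n m : ℕ} {i a : Fin d} {c w : Zd d}
    (start : ∀ j, -(n : ℤ) ≤ c j - w j ∧ c j - w j ≤ n) (start_a : c a - w a ≤ m) (hnm : m ≤ n) :
    TubeInv n m 0 i a c w c := by
  constructor <;> simp_all

lemma TubeInv.pass {n m s : ℕ} {i a : Fin d} {c w q : Zd d} (h : TubeInv n m s i a c w q)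
    (hs : 4 + 2 * d ≤ s) (hq : w i + spacing d n m - n ≤ q i) :
    TubeInv n m (s + 1) i a c w q := by
  obtain ⟨h1, h2, h3, h4, h5, h6, h7, h8, h9, h10, h11, h12, h13, h14⟩ := h
  constructor <;> intros
  all_goals first | exact h1 _ | exact h2 | omega | skip
  · exact h9 (by omega) _ ‹_›
  · exact h10 _ ‹_› (by omega)

lemma TubeInv.next {n m s : ℕ} (hnm : 2 * m + 1 ≤ n) {i a : Fin d} {c w q y : Zd d}
    (h : TubeInv n m s i a c w q) (hq : 4 + 2 * d ≤ s → q i < w i + spacing d n m - n)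
    (hy : Disp n m q y (sdir n w s i q) (ssgn w s i a c q)) :
    TubeInv n m (s + 1) i a c w y := by
  have hd : 0 < d := i.pos
  have hh : stepLen n m = n + m + 1 := rfl
  obtain ⟨h1, h2, h3, h4, h5, h6, h7, h8, h9, h10, h11, h12, h13, h14⟩ := h
  obtain ⟨hy1, hy2⟩ := hy
  have hdir := sdir_cases n w s i q
  -- the lateral displacements
  have hlate : 4 ≤ s → ∀ j, j ≠ i → (-(2 * n : ℤ) ≤ y j - w j ∧ y j - w j ≤ 2 * n) ∧
      (-(n : ℤ) ≤ q j - w j → q j - w j ≤ n → -(n : ℤ) ≤ y j - w j ∧ y j - w j ≤ n) ∧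
      (s = 4 + 2 * (j : ℕ) → -(n : ℤ) ≤ y j - w j ∧ y j - w j ≤ n) := by
    intro hs j hj
    have h9 := h9 hs j hj
    have hsg : ssgn w s i a c q j = if w j < q j then -1 else 1 := by
      simp [ssgn, hj, show ¬ s < 4 by omega]
    by_cases hjd : j = sdir n w s i q
    · rw [← hjd] at hy1 hdir
      obtain ⟨hs', _, habs⟩ := hdir.resolve_left hj
      rw [hsg] at hy1
      rw [lt_abs] at habs
      split_ifs at hy1 with hlt <;> simp only [Units.val_one, Units.val_neg] at hy1 <;> omega
    · have := hy2 j hjd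
      rw [hsg] at this
      have hnot : s = 4 + 2 * (j : ℕ) → -(n : ℤ) ≤ q j - w j ∧ q j - w j ≤ n := by
        intro hs'
        rw [← abs_le]
        by_contra hc
        exact hjd (sdir_eq n w hs' hj (not_le.1 hc)).symm
      split_ifs at this with hlt <;> simp only [Units.val_one, Units.val_neg] at this <;> omega
  have hi : (sdir n w s i q = i ∧ y i = q i + stepLen n m) ∨
      (sdir n w s i q ≠ i ∧ 4 ≤ s ∧ s < 4 + 2 * d ∧ m ≤ y i - q i ∧ y i - q i ≤ n - m) := by
    have hsg : ssgn w s i a c q i = 1 := by simp [ssgn]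
    by_cases hid : sdir n w s i q = i
    · left
      rw [hid, hsg] at hy1
      simp only [Units.val_one] at hy1
      exact ⟨hid, by omega⟩
    · right
      have := hy2 i (Ne.symm hid)
      rw [hsg] at this
      simp only [Units.val_one] at this
      have h' := hdir.resolve_left hid
      have := (sdir n w s i q).2
      exact ⟨hid, by omega, by omega, by omega, by omega⟩
  have hearly : s < 4 → y i = q i + stepLen n m ∧ ∀ j, j ≠ i →
      (if j = a ∧ s < 2 then (m : ℤ) ≤ y j - q j ∧ y j - q j ≤ n - m else
        if q j < c j then (m : ℤ) ≤ y j - q j ∧ y j - q j ≤ n - m else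
        (m : ℤ) ≤ q j - y j ∧ q j - y j ≤ n - m) := by
    intro hs
    rcases hi with ⟨hid, hi⟩ | hi
    swap
    · omega
    refine ⟨hi, fun j hj => ?_⟩
    have := hy2 j (by rwa [hid])
    simp only [ssgn, hj, hs, if_true, if_false] at this
    split_ifs at this ⊢ <;> simp only [Units.val_one, Units.val_neg] at this <;> omega
  clear hy1 hy2 hdir
  have hsl : 0 ≤ (s : ℤ) * stepLen n m := by rw [hh]; positivity
  have hmul : ((s + 1 : ℕ) : ℤ) * stepLen n m = s * stepLen n m + stepLen n m := by push_cast; ring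
  refine ⟨h1, h2, by omega, fun hs => ?_, fun hs j hj hja => ?_, fun hs j hj hja => ?_, fun hs ha => ?_,
    fun hs ha => ?_, fun hs j hj => ?_, fun j hj hs => ?_, fun hs => ?_, fun hs => ?_, fun hs => ?_,
    fun hs => ?_⟩
  · rw [(hearly (by omega)).1, h4 (by omega), hmul]; ring
  · have := (hearly (by omega)).2 j hj
    simp only [hja, false_and, if_false] at this
    have := h5 (by omega) j hj hja
    split_ifs at * <;> omega
  · have := (hearly (by omega)).2 j hj
    simp only [hja, false_and, if_false] at this
    rw [h3 (by omega)] at this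
    simp only [lt_irrefl, if_false] at this
    omega
  · have := (hearly (by omega)).2 a ha
    have := h7 (by omega) ha
    by_cases hs0 : s = 0
    · rw [h3 hs0] at *
      split_ifs at * <;> omega
    by_cases hs1 : s = 1
    · have := h8 hs1 ha
      split_ifs at * <;> omega
    simp only [show ¬ s < 2 by omega, and_false, if_false] at *
    split_ifs at * <;> omega
  · have := (hearly (by omega)).2 a ha
    rw [h3 (by omega)] at this
    simp only [show s < 2 by omega, and_self, if_true] at this
    omega
  · by_cases hs' : 4 ≤ s
    · exact (hlate hs' j hj).1
    · have := (hearly (by omega)).2 j hj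
      have := h1 j
      by_cases hja : j = a
      · subst hja
        have := h7 (by omega) hj
        split_ifs at * <;> omega
      · have := h5 (by omega) j hj hja
        split_ifs at * <;> omega
  · have hl := hlate (by omega) j hj
    by_cases hs' : s = 4 + 2 * (j : ℕ)
    · exact hl.2.2 hs'
    · have := h10 j hj (by omega)
      exact hl.2.1 this.1 this.2
  · by_cases hs' : 4 ≤ s
    · have := h11 hs'
      omega
    · have h4 := h4 (by omega)
      have := (hearly (by omega)).1
      obtain rfl : s = 3 := by omega
      push_cast at *
      omega
  · have := h12 (by omega)
    omega
  · by_cases hs' : 4 + 2 * d ≤ s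
    · have := hq hs'
      omega
    · have h12 := h12 (by omega)
      have : (s : ℤ) ≤ 4 + 2 * d := by omega
      have h1 := h1 i
      unfold spacing
      have : (s : ℤ) * stepLen n m ≤ (4 + 2 * d) * stepLen n m :=
        mul_le_mul_of_nonneg_right this (by omega)
      have e : (2 * d + 40 : ℤ) * stepLen n m = (4 + 2 * d) * stepLen n m + 36 * stepLen n m := by ring
      omega
  · by_cases hs' : 4 + 2 * d ≤ s
    · rcases h14 hs' with h14 | h14
      · rcases hi with hi | hi
        · left
          have e : (((s + 1 : ℕ) : ℤ) - 4 - 2 * d) * stepLen n m =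
            (s - 4 - 2 * d) * stepLen n m + stepLen n m := by push_cast; ring
          omega
        · omega
      · have := hq hs'
        omega
    · left
      have e : (((s + 1 : ℕ) : ℤ) - 4 - 2 * d) = 0 := by omega
      rw [e, zero_mul, add_zero]
      have : 4 ≤ s := by omega
      have := h11 this
      omega

/-- The points of the tubes from `w` in the direction `i` are close to the segment. -/
def Near (n m : ℕ) (i : Fin d) (w x : Zd d) : Prop :=
  ∀ j, w j - 4 * n ≤ x j ∧ x j ≤ w j + 4 * n + if j = i then spacing d n m else 0

/-- The target of the step number `s`. -/
def stepT (n m : ℕ) (w : Zd d) (s : ℕ) (i a : Fin d) (c q : Zd d) : Set (Zd d) :=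
  Tset q n m (sdir n w s i q) (ssgn w s i a c q)

lemma mem_stepT {n m s : ℕ} {i a : Fin d} {c w q x : Zd d} (hx : x ∈ stepT n m w s i a c q) :
    (sdir n w s i q = i ∧ q i + n + 1 ≤ x i ∧ x i ≤ q i + n + 2 * m + 1 ∧
      (∀ j, j ≠ i → q j - n ≤ x j ∧ x j ≤ q j + n) ∧
      (s < 4 → ∀ j, j ≠ i → if j = a ∧ s < 2 then q j ≤ x j else
        if q j < c j then q j ≤ x j else x j ≤ q j)) ∨
    (∃ j0, j0 ≠ i ∧ s = 4 + 2 * (j0 : ℕ) ∧ sdir n w s i q = j0 ∧ q i ≤ x i ∧ x i ≤ q i + n ∧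
      (w j0 + n < q j0 ∧ q j0 - (n + 2 * m + 1) ≤ x j0 ∧ x j0 ≤ q j0 - n - 1 ∨
        q j0 < w j0 - n ∧ q j0 + n + 1 ≤ x j0 ∧ x j0 ≤ q j0 + n + 2 * m + 1) ∧
      ∀ j, j ≠ j0 → q j - n ≤ x j ∧ x j ≤ q j + n) := by
  obtain ⟨h1, h2⟩ := hx
  have hlat : ∀ j, j ≠ sdir n w s i q → q j - n ≤ x j ∧ x j ≤ q j + n := by
    intro j hj
    have := h2 j hj
    rcases Int.units_eq_one_or (ssgn w s i a c q j) with hs | hs <;>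
      simp only [hs, Units.val_one, Units.val_neg] at this <;> omega
  have hsi : ssgn w s i a c q i = 1 := by simp [ssgn]
  rcases sdir_cases n w s i q with hd | ⟨hs, hne, habs⟩
  · left
    rw [hd] at h1 h2 hlat
    rw [hsi] at h1
    simp only [Units.val_one] at h1
    refine ⟨hd, by omega, by omega, hlat, fun hs j hj => ?_⟩
    have := h2 j hj
    simp only [ssgn, hj, hs, if_true, if_false] at this
    split_ifs at this ⊢ <;> simp only [Units.val_one, Units.val_neg] at this <;> omega
  · right
    have h3 := h2 i hne.symm
    rw [hsi] at h3
    simp only [Units.val_one] at h3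
    have hsg : ssgn w s i a c q (sdir n w s i q) =
        if w (sdir n w s i q) < q (sdir n w s i q) then -1 else 1 := by
      simp only [ssgn, hne, if_false, show ¬ s < 4 by omega]
    rw [hsg] at h1
    refine ⟨_, hne, hs, rfl, by omega, by omega, ?_, hlat⟩
    rw [lt_abs] at habs
    split_ifs at h1 with hlt <;> simp only [Units.val_one, Units.val_neg] at h1 <;> omega

lemma sdir_eq_self (n : ℕ) (w : Zd d) {s : ℕ} (i : Fin d) (q : Zd d)
    (h : s < 4 ∨ s % 2 = 1 ∨ 4 + 2 * d ≤ s) : sdir n w s i q = i := by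
  refine (sdir_cases n w s i q).resolve_right fun h' => ?_
  have := (sdir n w s i q).2
  omega

variable {n m s : ℕ} {i a : Fin d} {c w q : Zd d}

lemma mul_stepLen_le (n m : ℕ) {s k : ℕ} (hk : s ≤ k) :
    (s : ℤ) * stepLen n m ≤ k * stepLen n m :=
  mul_le_mul_of_nonneg_right (by exact_mod_cast hk) (by unfold stepLen; omega)

lemma TubeInv.lateral (h : TubeInv n m s i a c w q) {j : Fin d} (hj : j ≠ i) :
    w j - 2 * n - m ≤ q j ∧ q j ≤ w j + 2 * n := by
  by_cases hs : 4 ≤ s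
  · have := h.late hs j hj
    omega
  · have h1 := h.start j
    by_cases hja : j = a
    · subst hja
      have := h.near_a (by omega) hj
      have := h.start_a
      omega
    · have := h.near (by omega) j hj hja
      omega

lemma TubeInv.ge_start (h : TubeInv n m s i a c w q) : c i ≤ q i := by
  by_cases hs : 4 ≤ s
  · have := h.late_i hs
    unfold stepLen at this
    omega
  · have := h.early (by omega)
    have : 0 ≤ (s : ℤ) * stepLen n m := by unfold stepLen; positivity
    omega

lemma TubeInv.up_active (h : TubeInv n m s i a c w q)
    (hq : 4 + 2 * d ≤ s → q i < w i + spacing d n m - n) :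
    q i ≤ w i + spacing d n m - n := by
  by_cases hs : 4 + 2 * d ≤ s
  · exact (hq hs).le
  · have h12 := h.up (by omega)
    have hmul := mul_stepLen_le n m (show s ≤ 4 + 2 * d by omega)
    have h1 := h.start i
    have e : (2 * d + 40 : ℤ) * stepLen n m = (4 + 2 * d) * stepLen n m + 36 * stepLen n m := by ring
    unfold spacing
    push_cast at hmul
    have : stepLen n m = n + m + 1 := rfl
    omega

/-- The region of an active step stays near the axis. -/
lemma TubeInv.near_zone (hnm : 2 * m + 1 ≤ n) (h : TubeInv n m s i a c w q)
    (hq : 4 + 2 * d ≤ s → q i < w i + spacing d n m - n) {x : Zd d}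
    (hx : x ∈ bx q n ∨ x ∈ stepT n m w s i a c q) : Near n m i w x := by
  have h1 := h.start i
  have h2 := h.ge_start
  have h3 := h.up_active hq
  have hsp : 0 ≤ spacing d n m := by unfold spacing stepLen; positivity
  intro j
  have hl : j ≠ i → w j - 2 * n - m ≤ q j ∧ q j ≤ w j + 2 * n := fun hj => h.lateral hj
  rcases hx with hx | hx
  · have := abs_le.1 (hx j)
    split_ifs with hj
    · subst hj; omega
    · have := hl hj; omega
  · rcases mem_stepT hx with ⟨_, h4, h5, h6, _⟩ | ⟨j0, hj0, _, _, h4, h5, h6, h7⟩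
    · split_ifs with hj
      · subst hj; omega
      · have := hl hj
        have := h6 j hj
        omega
    · split_ifs with hj
      · subst hj; omega
      · have := hl hj
        by_cases hjj : j = j0
        · subst hjj; omega
        · have := h7 j hjj
          omega

/-- A vertex lies behind the point `q` of a tube in the direction `i`. -/
def Behind (n m : ℕ) (i : Fin d) (q x : Zd d) : Prop :=
  x i ≤ q i - m - 1 ∨ x i ≤ q i + m ∧ ∀ j, j ≠ i → q j - (n - m) ≤ x j ∧ x j ≤ q j + (n - m)

lemma zone_le (hnm : 2 * m + 1 ≤ n) {y : Zd d}
    (hy : Disp n m q y (sdir n w s i q) (ssgn w s i a c q)) {x : Zd d}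
    (hx : x i ≤ q i + n ∨ x ∈ stepT n m w s i a c q) :
    x i ≤ y i + n ∧ (sdir n w s i q = i → Behind n m i y x) := by
  have hsi : ssgn w s i a c q i = 1 := by simp [ssgn]
  obtain ⟨hy1, hy2⟩ := hy
  have hh : stepLen n m = n + m + 1 := rfl
  by_cases hd : sdir n w s i q = i
  · rw [hd] at hy1 hy2
    rw [hsi] at hy1
    simp only [Units.val_one] at hy1
    rcases hx with hx | hx
    · exact ⟨by omega, fun _ => Or.inl (by omega)⟩
    · rw [stepT, hd] at hx
      obtain ⟨h1, h2⟩ := hx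
      rw [hsi] at h1
      simp only [Units.val_one] at h1
      refine ⟨by omega, fun _ => Or.inr ⟨by omega, fun j hj => ?_⟩⟩
      have h3 := hy2 j hj
      have h4 := h2 j hj
      rcases Int.units_eq_one_or (ssgn w s i a c q j) with hs | hs <;>
        simp only [hs, Units.val_one, Units.val_neg] at * <;> omega
  · have h3 := hy2 i (Ne.symm hd)
    rw [hsi] at h3
    simp only [Units.val_one] at h3
    refine ⟨?_, fun h => absurd h hd⟩
    rcases hx with hx | hx
    · omega
    · rcases mem_stepT hx with ⟨h4, _⟩ | ⟨j0, hj0, _, _, h4, h5, h6, h7⟩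
      · exact absurd h4 hd
      · omega

/-- The target of a step avoids the previous regions of the same tube. -/
lemma not_mem_stepT_of_behind {x : Zd d} (h1 : x i ≤ q i + n)
    (h2 : sdir n w s i q ≠ i → Behind n m i q x) : x ∉ stepT n m w s i a c q := by
  intro hx
  rcases mem_stepT hx with ⟨_, h4, h5, h6, _⟩ | ⟨j0, hj0, _, hd, h4, h5, h6, h7⟩
  · omega
  · rcases h2 (by rwa [hd]) with h | ⟨_, h⟩
    · omega
    · have := h j0 hj0
      omega

/-- The target of a step avoids the regions of the other tubes with the same starting point. -/
lemma TubeInv.not_mem_stepT_sibling (hnm : 2 * m + 1 ≤ n) (h : TubeInv n m s i a c w q) {s' : ℕ}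
    {i' : Fin d} {q' : Zd d} (h' : TubeInv n m s' i' a c w q') (hi : i ≠ i') {x : Zd d}
    (hx' : x ∈ bx q' n ∨ x ∈ stepT n m w s' i' a c q') : x ∉ stepT n m w s i a c q := by
  intro hx
  have hh : stepLen n m = n + m + 1 := rfl
  have h1 := h.start
  have hge' := h'.ge_start
  -- bounds on the old region
  have hB : ∀ (P : Prop), (x ∈ bx q' n → P) → (x ∈ stepT n m w s' i' a c q' → P) → P :=
    fun P hP1 hP2 => hx'.elim hP1 hP2
  have hlat' :
      (s' < 4 → q' i - n ≤ x i ∧ x i ≤ q' i + n) ∧ q' i' - n ≤ x i' ∧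
      (4 ≤ s' → x i ≤ w i + 3 * n + 2 * m + 1) ∧ (s' = 0 → x i ≤ c i + n) ∧
      (s' = 1 → i ≠ a → x i ≤ c i + n) := by
    refine hB _ (fun hx => ?_) fun hx => ?_
    · have e1 := abs_le.1 (hx i)
      have e2 := abs_le.1 (hx i')
      have e3 : 4 ≤ s' → q' i ≤ w i + 2 * n := fun hs => by have := h'.late hs i hi; omega
      have e4 : s' = 0 → q' i = c i := fun hs => by rw [h'.zero hs]
      have e5 : s' = 1 → i ≠ a → q' i ≤ c i := fun hs => h'.one hs i hi
      refine ⟨by omega, by omega, by omega, by omega, fun hs ha => ?_⟩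
      have := e5 hs ha
      omega
    · have e3 : 4 ≤ s' → q' i ≤ w i + 2 * n := fun hs => by have := h'.late hs i hi; omega
      have e4 : s' = 0 → q' i = c i := fun hs => by rw [h'.zero hs]
      have e5 : s' = 1 → i ≠ a → q' i ≤ c i := fun hs => h'.one hs i hi
      rcases mem_stepT hx with ⟨_, f1, f2, f3, f4⟩ | ⟨j0, hj0, hsj, _, f1, f2, f3, f4⟩
      · have f3 := f3 i hi
        refine ⟨by omega, by omega, by omega, by omega, fun hs ha => ?_⟩
        have := e5 hs ha
        omega
      · refine ⟨by omega, by omega, fun hs => ?_, by omega, by omega⟩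
        by_cases hij : i = j0
        · subst hij
          have := e3 hs
          omega
        · have := f4 i hij
          have := e3 hs
          omega
  obtain ⟨g2, g3, g4, g5, g6⟩ := hlat'
  have hs1 : ∀ k : ℕ, k ≤ s → s ≤ 4 → c i + k * stepLen n m ≤ q i := fun k hk hs => by
    have := mul_stepLen_le n m hk
    have := h.early hs
    omega
  have hs1' : ∀ k : ℕ, k ≤ s' → s' ≤ 4 → c i' + k * stepLen n m ≤ q' i' := fun k hk hs => by
    have := mul_stepLen_le n m hk
    have := h'.early hs
    omega
  have hq'i : s' < 4 → q' i ≤ c i + 2 * n ∧ (i ≠ a → q' i ≤ c i + n) := fun hs => by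
    by_cases hia : i = a
    · subst hia
      have := h'.near_a (by omega) hi
      omega
    · have := h'.near (by omega) i hi hia
      omega
  by_cases hs : 4 ≤ s
  · have h4 := h.late_i hs
    have h1i := h1 i
    have hxi : q i ≤ x i := by
      rcases mem_stepT hx with ⟨_, f1, _⟩ | ⟨j0, hj0, _, _, f1, _⟩ <;> omega
    by_cases hs' : 4 ≤ s'
    · have := g4 hs'
      omega
    · have := g2 (by omega)
      have := hq'i (by omega)
      omega
  obtain ⟨_, f1, f2, f3, f4⟩ := (mem_stepT hx).resolve_right fun ⟨j0, _, hj, _⟩ => by omega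
  have f3 := f3 i' hi.symm
  have f4 := f4 (by omega) i' hi.symm
  have hqi' : q i' ≤ c i' + 2 * n ∧ (i' ≠ a → q i' ≤ c i' + n) := by
    by_cases hia : i' = a
    · subst hia
      have := h.near_a (by omega) hi.symm
      omega
    · have := h.near (by omega) i' hi.symm hia
      omega
  by_cases hs' : 4 ≤ s'
  · have := h'.late_i hs'
    omega
  have g2 := g2 (by omega)
  have hq'i := hq'i (by omega)
  have hc := h.ge_start
  by_cases hs0' : s' = 0
  · have := g5 hs0'
    omega
  have k1 := hs1' 1 (by omega) (by omega)
  by_cases hs0 : s = 0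
  · rw [h.zero hs0] at *
    by_cases hia : i' = a
    · by_cases hs1'' : s' = 1
      · have := g6 hs1'' (by rw [← hia]; exact hi)
        omega
      · have := hs1' 2 (by omega) (by omega)
        push_cast at *
        omega
    · simp only [hia, false_and, if_false, lt_irrefl] at f4
      push_cast at *
      omega
  have k2 := hs1 1 (by omega) (by omega)
  by_cases hia : i = a
  · by_cases hs1'' : s' = 1
    · have := h'.one_a hs1'' (by rw [← hia]; exact hi)
      rw [← hia] at this
      push_cast at *
      omega
    · have := hs1' 2 (by omega) (by omega)
      have hia' : i' ≠ a := by rw [← hia]; exact hi.symm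
      have := hqi'.2 hia'
      simp only [hia', false_and, if_false] at f4
      push_cast at *
      split_ifs at f4 <;> omega
  · have := hq'i.2 hia
    push_cast at *
    omega

/-- The target of a step avoids the regions of the tube arriving at its starting point. -/
lemma TubeInv.not_mem_stepT_parent (hnm : 2 * m + 1 ≤ n) (h : TubeInv n m s i a c w q)
    (hq : 4 + 2 * d ≤ s → q i < w i + spacing d n m - n) {s' : ℕ}
    {a' : Fin d} {c' w' q' : Zd d} (h' : TubeInv n m s' a a' c' w' q')
    (hw : ∀ j, w j = w' j + if j = a then spacing d n m else 0) {x : Zd d}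
    (hx' : x ∈ bx q' n ∨ x ∈ stepT n m w' s' a a' c' q') (hb : Behind n m a c x) :
    x ∉ stepT n m w s i a c q := by
  intro hx
  have hh : stepLen n m = n + m + 1 := rfl
  have hc := h.ge_start
  by_cases hia : i = a
  · subst hia
    have : c i + n + 1 ≤ x i := by
      rcases mem_stepT hx with ⟨_, f1, _⟩ | ⟨j0, hj0, hs, _, f1, _⟩
      · omega
      · have := h.late_i (by omega)
        omega
    rcases hb with hb | hb <;> omega
  by_cases hs0 : s = 0
  · obtain ⟨_, f1, f2, f3, f4⟩ := (mem_stepT hx).resolve_right fun ⟨j0, _, hj, _⟩ => by omega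
    have f4 := f4 (by omega) a (Ne.symm hia)
    rw [h.zero hs0] at *
    simp only [hs0, true_and, show 0 < 2 by norm_num, if_true] at f4
    rcases hb with hb | ⟨hb, hb'⟩
    · omega
    · have := hb' i hia
      omega
  have hxi : 1 ≤ s → c i + stepLen n m ≤ x i ∧ (2 ≤ s → c i + 2 * stepLen n m + n + 1 ≤ x i) := by
    intro hs
    rcases mem_stepT hx with ⟨_, f1, _⟩ | ⟨j0, hj0, hs, _, f1, _⟩
    · by_cases h4 : 4 ≤ s
      · have := h.late_i h4
        omega
      · have := h.early (by omega)
        have h1 := mul_stepLen_le n m hs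
        by_cases h2 : 2 ≤ s
        · have h2 := mul_stepLen_le n m h2
          push_cast at *
          omega
        · push_cast at *
          omega
    · have := h.late_i (by omega)
      omega
  have hxi := hxi (by omega)
  rcases hb with hb | ⟨hb, hb'⟩
  swap
  · have := hb' i hia
    omega
  by_cases hs1 : s = 1
  · obtain ⟨_, f1, f2, f3, f4⟩ := (mem_stepT hx).resolve_right fun ⟨j0, _, hj, _⟩ => by omega
    have f4 := f4 (by omega) a (Ne.symm hia)
    simp only [hs1, true_and, show 1 < 2 by norm_num, if_true] at f4
    have := h.one_a hs1 (Ne.symm hia)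
    omega
  have hxi := hxi.2 (by omega)
  have hsti := h.start i
  have hwi := hw i
  rw [if_neg hia] at hwi
  by_cases hs' : 4 + 2 * d ≤ s'
  · have hsm := h'.small i hia (by omega)
    rcases hx' with hx' | hx'
    · have := abs_le.1 (hx' i)
      omega
    · rcases mem_stepT hx' with ⟨_, _, _, f3, _⟩ | ⟨j0, _, hs, _⟩
      · have := f3 i hia
        omega
      · omega
  · have h12 := h'.up (by omega)
    have hmul := mul_stepLen_le n m (show s' ≤ 4 + 2 * d by omega)
    have h1 := h'.start a
    have e : (2 * d + 40 : ℤ) * stepLen n m = (4 + 2 * d) * stepLen n m + 36 * stepLen n m := by ring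
    have hwa := hw a
    rw [if_pos rfl] at hwa
    unfold spacing at hwa
    push_cast at hmul
    have hN := (h.near_zone hnm hq (Or.inr hx) a).1
    have : x a ≤ q' a + n + 2 * m + 1 := by
      rcases hx' with hx' | hx'
      · have := abs_le.1 (hx' a)
        omega
      · rcases mem_stepT hx' with ⟨_, _, _, f3, _⟩ | ⟨j0, _, hs, _⟩ <;> omega
    omega

/-- The target of a step from the root avoids the initial region. -/
lemma TubeInv.le_of_mem_stepT (hnm : 2 * m + 1 ≤ n) (h : TubeInv n m s i a c w q) {x : Zd d}
    (hx : x ∈ stepT n m w s i a c q) : c i + n + 1 ≤ x i := by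
  have hh : stepLen n m = n + m + 1 := rfl
  have hc := h.ge_start
  rcases mem_stepT hx with ⟨_, f1, _⟩ | ⟨j0, hj0, hs, _, f1, _⟩
  · omega
  · have := h.late_i (by omega)
    omega

end Steering

section Scheme

/-- The number of steps of a tube. -/
def nst (d : ℕ) : ℕ := 4 * d + 44

/-- The jobs: a coarse site and the number of a step of its tube. -/
abbrev Job (d : ℕ) := (Fin d → ℕ) × ℕ

/-- A height on the coarse lattice separating the successors of a site. -/
def height {d : ℕ} (v : Fin d → ℕ) : ℕ := ∑ i : Fin d, ((i : ℕ) + 1) * v i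

/-- The order of the jobs. -/
def jkey {d : ℕ} (j : Job d) : ℕ := height j.1 * nst d + j.2

/-- The layers. -/
abbrev Col (d : ℕ) := (Fin d → Fin 4) × Fin d × Fin (nst d)

variable {d : ℕ}

/-- The predecessor of a coarse site. -/
def pre (v : Fin d → ℕ) (i : Fin d) : Fin d → ℕ := fun j => if j = i then v j - 1 else v j

/-- The position of a coarse site. -/
def cpos (n m : ℕ) (u : Fin d → ℕ) : Zd d := fun j => 6 * n + spacing d n m * u j

/-- The instruction of a step. -/
noncomputable def inst (n m : ℕ) (v : Fin d → ℕ) (s : ℕ) (D : Datum d) : Ins (Col d) d :=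
  ((fun j => ⟨pre v D.1 j % 4, Nat.mod_lt _ (by norm_num)⟩, D.1,
      ⟨s % nst d, Nat.mod_lt _ (by unfold nst; omega)⟩),
    D.2.2.2, sdir n (cpos n m (pre v D.1)) s D.1 D.2.2.2,
    ssgn (cpos n m (pre v D.1)) s D.1 D.2.1 D.2.2.1 D.2.2.2)

/-- The step is needed. -/
def Active (n m : ℕ) (v : Fin d → ℕ) (s : ℕ) (D : Datum d) : Prop :=
  4 + 2 * d ≤ s → D.2.2.2 D.1 < cpos n m (pre v D.1) D.1 + spacing d n m - n

/-- The possible starting points of the tube leading to `v`. -/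
def IsStart (n m : ℕ) (v : Fin d → ℕ) (look : Job d → Out (Col d) d (Datum d)) (D : Datum d) : Prop :=
  0 < v D.1 ∧ D.2.2.1 = D.2.2.2 ∧
    ((pre v D.1 = 0 ∧ (D.2.1 : ℕ) = 0 ∧ D.2.2.1 = cpos n m 0) ∨
      ∃ x a' c', look (pre v D.1, nst d - 1) = some (x, some (D.2.1, a', c', D.2.2.1)))

open Classical in
/-- The datum before a step. -/
noncomputable def datum (n m : ℕ) (j : Job d) (look : Job d → Out (Col d) d (Datum d)) :
    Option (Datum d) :=
  if j.2 = 0 then if h : ∃ D, IsStart n m j.1 look D then some h.choose else none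
  else (look (j.1, j.2 - 1)).bind Prod.snd

open Classical in
/-- The steering rule. -/
noncomputable def ctrl (n m : ℕ) (j : Job d) (look : Job d → Out (Col d) d (Datum d)) :
    Option (Datum d × Option (Ins (Col d) d)) :=
  if nst d ≤ j.2 then none else
    (datum n m j look).map fun D => (D, if Active n m j.1 j.2 D then some (inst n m j.1 j.2 D) else none)

/-- The exploration scheme of tubes joining neighbourhoods of the coarse sites. -/
noncomputable def steer (d n m : ℕ) : Plan (Col d) (Job d) (Datum d) d where
  ctrl := ctrl n m
  upd D y := (D.1, D.2.1, D.2.2.1, y)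
  V0 := Finset.Icc 0 fun _ => 6 * n + m
  n := n
  m := m

/-- The invariants of a tube within a history. -/
structure Tube (n m : ℕ) (h : List (Job d × Out (Col d) d (Datum d))) (v : Fin d → ℕ) (s : ℕ)
    (D : Datum d) : Prop where
  pos : 0 < v D.1
  root : (pre v D.1 = 0 ∧ (D.2.1 : ℕ) = 0 ∧ D.2.2.1 = cpos n m 0) ∨
      ∃ x a' c', ((pre v D.1, nst d - 1), some (x, some (D.2.1, a', c', D.2.2.1))) ∈ h
  inv : TubeInv n m s D.1 D.2.1 D.2.2.1 (cpos n m (pre v D.1)) D.2.2.2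
  past : ∀ s' < s, ∀ I o, ((v, s'), some (some I, o)) ∈ h → ∃ q',
    TubeInv n m s' D.1 D.2.1 D.2.2.1 (cpos n m (pre v D.1)) q' ∧
    Active n m v s' (D.1, D.2.1, D.2.2.1, q') ∧ I = inst n m v s' (D.1, D.2.1, D.2.2.1, q') ∧
    ∀ x ∈ (steer d n m).izone I, x D.1 ≤ D.2.2.2 D.1 + n ∧
      (s < 4 ∨ s % 2 = 0 ∨ 4 + 2 * d ≤ s → Behind n m D.1 D.2.2.2 x)

variable {n m : ℕ}

lemma mem_izone_inst {v : Fin d → ℕ} {s : ℕ} {D : Datum d} {x : Zd d} :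
    x ∈ (steer d n m).izone (inst n m v s D) ↔ x ∈ bx D.2.2.2 n ∨
      x ∈ stepT n m (cpos n m (pre v D.1)) s D.1 D.2.1 D.2.2.1 D.2.2.2 := mem_zone

lemma Tube.mono {h : List (Job d × Out (Col d) d (Datum d))} {v : Fin d → ℕ} {s : ℕ} {D : Datum d}
    (hT : Tube n m h v s D) {j : Job d} {o : Out (Col d) d (Datum d)} (hj : ∀ s' < s, j ≠ (v, s')) :
    Tube n m ((j, o) :: h) v s D := by
  refine ⟨hT.pos, hT.root.imp_right ?_, hT.inv, fun s' hs' I o' hI => hT.past s' hs' I o' ?_⟩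
  · rintro ⟨x, a', c', hx⟩
    exact ⟨x, a', c', List.mem_cons_of_mem _ hx⟩
  · rcases List.mem_cons.1 hI with hI | hI
    · exact absurd (congrArg Prod.fst hI).symm (hj s' hs')
    · exact hI

lemma pre_self (v : Fin d → ℕ) (i : Fin d) : pre v i i = v i - 1 := by simp [pre]

lemma pre_ne (v : Fin d → ℕ) {i j : Fin d} (h : j ≠ i) : pre v i j = v j := by simp [pre, h]

lemma cpos_eq_pre {v : Fin d → ℕ} {i : Fin d} (hv : 0 < v i) (j : Fin d) :
    cpos n m v j = cpos n m (pre v i) j + if j = i then spacing d n m else 0 := by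
  unfold cpos pre
  split_ifs with h
  · subst h
    obtain ⟨k, hk⟩ : ∃ k, v j = k + 1 := ⟨v j - 1, by omega⟩
    rw [hk, Nat.add_sub_cancel]
    push_cast
    ring
  · simp

/-- The final point of a tube is close to the coarse site. -/
lemma Tube.arrive (hmn : m ≤ n) {h : List (Job d × Out (Col d) d (Datum d))} {v : Fin d → ℕ} {D : Datum d}
    (hT : Tube n m h v (nst d) D) :
    (∀ j, -(n : ℤ) ≤ D.2.2.2 j - cpos n m v j ∧ D.2.2.2 j - cpos n m v j ≤ n) ∧
      D.2.2.2 D.1 - cpos n m v D.1 ≤ m := by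
  have hh : stepLen n m = n + m + 1 := rfl
  have hd : 0 < d := D.1.pos
  have hI := hT.inv
  have key : ∀ j, -(n : ℤ) ≤ D.2.2.2 j - cpos n m v j ∧
      D.2.2.2 j - cpos n m v j ≤ if j = D.1 then m else n := by
    intro j
    rw [cpos_eq_pre hT.pos j]
    by_cases hj : j = D.1
    · subst hj
      have h1 := hI.final_up (by unfold nst; omega)
      have h2 := hI.final (by unfold nst; omega)
      have h3 := hI.start D.1
      have e : ((nst d : ℕ) - 4 - 2 * d : ℤ) * stepLen n m = spacing d n m := by
        unfold spacing nst
        push_cast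
        ring
      rw [e] at h2
      simp only [if_true]
      omega
    · have := hI.small j hj (by unfold nst; omega)
      simp only [hj, if_false]
      omega
  refine ⟨fun j => ⟨(key j).1, (key j).2.trans ?_⟩, ?_⟩
  · split_ifs
    · exact_mod_cast hmn
    · exact le_rfl
  · simpa using (key D.1).2

/-- The invariants of the exploration. -/
structure HistInv (n m : ℕ) (st : St (Col d) (Job d) (Datum d) d) : Prop where
  done : ∀ v s x D, ((v, s), some (x, some D)) ∈ st.2 →
    s < nst d ∧ Tube n m st.2 v (s + 1) D ∧ bx D.2.2.2 m ⊆ (st.1 : Set (Zd d))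
  ins : ∀ v s I o, ((v, s), some (some I, o)) ∈ st.2 →
    s < nst d ∧ ∃ D, Tube n m st.2 v s D ∧ Active n m v s D ∧ I = inst n m v s D
  cover : ∀ x ∈ st.1, x ∈ (steer d n m).V0 ∨ ∃ j I o, (j, some (some I, o)) ∈ st.2 ∧
    x ∈ (steer d n m).izone I

lemma mem_V0 {x : Zd d} : x ∈ (steer d n m).V0 ↔ ∀ j, 0 ≤ x j ∧ x j ≤ 6 * n + m := by
  simp only [steer, Finset.mem_Icc, Pi.le_def, Pi.zero_apply, forall_and]

/-- The tube of the next job. -/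
lemma HistInv.tube (hnm : 2 * m + 1 ≤ n) {st : St (Col d) (Job d) (Datum d) d} (h : HistInv n m st)
    (hV0 : (steer d n m).V0 ⊆ st.1) {v : Fin d → ℕ} {s : ℕ} {D : Datum d}
    {y : Option (Ins (Col d) d)} (hc : ctrl n m (v, s) (look st.2) = some (D, y)) :
    s < nst d ∧ Tube n m st.2 v s D ∧ bx D.2.2.2 m ⊆ (st.1 : Set (Zd d)) ∧
      (Active n m v s D ∧ y = some (inst n m v s D) ∨ ¬ Active n m v s D ∧ y = none) := by
  unfold ctrl at hc
  by_cases hs : nst d ≤ s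
  · simp [hs] at hc
  simp only [hs, if_false, Option.map_eq_some_iff, Prod.mk.injEq] at hc
  obtain ⟨D', hD, rfl, hy⟩ := hc
  have hy' : Active n m v s D' ∧ y = some (inst n m v s D') ∨ ¬ Active n m v s D' ∧ y = none := by
    split_ifs at hy with hA
    · exact Or.inl ⟨hA, hy.symm⟩
    · exact Or.inr ⟨hA, hy.symm⟩
  have main : Tube n m st.2 v s D' ∧ bx D'.2.2.2 m ⊆ (st.1 : Set (Zd d)) := by
    unfold datum at hD
    by_cases hs0 : s = 0
    · subst hs0
      simp only [if_true] at hD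
      split_ifs at hD with hex
      obtain ⟨h1, h2, h3⟩ := hex.choose_spec
      rw [Option.some.inj hD] at h1 h2 h3
      rcases h3 with h3 | ⟨x, a', c', h3⟩
      · obtain ⟨h4, h5, h6⟩ := h3
        refine ⟨⟨h1, Or.inl ⟨h4, h5, h6⟩, ?_, fun s' hs' => absurd hs' (by omega)⟩, ?_⟩
        · rw [← h2, h6, h4]
          exact TubeInv.of_center (by simp) (by simp) (by omega)
        · rw [← h2, h6]
          intro x hx
          refine hV0 (mem_V0.2 fun j => ?_)
          have := abs_le.1 (hx j)
          simp only [cpos, Pi.zero_apply, Nat.cast_zero, mul_zero, add_zero] at this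
          omega
      · have hm := mem_of_look h3
        obtain ⟨_, hT, hb⟩ := h.done _ _ _ _ hm
        rw [show nst d - 1 + 1 = nst d by unfold nst; omega] at hT
        refine ⟨⟨h1, Or.inr ⟨x, a', c', hm⟩, ?_, fun s' hs' => absurd hs' (by omega)⟩, ?_⟩
        · rw [← h2]
          obtain ⟨k1, k2⟩ := hT.arrive (by omega)
          exact TubeInv.of_center k1 k2 (by omega)
        · rw [← h2]
          exact hb
    · simp only [hs0, if_false, Option.bind_eq_some_iff, Prod.exists] at hD
      obtain ⟨x, o, h1, h2⟩ := hD
      change o = some D' at h2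
      rw [h2] at h1
      obtain ⟨_, hT, hb⟩ := h.done _ _ _ _ (mem_of_look h1)
      rw [show s - 1 + 1 = s by omega] at hT
      exact ⟨hT, hb⟩
  exact ⟨not_le.1 hs, main.1, main.2, hy'⟩

end Scheme

section Scheme

variable {d n m : ℕ}

lemma Tube.pass {h : List (Job d × Out (Col d) d (Datum d))} {v : Fin d → ℕ} {s : ℕ} {D : Datum d}
    (hT : Tube n m h v s D) (hA : ¬ Active n m v s D)
    (hs : ∀ I o, ((v, s), some (some I, o)) ∉ h) : Tube n m h v (s + 1) D := by
  obtain ⟨h1, h2⟩ := Classical.not_imp.1 hA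
  refine ⟨hT.pos, hT.root, hT.inv.pass h1 (not_lt.1 h2), fun s' hs' I o hI => ?_⟩
  have hss : s' < s := lt_of_le_of_ne (by omega) fun hss => hs I o (hss ▸ hI)
  obtain ⟨q', k1, k2, k3, k4⟩ := hT.past s' hss I o hI
  exact ⟨q', k1, k2, k3, fun x hx => ⟨(k4 x hx).1, fun _ => (k4 x hx).2 (by omega)⟩⟩

lemma Tube.next (hnm : 2 * m + 1 ≤ n) {h : List (Job d × Out (Col d) d (Datum d))} {v : Fin d → ℕ}
    {s : ℕ} {D : Datum d} (hT : Tube n m h v s D) (hA : Active n m v s D) {y : Zd d}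
    (hy : bx y m ⊆ stepT n m (cpos n m (pre v D.1)) s D.1 D.2.1 D.2.2.1 D.2.2.2)
    (hs : ∀ I o, ((v, s), some (some I, o)) ∈ h → I = inst n m v s D) :
    Tube n m h v (s + 1) (D.1, D.2.1, D.2.2.1, y) := by
  have hD := disp_of_subset hy
  refine ⟨hT.pos, hT.root, hT.inv.next hnm hA hD, fun s' hs' I o hI => ?_⟩
  have hself : s + 1 < 4 ∨ (s + 1) % 2 = 0 ∨ 4 + 2 * d ≤ s + 1 →
      sdir n (cpos n m (pre v D.1)) s D.1 D.2.2.2 = D.1 :=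
    fun hc => sdir_eq_self _ _ _ _ (by omega)
  by_cases hss : s' = s
  · subst hss
    refine ⟨D.2.2.2, hT.inv, hA, hs I o hI, fun x hx => ?_⟩
    rw [hs I o hI, mem_izone_inst] at hx
    have := zone_le hnm hD (x := x) (hx.imp_left fun hx => by have := abs_le.1 (hx D.1); omega)
    exact ⟨this.1, fun hc => this.2 (hself hc)⟩
  · obtain ⟨q', k1, k2, k3, k4⟩ := hT.past s' (by omega) I o hI
    refine ⟨q', k1, k2, k3, fun x hx => ?_⟩
    have := zone_le hnm hD (x := x) (Or.inl (k4 x hx).1)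
    exact ⟨this.1, fun hc => this.2 (hself hc)⟩

lemma jkey_le_iff {v : Fin d → ℕ} {s s' : ℕ} : jkey (v, s) ≤ jkey (v, s') ↔ s ≤ s' := by
  simp [jkey]

lemma histInv_run (hnm : 2 * m + 1 ≤ n) (l : List (Job d)) (ω : Option (Col d) × Sym2 (Zd d) → Bool)
    (hl : Ordered jkey l) : HistInv n m ((steer d n m).run l ω) := by
  induction l with
  | nil =>
    refine ⟨fun v s x D h => ?_, fun v s I o h => ?_, fun x hx => Or.inl hx⟩ <;>
      simp [Plan.run] at h
  | cons j l ih =>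
    obtain ⟨v, s⟩ := j
    replace ih := ih hl.tail
    have hord := (List.pairwise_cons.1 hl).1
    have hfst := (steer d n m).map_fst_run l ω
    have hV0 := (steer d n m).V0_subset l ω
    change HistInv n m ((steer d n m).adv (v, s) ((steer d n m).run l ω) ω)
    set st := (steer d n m).run l ω
    have hold : ∀ j' o', (j', o') ∈ st.2 → jkey j' ≤ jkey (v, s) ∧ (v, s) ≠ j' := fun j' o' h =>
      hord j' (hfst ▸ List.mem_map.2 ⟨(j', o'), h, rfl⟩)
    have hnot : ∀ o', ((v, s), o') ∉ st.2 := fun o' h => (hold _ _ h).2 rfl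
    have hne : ∀ v' s' o', ((v', s'), o') ∈ st.2 → ∀ s'' ≤ s', (v, s) ≠ (v', s'') := by
      intro v' s' o' h s'' hs'' he
      obtain ⟨rfl, rfl⟩ := Prod.mk.inj he
      obtain ⟨h1, h2⟩ := hold _ _ h
      rw [jkey_le_iff] at h1
      exact h2 (by rw [le_antisymm h1 hs''])
    have hdone : ∀ (V' : Finset (Zd d)) (o : Out (Col d) d (Datum d)), st.1 ⊆ V' → ∀ v' s' x D,
        ((v', s'), some (x, some D)) ∈ st.2 → s' < nst d ∧ Tube n m (((v, s), o) :: st.2) v' (s' + 1) D ∧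
          bx D.2.2.2 m ⊆ (V' : Set (Zd d)) := by
      intro V' o hV v' s' x D h
      obtain ⟨h1, h2, h3⟩ := ih.done _ _ _ _ h
      exact ⟨h1, h2.mono fun s'' hs'' => hne _ _ _ h s'' (by omega), h3.trans (by exact_mod_cast hV)⟩
    have hins : ∀ (o : Out (Col d) d (Datum d)), ∀ v' s' I o', ((v', s'), some (some I, o')) ∈ st.2 →
        s' < nst d ∧ ∃ D, Tube n m (((v, s), o) :: st.2) v' s' D ∧ Active n m v' s' D ∧
          I = inst n m v' s' D := by
      intro o v' s' I o' h
      obtain ⟨h1, D, h2, h3⟩ := ih.ins _ _ _ _ h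
      exact ⟨h1, D, h2.mono fun s'' hs'' => hne _ _ _ h s'' (by omega), h3⟩
    have hcov : ∀ (o : Out (Col d) d (Datum d)), ∀ x ∈ st.1, x ∈ (steer d n m).V0 ∨
        ∃ j I o', (j, some (some I, o')) ∈ (((v, s), o) :: st.2) ∧ x ∈ (steer d n m).izone I := by
      intro o x hx
      refine (ih.cover x hx).imp_right ?_
      rintro ⟨j, I, o', h1, h2⟩
      exact ⟨j, I, o', List.mem_cons_of_mem _ h1, h2⟩
    rcases (steer d n m).adv_cases (v, s) st ω with ⟨_, h⟩ | ⟨D, hc, h⟩ | ⟨D, I, hc, h⟩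
    · rw [h]
      refine ⟨fun v' s' x D hm => ?_, fun v' s' I o hm => ?_, hcov _⟩
      · rcases List.mem_cons.1 hm with hm | hm
        · simp at hm
        · exact hdone _ _ subset_rfl _ _ _ _ hm
      · rcases List.mem_cons.1 hm with hm | hm
        · simp at hm
        · exact hins _ _ _ _ _ hm
    · obtain ⟨h1, h2, h3, h4⟩ := ih.tube hnm hV0 hc
      have hA : ¬ Active n m v s D := by
        rcases h4 with h4 | h4
        · exact absurd h4.2 (by simp)
        · exact h4.1
      rw [h]
      refine ⟨fun v' s' x D' hm => ?_, fun v' s' I o hm => ?_, hcov _⟩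
      · rcases List.mem_cons.1 hm with hm | hm
        · simp only [Prod.mk.injEq, Option.some.injEq] at hm
          obtain ⟨⟨rfl, rfl⟩, rfl, rfl⟩ := hm
          refine ⟨h1, (h2.mono fun s'' hs'' he => ?_).pass hA fun I o hI => ?_, h3⟩
          · have := (Prod.mk.inj he).2
            omega
          · rcases List.mem_cons.1 hI with hI | hI
            · simp at hI
            · exact hnot _ hI
        · exact hdone _ _ subset_rfl _ _ _ _ hm
      · rcases List.mem_cons.1 hm with hm | hm
        · simp at hm
        · exact hins _ _ _ _ _ hm
    · obtain ⟨h1, h2, h3, h4⟩ := ih.tube hnm hV0 hc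
      obtain ⟨hA, hI⟩ : Active n m v s D ∧ I = inst n m v s D := by
        rcases h4 with h4 | h4
        · exact ⟨h4.1, Option.some.inj h4.2⟩
        · exact absurd h4.2 (by simp)
      rw [h]
      refine ⟨fun v' s' x D' hm => ?_, fun v' s' I' o hm => ?_, fun x hx => ?_⟩
      · rcases List.mem_cons.1 hm with hm | hm
        · simp only [Prod.mk.injEq, Option.some.injEq] at hm
          obtain ⟨⟨rfl, rfl⟩, rfl, hD'⟩ := hm
          obtain ⟨y, hy1, hy2, rfl⟩ := Plan.result_eq_some _ hD'.symm
          refine ⟨h1, (h2.mono fun s'' hs'' he => ?_).next hnm hA (y := y) ?_ fun I' o hI' => ?_, ?_⟩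
          · have := (Prod.mk.inj he).2
            omega
          · rw [hI] at hy1
            exact hy1
          · rcases List.mem_cons.1 hI' with hI' | hI'
            · simp only [Prod.mk.injEq, Option.some.injEq] at hI'
              exact hI'.2.1.trans hI
            · exact absurd hI' (hnot _)
          · rw [Finset.coe_union]
            exact hy2.trans Set.subset_union_right
        · exact hdone _ _ Finset.subset_union_left _ _ _ _ hm
      · rcases List.mem_cons.1 hm with hm | hm
        · simp only [Prod.mk.injEq, Option.some.injEq] at hm
          obtain ⟨⟨rfl, rfl⟩, rfl, _⟩ := hm
          refine ⟨h1, D, h2.mono fun s'' hs'' he => ?_, hA, hI⟩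
          have := (Prod.mk.inj he).2
          omega
        · exact hins _ _ _ _ _ hm
      · rcases Finset.mem_union.1 hx with hx | hx
        · exact hcov _ x hx
        · obtain ⟨u, _, v', _, _, _, _, hconn⟩ := mem_grow.1 hx
          exact Or.inr ⟨_, I, _, List.mem_cons_self, hconn.mem.1⟩

/-- Coarse sites with neighbouring tubes. -/
lemma near_cases {u u' : Fin d → ℕ} {i i' : Fin d} {x y : Zd d}
    (hx : Near n m i (cpos n m u) x) (hy : Near n m i' (cpos n m u') y)
    (hxy : ∀ j, |x j - y j| ≤ 1) (j : Fin d) :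
    (u' j ≤ u j + if j = i then 1 else 0) ∧ u j ≤ u' j + if j = i' then 1 else 0 := by
  have h1 := hx j
  have h2 := hy j
  have h3 := abs_le.1 (hxy j)
  have hL : spacing d n m = (2 * d + 40) * stepLen n m := rfl
  have hL' : 40 * stepLen n m ≤ spacing d n m := by
    rw [hL]
    gcongr
    · unfold stepLen; omega
    · omega
  have hh : stepLen n m = n + m + 1 := rfl
  unfold cpos at h1 h2
  constructor
  · by_contra hcon
    have : (u j : ℤ) + (if j = i then 1 else 0) + 1 ≤ u' j := by
      split_ifs at hcon ⊢ <;> omega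
    have := mul_le_mul_of_nonneg_left this (show 0 ≤ spacing d n m by omega)
    split_ifs at * <;> nlinarith
  · by_contra hcon
    have : (u' j : ℤ) + (if j = i' then 1 else 0) + 1 ≤ u j := by
      split_ifs at hcon ⊢ <;> omega
    have := mul_le_mul_of_nonneg_left this (show 0 ≤ spacing d n m by omega)
    split_ifs at * <;> nlinarith

end Scheme

section Scheme

variable {d n m : ℕ}

lemma height_pre {v : Fin d → ℕ} {i : Fin d} (hv : 0 < v i) :
    height v = height (pre v i) + (i + 1) := by
  unfold height
  rw [← Finset.add_sum_erase _ _ (Finset.mem_univ i),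
    ← Finset.add_sum_erase (a := i) _ (fun j : Fin d => ((j : ℕ) + 1) * pre v i j) (Finset.mem_univ i),
    Finset.sum_congr rfl fun j hj => by rw [← pre_ne v (Finset.ne_of_mem_erase hj)]]
  simp only [pre_self]
  obtain ⟨k, hk⟩ : ∃ k, v i = k + 1 := ⟨v i - 1, by omega⟩
  rw [hk, Nat.add_sub_cancel]
  ring

lemma tube_cases {v v' : Fin d → ℕ} {i i' : Fin d} (hv : 0 < v i) (hv' : 0 < v' i') {x y : Zd d}
    (hx : Near n m i (cpos n m (pre v i)) x) (hy : Near n m i' (cpos n m (pre v' i')) y)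
    (hxy : ∀ j, |x j - y j| ≤ 1) :
    (pre v i = pre v' i' ∧ i ≠ i') ∨ pre v' i' = v ∨ v' = pre v i ∨ v = v' := by
  have h := near_cases hx hy hxy
  by_cases hi : i = i'
  · subst hi
    have hne : ∀ j, j ≠ i → v j = v' j := by
      intro j hj
      have := h j
      simp only [hj, if_false, pre_ne v hj, pre_ne v' hj] at this
      omega
    have h0 := h i
    simp only [if_true, pre_self] at h0
    rcases lt_trichotomy (v i) (v' i) with hlt | heq | hgt
    · right; left
      funext j
      by_cases hj : j = i
      · subst hj; rw [pre_self]; omega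
      · rw [pre_ne v' hj, hne j hj]
    · right; right; right
      funext j
      by_cases hj : j = i
      · rw [hj, heq]
      · exact hne j hj
    · right; right; left
      funext j
      by_cases hj : j = i
      · subst hj; rw [pre_self]; omega
      · rw [pre_ne v hj, hne j hj]
  · have hne : ∀ j, j ≠ i → j ≠ i' → v j = v' j := by
      intro j hj hj'
      have := h j
      simp only [hj, hj', if_false, pre_ne v hj, pre_ne v' hj'] at this
      omega
    have h0 := h i
    have h1 := h i'
    have hi' : i' ≠ i := Ne.symm hi
    simp only [if_true, if_false, hi, hi', pre_self, pre_ne v hi', pre_ne v' hi] at h0 h1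
    have hgoal : ∀ {p q : Fin d → ℕ}, p i = q i → p i' = q i' → (∀ j, j ≠ i → j ≠ i' → p j = q j) →
        p = q := by
      intro p q k1 k2 k3
      funext j
      by_cases hj : j = i
      · rw [hj, k1]
      · by_cases hj' : j = i'
        · rw [hj', k2]
        · exact k3 j hj hj'
    by_cases k1 : v' i = v i - 1 <;> by_cases k2 : v i' = v' i' - 1
    · left
      refine ⟨hgoal ?_ ?_ fun j hj hj' => ?_, hi⟩
      · rw [pre_self, pre_ne v' hi, k1]
      · rw [pre_self, pre_ne v hi', k2]
      · rw [pre_ne v hj, pre_ne v' hj', hne j hj hj']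
    · right; right; left
      refine hgoal ?_ ?_ fun j hj hj' => ?_
      · rw [pre_self, k1]
      · rw [pre_ne v hi']; omega
      · rw [pre_ne v hj, hne j hj hj']
    · right; left
      refine hgoal ?_ ?_ fun j hj hj' => ?_
      · rw [pre_ne v' hi]; omega
      · rw [pre_self, k2]
      · rw [pre_ne v' hj', hne j hj hj']
    · right; right; right
      exact hgoal (by omega) (by omega) hne

lemma jkey_lt_of_height_lt {v v' : Fin d → ℕ} (h : height v' < height v) {s s' : ℕ}
    (hs' : s' < nst d) : jkey (v', s') < jkey (v, s) := by
  unfold jkey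
  have : (height v' + 1) * nst d ≤ height v * nst d := Nat.mul_le_mul_right _ h
  simp only
  nlinarith

/-- Position of an earlier tube whose region is near the region of a later one. -/
lemma earlier_cases {v v' : Fin d → ℕ} {i i' : Fin d} (hv : 0 < v i) (hv' : 0 < v' i')
    {s s' : ℕ} (hs : s < nst d) (hs' : s' < nst d) (hk : jkey (v', s') ≤ jkey (v, s))
    (hne : (v, s) ≠ (v', s')) {x y : Zd d}
    (hx : Near n m i (cpos n m (pre v i)) x) (hy : Near n m i' (cpos n m (pre v' i')) y)
    (hxy : ∀ j, |x j - y j| ≤ 1) :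
    jkey (v', s') < jkey (v, s) ∧
      ((pre v i = pre v' i' ∧ i ≠ i') ∨ v' = pre v i ∨ (v = v' ∧ s' < s)) := by
  have h1 := height_pre hv
  have h2 := height_pre hv'
  rcases tube_cases hv hv' hx hy hxy with ⟨h, hi⟩ | h | h | h
  · rw [h] at h1
    have hi' : (i : ℕ) ≠ i' := fun h => hi (Fin.ext h)
    have : height v' < height v := by
      by_contra hcon
      have := jkey_lt_of_height_lt (v := v') (v' := v) (by omega) hs (s := s')
      omega
    exact ⟨jkey_lt_of_height_lt this hs', Or.inl ⟨h, hi⟩⟩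
  · rw [h] at h2
    have := jkey_lt_of_height_lt (v := v') (v' := v) (by omega) hs (s := s')
    omega
  · rw [← h] at h1
    exact ⟨jkey_lt_of_height_lt (by omega) hs', Or.inr (Or.inl h)⟩
  · subst h
    rw [jkey_le_iff] at hk
    have hlt : s' < s := lt_of_le_of_ne hk fun h => hne (by rw [h])
    exact ⟨by unfold jkey; simp only; omega, Or.inr (Or.inr ⟨rfl, hlt⟩)⟩

lemma not_mem_V0_of_near {v : Fin d → ℕ} {i : Fin d} (h0 : pre v i ≠ 0) {x : Zd d}
    (hx : Near n m i (cpos n m (pre v i)) x) : x ∉ (steer d n m).V0 := by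
  intro hV
  obtain ⟨j, hj⟩ := Function.ne_iff.1 h0
  have h1 := (hx j).1
  have h2 := mem_V0.1 hV j
  have hj' : (1 : ℤ) ≤ pre v i j := by
    have : pre v i j ≠ 0 := hj
    omega
  have hL : 40 * stepLen n m ≤ spacing d n m := by
    unfold spacing
    gcongr
    · unfold stepLen; omega
    · omega
  have hh : stepLen n m = n + m + 1 := rfl
  have := mul_le_mul_of_nonneg_left hj' (show 0 ≤ spacing d n m by omega)
  unfold cpos at h1
  omega

/-- The steering scheme is valid. -/
lemma valid_steer (hnm : 2 * m + 1 ≤ n) : (steer d n m).Valid jkey {x | ∀ j, 0 ≤ x j} := by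
  rintro ⟨v, s⟩ l ω D I hl hc
  have H := histInv_run hnm l ω hl.tail
  have hord := (List.pairwise_cons.1 hl).1
  have hfst := (steer d n m).map_fst_run l ω
  have hnd : (((steer d n m).run l ω).2.map Prod.fst).Nodup := by
    rw [hfst]
    exact hl.tail.nodup
  have hV0 := (steer d n m).V0_subset l ω
  set st := (steer d n m).run l ω
  obtain ⟨hs, hT, hb, hA'⟩ := H.tube hnm hV0 hc
  obtain ⟨hA, rfl⟩ : Active n m v s D ∧ I = inst n m v s D := by
    rcases hA' with h4 | h4
    · exact ⟨h4.1, Option.some.inj h4.2⟩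
    · exact absurd h4.2 (by simp)
  have hold : ∀ j' o', (j', o') ∈ st.2 → jkey j' ≤ jkey (v, s) ∧ (v, s) ≠ j' := fun j' o' h =>
    hord j' (hfst ▸ List.mem_map.2 ⟨(j', o'), h, rfl⟩)
  have hnear : ∀ x ∈ (steer d n m).izone (inst n m v s D), Near n m D.1 (cpos n m (pre v D.1)) x :=
    fun x hx => hT.inv.near_zone hnm hA (mem_izone_inst.1 hx)
  have hcases : ∀ j' I' o, (j', some (some I', o)) ∈ st.2 → ∀ x ∈ (steer d n m).izone I',
      ∀ y ∈ (steer d n m).izone (inst n m v s D), (∀ j, |y j - x j| ≤ 1) →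
      ∃ D', Tube n m st.2 j'.1 j'.2 D' ∧ Active n m j'.1 j'.2 D' ∧ I' = inst n m j'.1 j'.2 D' ∧
        jkey j' < jkey (v, s) ∧ ((pre v D.1 = pre j'.1 D'.1 ∧ D.1 ≠ D'.1) ∨ j'.1 = pre v D.1 ∨
          (v = j'.1 ∧ j'.2 < s)) := by
    rintro ⟨v', s'⟩ I' o hI x hx y hy hxy
    obtain ⟨hs', D', hT', hA', rfl⟩ := H.ins _ _ _ _ hI
    obtain ⟨k1, k2⟩ := hold _ _ hI
    have := earlier_cases hT.pos hT'.pos hs hs' k1 k2 (hnear y hy)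
      (hT'.inv.near_zone hnm hA' (mem_izone_inst.1 hx)) hxy
    exact ⟨D', hT', hA', rfl, this⟩
  refine ⟨hb, ?_, ?_, ?_, ?_⟩
  · rw [Set.disjoint_left]
    intro x hxV hxT
    change x ∈ stepT n m (cpos n m (pre v D.1)) s D.1 D.2.1 D.2.2.1 D.2.2.2 at hxT
    have hxz : x ∈ (steer d n m).izone (inst n m v s D) := mem_izone_inst.2 (Or.inr hxT)
    rcases H.cover x hxV with hx0 | ⟨j', I', o, hI, hx'⟩
    · by_cases hu : pre v D.1 = 0
      · have hcc : D.2.2.1 = cpos n m 0 := by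
          rcases hT.root with h | ⟨y, a', c', h⟩
          · exact h.2.2
          · have := (H.done _ _ _ _ h).2.1.pos
            rw [hu] at this
            simp at this
        have h1 := hT.inv.le_of_mem_stepT hnm hxT
        have h2 := mem_V0.1 hx0 D.1
        rw [hcc] at h1
        simp only [cpos, Pi.zero_apply, Nat.cast_zero, mul_zero, add_zero] at h1
        omega
      · exact not_mem_V0_of_near hu (hnear x hxz) hx0
    · obtain ⟨D', hT', hA', hII, _, hcase⟩ := hcases j' I' o hI x hx' x hxz (by simp)
      rcases hcase with ⟨hu, hi⟩ | hu | ⟨hvv, hss⟩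
      · have hca : D'.2.1 = D.2.1 ∧ D'.2.2.1 = D.2.2.1 := by
          rcases hT.root with ⟨r1, r2, r3⟩ | ⟨y, a', c', r⟩ <;>
            rcases hT'.root with ⟨r1', r2', r3'⟩ | ⟨y', a'', c'', r'⟩
          · exact ⟨Fin.ext (by rw [r2, r2']), by rw [r3, r3']⟩
          · have := (H.done _ _ _ _ r').2.1.pos
            rw [← hu, r1] at this
            simp at this
          · have := (H.done _ _ _ _ r).2.1.pos
            rw [hu, r1'] at this
            simp at this
          · rw [← hu] at r'
            have e1 := look_of_mem hnd r
            rw [look_of_mem hnd r'] at e1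
            simp only [Option.some.injEq, Prod.mk.injEq] at e1
            exact ⟨e1.2.1, e1.2.2.2.2⟩
        rw [hII, mem_izone_inst, ← hu, hca.1, hca.2] at hx'
        have hT'' := hT'.inv
        rw [← hu, hca.1, hca.2] at hT''
        exact hT.inv.not_mem_stepT_sibling hnm hT'' hi hx' hxT
      · have hu0 : pre v D.1 ≠ 0 := by
          intro h0
          have := hT'.pos
          rw [hu, h0] at this
          simp at this
        obtain ⟨y, a', c', hr⟩ := hT.root.resolve_left fun h => hu0 h.1
        have hTu := (H.done _ _ _ _ hr).2.1
        rw [show nst d - 1 + 1 = nst d by unfold nst; omega] at hTu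
        obtain ⟨v', s'⟩ := j'
        simp only at hu
        subst hu
        obtain ⟨q', k1, k2, k3, k4⟩ := hTu.past s' (H.ins _ _ _ _ hI).1 I' o hI
        have hb := (k4 x hx').2 (Or.inr (Or.inr (by unfold nst; omega)))
        rw [k3, mem_izone_inst] at hx'
        exact hT.inv.not_mem_stepT_parent hnm hA k1 (cpos_eq_pre hTu.pos) hx' hb hxT
      · obtain ⟨v', s'⟩ := j'
        simp only at hvv hss
        subst hvv
        obtain ⟨q', k1, k2, k3, k4⟩ := hT.past s' hss I' o hI
        refine not_mem_stepT_of_behind (k4 x hx').1 (fun hsd => (k4 x hx').2 ?_) hxT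
        rcases sdir_cases n (cpos n m (pre v D.1)) s D.1 D.2.2.2 with h | h
        · exact absurd h hsd
        · omega
  · intro I' hI' hcol
    obtain ⟨⟨v', s'⟩, o, hI⟩ := mem_insOf.1 hI'
    rw [Finset.disjoint_left]
    intro x hx hx'
    obtain ⟨D', hT', hA', rfl, _, hcase⟩ := hcases _ I' o hI x hx x hx' (by simp)
    have hs' := (H.ins _ _ _ _ hI).1
    simp only at hcase hT' hcol
    simp only [inst, Prod.mk.injEq, Fin.mk.injEq, Nat.mod_eq_of_lt hs, Nat.mod_eq_of_lt hs',
      funext_iff] at hcol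
    obtain ⟨c1, c2, c3⟩ := hcol
    rcases hcase with ⟨_, hi⟩ | hu | ⟨_, hss⟩
    · exact hi c2.symm
    · have h1 := c1 D'.1
      have h2 := hT'.pos
      rw [pre_self, ← hu] at h1
      omega
    · omega
  · intro x hx j
    have h1 := (hnear x hx j).1
    have : 0 ≤ spacing d n m * (pre v D.1 j : ℤ) := by unfold spacing stepLen; positivity
    unfold cpos at h1
    omega
  · intro j' I' o hI x hx y hy hxy
    obtain ⟨_, _, _, _, h, _⟩ := hcases j' I' o hI x hx y hy fun j => by
      rcases hxy with hxy | rfl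
      · rw [abs_sub_comm]
        exact_mod_cast hxy.abs_sub_le j
      · simp
    exact h

end Scheme

/-- The `i`-th unit vector of the lattice. -/
abbrev unit {d : ℕ} (i : Fin d) : Zd d := Pi.single i 1

lemma lattice_induction {d : ℕ} {P : Zd d → Prop} (h0 : P 0)
    (hi : ∀ x i, P x ↔ P (x + unit i)) (x : Zd d) : P x := by
  have step1 : ∀ (i : Fin d) (y : Zd d) (n : ℤ), P y → P (y + Pi.single i n) := by
    intro i y n hy
    induction n using Int.induction_on with
    | zero => simpa using hy
    | succ k hk =>
      have := (hi _ i).1 hk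
      rwa [add_assoc, ← Pi.single_add] at this
    | pred k hk =>
      rw [hi _ i, add_assoc, ← Pi.single_add]
      simpa using hk
  have : ∀ s : Finset (Fin d), P (∑ i ∈ s, Pi.single i (x i)) := by
    intro s
    induction s using Finset.induction_on with
    | empty => simpa using h0
    | insert i s his ih =>
      rw [Finset.sum_insert his, add_comm]
      exact step1 i _ _ ih
  have h := this Finset.univ
  rwa [Finset.univ_sum_single] at h

/-- A one-cochain on the lattice with values in `ZMod 2` which is closed on plaquettes is exact. -/
lemma exists_potential {d : ℕ} (φ : Zd d → Fin d → ZMod 2)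
    (hφ : ∀ x i j, φ x i + φ (x + unit i) j = φ x j + φ (x + unit j) i) :
    ∃ f : Zd d → ZMod 2, ∀ x i, f (x + unit i) = f x + φ x i := by
  let σ : Fin d → Equiv.Perm (ZMod 2 × Zd d) := fun i =>
    { toFun := fun w => (w.1 + φ w.2 i, w.2 + unit i)
      invFun := fun w => (w.1 - φ (w.2 - unit i) i, w.2 - unit i)
      left_inv := fun w => by ext <;> simp
      right_inv := fun w => by ext <;> simp }
  have hσ : ∀ i w, σ i w = (w.1 + φ w.2 i, w.2 + unit i) := fun i w => rfl
  have hc : ∀ i j, Commute (σ i) (σ j) := by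
    intro i j
    refine Equiv.ext fun w => ?_
    simp only [Equiv.Perm.mul_apply, hσ]
    refine Prod.ext ?_ (add_right_comm _ _ _)
    have := hφ w.2 i j
    simp only [add_assoc, this]
  let F : (∀ _ : Fin d, Multiplicative ℤ) →* Equiv.Perm (ZMod 2 × Zd d) :=
    MonoidHom.noncommPiCoprod (fun i => zpowersHom _ (σ i)) (by
      intro i j _ a b
      exact (hc i j).zpow_zpow _ _)
  let h : Zd d → ZMod 2 × Zd d := fun x => F (fun i => Multiplicative.ofAdd (x i)) (0, 0)
  have hstep : ∀ x i, h (x + unit i) = σ i (h x) := by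
    intro x i
    have h1 : (fun j => Multiplicative.ofAdd ((x + unit i) j))
        = Pi.mulSingle i (Multiplicative.ofAdd (1 : ℤ)) *
          (fun j => Multiplicative.ofAdd (x j) : ∀ _ : Fin d, Multiplicative ℤ) := by
      funext j
      by_cases hj : j = i
      · subst hj; simp [ofAdd_add, mul_comm]
      · simp [hj]
    have h2 : F (Pi.mulSingle i (Multiplicative.ofAdd (1 : ℤ))) = σ i := by
      refine (MonoidHom.noncommPiCoprod_mulSingle _ i _).trans ?_
      simp
    change F _ _ = _
    rw [h1, map_mul, h2]
    rfl
  have hpos : ∀ x, (h x).2 = x := by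
    refine lattice_induction ?_ ?_
    · have : F (fun i : Fin d => Multiplicative.ofAdd ((0 : Zd d) i)) = 1 := map_one F
      simp only [h, this]; rfl
    · intro x i
      rw [hstep, hσ]
      exact (add_left_inj _).symm
  exact ⟨fun x => (h x).1, fun x i => by
    change (h _).1 = _
    rw [hstep, hσ, hpos]⟩

/-- Adjacency for the sup norm. -/
def starAdj {d : ℕ} (x y : Zd d) : Prop := ∀ i, |x i - y i| ≤ 1

lemma starAdj.symm {d : ℕ} {x y : Zd d} (h : starAdj x y) : starAdj y x := fun i => by
  rw [abs_sub_comm]; exact h i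

lemma starAdj_refl {d : ℕ} (x : Zd d) : starAdj x x := fun i => by simp

lemma starAdj_add_unit {d : ℕ} (x : Zd d) (i : Fin d) : starAdj x (x + unit i) := fun j => by
  by_cases h : j = i
  · subst h; simp
  · simp [h]

lemma starAdj_units {d : ℕ} (x : Zd d) (i j : Fin d) : starAdj (x + unit i) (x + unit j) :=
  fun k => by
  by_cases h : k = i <;> by_cases h' : k = j
  · subst h; subst h'; simp
  · subst h; simp [h']
  · subst h'; simp [h]
  · simp [h, h']

/-- Joined by a sup-norm path inside `S`. -/
def starConn {d : ℕ} (S : Set (Zd d)) (x y : Zd d) : Prop :=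
  Relation.ReflTransGen (fun a b => starAdj a b ∧ a ∈ S ∧ b ∈ S) x y

lemma starConn.symm {d : ℕ} {S : Set (Zd d)} {x y : Zd d} (h : starConn S x y) :
    starConn S y x := by
  induction h with
  | refl => exact .refl
  | tail _ hbc ih => exact .head ⟨hbc.1.symm, hbc.2.2, hbc.2.1⟩ ih

lemma starConn.mono {d : ℕ} {S T : Set (Zd d)} (hST : S ⊆ T) {x y : Zd d}
    (h : starConn S x y) : starConn T x y :=
  h.lift id fun _ _ h => ⟨h.1, hST h.2.1, hST h.2.2⟩

/-- A set on which every locally constant `ZMod 2`-valued function is constant. -/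
def LocConst {d : ℕ} (S : Set (Zd d)) : Prop :=
  ∀ f : Zd d → ZMod 2, (∀ x i, x ∈ S → x + unit i ∈ S → f x = f (x + unit i)) →
    ∀ x ∈ S, ∀ y ∈ S, f x = f y

/-- The edge from `x` to `x + e_i` has exactly one endpoint in `U`. -/
def isCut {d : ℕ} (U : Set (Zd d)) (x : Zd d) (i : Fin d) : Prop :=
  ¬(x ∈ U ↔ x + unit i ∈ U)

/-- The lower endpoints of the edges of the edge boundary of `U`. -/
def cutBase {d : ℕ} (U : Set (Zd d)) : Set (Zd d) := {x | ∃ i, isCut U x i}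

open Classical in
lemma cutBase_starConn {d : ℕ} {U : Set (Zd d)} (hU : LocConst U) (hU' : LocConst Uᶜ)
    {x0 y0 : Zd d} (hx0 : x0 ∈ cutBase U) (hy0 : y0 ∈ cutBase U) :
    starConn (cutBase U) x0 y0 := by
  let u : Zd d → ZMod 2 := fun x => if x ∈ U then 1 else 0
  let g : Zd d → Fin d → ZMod 2 := fun x i => u x + u (x + unit i)
  have two : (1 : ZMod 2) + 1 = 0 := by decide
  have hg : ∀ x i, g x i = if isCut U x i then 1 else 0 := by
    intro x i
    by_cases h1 : x ∈ U <;> by_cases h2 : x + unit i ∈ U <;> simp [g, u, isCut, h1, h2, two]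
  let C : Set (Zd d) := {y | starConn (cutBase U) x0 y}
  let φ : Zd d → Fin d → ZMod 2 := fun x i => if x ∈ C then g x i else 0
  have hC : ∀ x y i j, starAdj x y → g x i ≠ 0 → x ∈ C → φ y j = g y j := by
    intro x y i j hxy hgx hx
    by_cases h : isCut U y j
    · have hx' : isCut U x i := by by_contra h'; exact hgx (by rw [hg, if_neg h'])
      have : y ∈ C := Relation.ReflTransGen.tail hx ⟨hxy, ⟨i, hx'⟩, ⟨j, h⟩⟩
      simp [φ, this]
    · have : g y j = 0 := by rw [hg, if_neg h]
      simp [φ, this]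
  have hφ0 : ∀ x i, φ x i ≠ 0 → g x i ≠ 0 ∧ x ∈ C := by
    intro x i h
    by_cases hx : x ∈ C
    · simp only [φ, hx, if_true] at h; exact ⟨h, hx⟩
    · simp [φ, hx] at h
  have hclosed : ∀ x i j, φ x i + φ (x + unit i) j = φ x j + φ (x + unit j) i := by
    intro x i j
    have key : ∀ z k, (z = x ∨ z = x + unit i ∨ z = x + unit j) → φ z k ≠ 0 →
        φ x i + φ (x + unit i) j = φ x j + φ (x + unit j) i := by
      intro z k hz hne
      obtain ⟨h1, h2⟩ := hφ0 _ _ hne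
      have a0 : starAdj z x := by
        rcases hz with rfl | rfl | rfl
        exacts [starAdj_refl _, (starAdj_add_unit _ _).symm, (starAdj_add_unit _ _).symm]
      have a1 : starAdj z (x + unit i) := by
        rcases hz with rfl | rfl | rfl
        exacts [starAdj_add_unit _ _, starAdj_refl _, starAdj_units _ _ _]
      have a2 : starAdj z (x + unit j) := by
        rcases hz with rfl | rfl | rfl
        exacts [starAdj_add_unit _ _, starAdj_units _ _ _, starAdj_refl _]
      rw [hC z _ k i a0 h1 h2, hC z _ k j a0 h1 h2, hC z _ k j a1 h1 h2, hC z _ k i a2 h1 h2]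
      have e : x + unit i + unit j = x + unit j + unit i := add_right_comm _ _ _
      have t : ∀ a : ZMod 2, a + a = 0 := by decide
      simp only [g, e]
      linear_combination t (u (x + unit i)) - t (u (x + unit j))
    by_cases c1 : φ x i = 0
    · by_cases c2 : φ (x + unit i) j = 0
      · by_cases c3 : φ x j = 0
        · by_cases c4 : φ (x + unit j) i = 0
          · rw [c1, c2, c3, c4]
          · exact key _ _ (.inr (.inr rfl)) c4
        · exact key _ _ (.inl rfl) c3
      · exact key _ _ (.inr (.inl rfl)) c2
    · exact key _ _ (.inl rfl) c1
  obtain ⟨f, hf⟩ := exists_potential φ hclosed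
  have hflat : ∀ x i, ¬ isCut U x i → f x = f (x + unit i) := by
    intro x i h
    have : φ x i = 0 := by
      by_contra hne
      exact (hφ0 _ _ hne).1 (by rw [hg, if_neg h])
    rw [hf, this, add_zero]
  have cU : ∀ x ∈ U, ∀ y ∈ U, f x = f y :=
    hU f fun x i h1 h2 => hflat x i (by simp [isCut, h1, h2])
  have cU' : ∀ x ∈ Uᶜ, ∀ y ∈ Uᶜ, f x = f y :=
    hU' f fun x i h1 h2 => hflat x i (by
      rw [Set.mem_compl_iff] at h1 h2; simp [isCut, h1, h2])
  obtain ⟨i, hi⟩ := hx0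
  obtain ⟨j, hj⟩ := hy0
  have hx : f (x0 + unit i) ≠ f x0 := by
    rw [hf]
    have : φ x0 i = 1 := by
      have : x0 ∈ C := Relation.ReflTransGen.refl
      simp only [φ, this, if_true, hg, hi]
    rw [this]; simp
  have hy : f (y0 + unit j) ≠ f y0 := by
    intro h
    apply hx
    unfold isCut at hi hj
    by_cases h1 : x0 ∈ U
    · have h2 : x0 + unit i ∈ Uᶜ := fun h => hi (by simp [h1, h])
      by_cases h3 : y0 ∈ U
      · have h4 : y0 + unit j ∈ Uᶜ := fun h => hj (by simp [h3, h])
        rw [cU _ h1 _ h3, cU' _ h2 _ h4, h]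
      · have h4 : y0 + unit j ∈ U := by by_contra h; exact hj (by simp [h3, h])
        rw [cU _ h1 _ h4, cU' _ h2 _ h3, h]
    · have h2 : x0 + unit i ∈ U := by by_contra h; exact hi (by simp [h1, h])
      by_cases h3 : y0 ∈ U
      · have h4 : y0 + unit j ∈ Uᶜ := fun h => hj (by simp [h3, h])
        rw [cU' _ h1 _ h4, cU _ h2 _ h3, h]
      · have h4 : y0 + unit j ∈ U := by by_contra h; exact hj (by simp [h3, h])
        rw [cU' _ h1 _ h3, cU _ h2 _ h4, h]
  refine (hφ0 y0 j fun h => hy ?_).2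
  rw [hf, h, add_zero]

section

variable {d : ℕ}

lemma latAdj.eq_add_unit {x y : Zd d} (h : latAdj x y) :
    ∃ i, y = x + unit i ∨ x = y + unit i := by
  obtain ⟨i, hi⟩ : ∃ i, x i ≠ y i := by
    by_contra! hc
    exact h.ne (funext hc)
  have h1 : 1 ≤ |x i - y i| := Int.one_le_abs (sub_ne_zero.2 hi)
  unfold latAdj at h
  rw [← Finset.add_sum_erase _ _ (Finset.mem_univ i)] at h
  have h2 : 0 ≤ ∑ j ∈ Finset.univ.erase i, |x j - y j| := Finset.sum_nonneg fun _ _ => abs_nonneg _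
  have h3 : ∑ j ∈ Finset.univ.erase i, |x j - y j| = 0 := by omega
  rw [Finset.sum_eq_zero_iff_of_nonneg fun _ _ => abs_nonneg _] at h3
  have h4 : ∀ j, j ≠ i → x j = y j := fun j hj => by
    have := abs_eq_zero.1 (h3 j (by simp [hj]))
    omega
  have h5 : |x i - y i| = 1 := by omega
  refine ⟨i, ?_⟩
  rcases (abs_eq zero_le_one).1 h5 with h5 | h5
  · right
    funext j
    by_cases hj : j = i
    · subst hj; simp only [Pi.add_apply, Pi.single_eq_same]; omega
    · simp [hj, h4 j hj]
  · left
    funext j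
    by_cases hj : j = i
    · subst hj; simp only [Pi.add_apply, Pi.single_eq_same]; omega
    · simp [hj, h4 j hj]

lemma latAdj_add_unit (x : Zd d) (i : Fin d) : latAdj x (x + unit i) :=
  latAdj_add_single x i (by simp)

/-- The component of `(-1, …, -1)` in the complement of `A`. -/
def outer (A : Set (Zd d)) : Set (Zd d) := {x | conn (fun _ => true) Aᶜ (fun _ => -1) x}

lemma outer_subset (A : Set (Zd d)) : outer A ⊆ Aᶜ := fun _ h => h.mem

lemma subset_compl_outer (A : Set (Zd d)) : A ⊆ (outer A)ᶜ :=
  fun _ hx h => outer_subset A h hx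

lemma mem_outer_of_adj {A : Set (Zd d)} {x y : Zd d} (hx : x ∈ outer A) (hy : y ∉ A)
    (h : latAdj x y) : y ∈ outer A := conn.tail hx ⟨h, rfl⟩ hy

/-- A set of sites of the positive orthant in which every site is reached from the origin by
an oriented path. -/
structure Oriented (A : Set (Zd d)) : Prop where
  zero_mem : 0 ∈ A
  nonneg : ∀ x ∈ A, ∀ i, 0 ≤ x i
  pred : ∀ x ∈ A, x ≠ 0 → ∃ i, x - unit i ∈ A

lemma Oriented.const {A : Set (Zd d)} (hA : Oriented A) {α : Type*} {f : Zd d → α}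
    (hf : ∀ x i, x ∈ A → x + unit i ∈ A → f x = f (x + unit i)) {x : Zd d} (hx : x ∈ A) :
    f x = f 0 := by
  generalize hk : (∑ i, x i).toNat = k
  induction k generalizing x with
  | zero =>
    have : x = 0 := by
      have h0 := Finset.sum_nonneg fun i (_ : i ∈ Finset.univ) => hA.nonneg x hx i
      have h1 : ∑ i, x i = 0 := by omega
      rw [Finset.sum_eq_zero_iff_of_nonneg fun i _ => hA.nonneg x hx i] at h1
      exact funext fun i => h1 i (Finset.mem_univ i)
    rw [this]
  | succ k ih =>
    have hne : x ≠ 0 := by rintro rfl; simp at hk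
    obtain ⟨i, hi⟩ := hA.pred x hx hne
    have h1 := hf _ i hi (by simpa using hx)
    rw [sub_add_cancel] at h1
    rw [← h1]
    refine ih hi ?_
    have : ∑ j, (x - unit i) j = ∑ j, x j - 1 := by
      simp [Finset.sum_sub_distrib]
    omega

lemma Oriented.locConst_compl_outer {A : Set (Zd d)} (hA : Oriented A) :
    LocConst (outer A)ᶜ := by
  intro f hf
  have hsub := subset_compl_outer A
  have hadj : ∀ a b, latAdj a b → a ∈ (outer A)ᶜ → b ∈ (outer A)ᶜ → f a = f b := by
    intro a b h ha hb
    obtain ⟨i, rfl | rfl⟩ := h.eq_add_unit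
    · exact hf _ _ ha hb
    · exact (hf _ _ hb ha).symm
  have key : ∀ x ∈ (outer A)ᶜ, f x = f 0 := by
    intro x hx
    have hp : conn (fun _ => true) (Set.Icc (x ⊓ 0) (x ⊔ 0)) x 0 :=
      conn_of_full_Icc (fun _ _ => rfl) ⟨inf_le_left, le_sup_left⟩ ⟨inf_le_right, le_sup_right⟩
    replace hp := hp.2
    generalize Set.Icc (x ⊓ 0) (x ⊔ 0) = T at hp
    induction hp using Relation.ReflTransGen.head_induction_on with
    | refl => rfl
    | @head a b hab _ ih =>
      by_cases ha : a ∈ A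
      · exact hA.const (fun y i h1 h2 => hf y i (hsub h1) (hsub h2)) ha
      · have hb : b ∈ (outer A)ᶜ := fun hb => hx (mem_outer_of_adj hb ha (latAdj_symm hab.1.1))
        rw [hadj a b hab.1.1 hx hb, ih hb]
  intro x hx y hy
  rw [key x hx, key y hy]

lemma locConst_outer (A : Set (Zd d)) : LocConst (outer A) := by
  intro f hf
  have key : ∀ x ∈ outer A, f x = f (fun _ => -1) := by
    intro x hx
    obtain ⟨hz, hp⟩ := hx
    induction hp with
    | refl => rfl
    | tail hp hab ih =>
      rename_i a b
      have ha : a ∈ outer A := ⟨hz, hp⟩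
      have hb : b ∈ outer A := ⟨hz, hp.tail hab⟩
      rw [← ih]
      obtain ⟨i, rfl | rfl⟩ := hab.1.1.eq_add_unit
      · exact (hf _ _ ha hb).symm
      · exact hf _ _ hb ha
  intro x hx y hy
  rw [key x hx, key y hy]

lemma Oriented.mem_outer_of_neg {A : Set (Zd d)} (hA : Oriented A) {x : Zd d} {j : Fin d}
    (hj : x j < 0) : x ∈ outer A := by
  let z : Zd d := fun _ => -1
  have : conn (fun _ => true) (Set.Icc (z ⊓ x) (z ⊔ x)) z x :=
      conn_of_full_Icc (fun _ _ => rfl) ⟨inf_le_left, le_sup_left⟩ ⟨inf_le_right, le_sup_right⟩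
  refine this.mono fun y hy hyA => ?_
  have h1 := hy.2 j
  have h2 := hA.nonneg y hyA j
  simp only [z, Pi.sup_apply] at h1
  omega

lemma Oriented.mem_outer_of_gt {A : Set (Zd d)} (hA : Oriented A) (hd : 2 ≤ d) {t : ℤ}
    (ht : ∀ y ∈ A, ∀ i, y i ≤ t) {x : Zd d} {j : Fin d} (hj : t < x j) : x ∈ outer A := by
  have : Nontrivial (Fin d) := Fin.nontrivial_iff_two_le.2 hd
  obtain ⟨k, hk⟩ := exists_ne j
  let w : Zd d := Function.update x k (-1)
  have hw : w ∈ outer A := hA.mem_outer_of_neg (j := k) (by simp [w])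
  have h1 : conn (fun _ => true) (Set.Icc (w ⊓ x) (w ⊔ x)) w x :=
      conn_of_full_Icc (fun _ _ => rfl) ⟨inf_le_left, le_sup_left⟩ ⟨inf_le_right, le_sup_right⟩
  refine conn.trans hw (h1.mono fun y hy hyA => ?_)
  have h1 := hy.1 j
  have h2 := ht y hyA j
  have : w j = x j := by simp [w, hk.symm]
  simp only [Pi.inf_apply, this] at h1
  omega

lemma Oriented.compl_outer_subset {A : Set (Zd d)} (hA : Oriented A) (hd : 2 ≤ d) {t : ℤ}
    (ht : ∀ y ∈ A, ∀ i, y i ≤ t) : (outer A)ᶜ ⊆ Set.Icc 0 (fun _ => t) := by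
  intro x hx
  refine ⟨fun i => ?_, fun i => ?_⟩
  · by_contra h
    exact hx (hA.mem_outer_of_neg (j := i) (not_le.1 h))
  · by_contra h
    exact hx (hA.mem_outer_of_gt hd ht (j := i) (not_le.1 h))

end

section

variable {d : ℕ}

open Classical in
/-- The translate of `W` by `-e_i`. -/
noncomputable def shift (W : Finset (Zd d)) (i : Fin d) : Finset (Zd d) :=
  W.image fun x => x - unit i

lemma mem_shift {W : Finset (Zd d)} {i : Fin d} {x : Zd d} :
    x ∈ shift W i ↔ x + unit i ∈ W := by
  unfold shift
  rw [Finset.mem_image]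
  constructor
  · rintro ⟨y, hy, rfl⟩; simpa using hy
  · intro h; exact ⟨_, h, by simp⟩

lemma card_shift (W : Finset (Zd d)) (i : Fin d) : (shift W i).card = W.card :=
  Finset.card_image_of_injective _ sub_left_injective

open Classical in
/-- The sites of `W` whose neighbour in direction `e_i` is not in `W`. -/
noncomputable def upper (W : Finset (Zd d)) (i : Fin d) : Finset (Zd d) := W \ shift W i

lemma mem_upper {W : Finset (Zd d)} {i : Fin d} {x : Zd d} :
    x ∈ upper W i ↔ x ∈ W ∧ x + unit i ∉ W := by
  unfold upper
  rw [Finset.mem_sdiff, mem_shift]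

/-- The number of upper faces of `W`. -/
noncomputable def faces (W : Finset (Zd d)) : ℕ := ∑ i, (upper W i).card

open Classical in
lemma cutBase_compl_eq (W : Finset (Zd d)) : cutBase ((W : Set (Zd d))ᶜ) =
    ↑(Finset.univ.biUnion fun i => upper W i ∪ (shift W i \ W)) := by
  ext x
  simp only [cutBase, isCut, Set.mem_compl_iff, Finset.mem_coe, Finset.mem_biUnion,
    Finset.mem_univ, true_and, Finset.mem_union, mem_upper, Finset.mem_sdiff, mem_shift,
    Set.mem_ofPred_eq]
  refine exists_congr fun i => ?_
  tauto

open Classical in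
lemma card_cut_le (W : Finset (Zd d)) :
    (Finset.univ.biUnion fun i => upper W i ∪ (shift W i \ W)).card ≤ 2 * faces W := by
  refine Finset.card_biUnion_le.trans ?_
  unfold faces
  rw [Finset.mul_sum]
  refine Finset.sum_le_sum fun i _ => (Finset.card_union_le _ _).trans ?_
  have : (shift W i \ W).card = (upper W i).card :=
    Finset.card_sdiff_comm (card_shift W i)
  omega

lemma exists_upper_on_line {W : Finset (Zd d)} {x : Zd d} (hx : x ∈ W) (i : Fin d) :
    ∃ k : ℕ, x + Pi.single i (k : ℤ) ∈ upper W i := by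
  by_contra! hc
  have : ∀ k : ℕ, x + Pi.single i (k : ℤ) ∈ W := by
    intro k
    induction k with
    | zero => simpa using hx
    | succ k ih =>
      by_contra h
      refine hc k (mem_upper.2 ⟨ih, ?_⟩)
      rw [add_assoc, ← Pi.single_add]
      exact_mod_cast h
  refine Set.infinite_univ (α := ℕ) ?_
  refine Set.Finite.of_injOn (f := fun k : ℕ => x + Pi.single i (k : ℤ)) (t := (W : Set (Zd d)))
    (fun k _ => this k) ?_ W.finite_toSet
  intro a _ b _ hab
  have := congrFun hab i
  simpa using this

lemma pi_count (d : ℕ) :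
    Measure.pi (fun _ : Fin d => (Measure.count : Measure ℤ)) = Measure.count := by
  refine Measure.ext_of_singleton fun x => ?_
  rw [Measure.pi_singleton]
  simp

open Classical in
/-- The Loomis-Whitney isoperimetric inequality. -/
lemma card_pow_le_faces_pow (hd : 2 ≤ d) (W : Finset (Zd d)) :
    W.card ^ (d - 1) ≤ faces W ^ d := by
  have hd1 : (1 : ℝ) < d := by exact_mod_cast hd
  have hq := Real.HolderConjugate.conjExponent hd1
  let f : Zd d → ℝ≥0∞ := fun x => ∑ i, if x ∈ upper W i then 1 else 0
  have hf : Measurable f := measurable_of_countable f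
  have h1 := lintegral_prod_lintegral_pow_le (ι := Fin d) (A := fun _ => ℤ)
    (fun _ => Measure.count) (p := Real.conjExponent d) (by simpa using hq) hf
  rw [pi_count, lintegral_count, lintegral_count] at h1
  have h2 : ∑' x, f x = (faces W : ℝ≥0∞) := by
    simp only [f]
    rw [Summable.tsum_finsetSum fun _ _ => ENNReal.summable]
    unfold faces
    push_cast
    refine Finset.sum_congr rfl fun i _ => ?_
    rw [tsum_eq_sum (s := upper W i) (fun x hx => if_neg hx),
      Finset.sum_congr rfl (fun x hx => if_pos hx)]
    simp
  have h3 : (W.card : ℝ≥0∞) ≤ (faces W : ℝ≥0∞) ^ (Real.conjExponent d) := by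
    rw [← h2]
    refine le_trans ?_ h1
    refine le_trans ?_ (ENNReal.sum_le_tsum W)
    rw [Finset.cast_card]
    refine Finset.sum_le_sum fun x hx => Finset.one_le_prod' fun i _ => ?_
    refine ENNReal.one_le_rpow ?_ ?_
    · rw [lintegral_count]
      obtain ⟨k, hk⟩ := exists_upper_on_line hx i
      refine le_trans ?_ (ENNReal.le_tsum (x i + k))
      have : Function.update x i (x i + k) = x + Pi.single i (k : ℤ) := by
        funext j
        by_cases hj : j = i
        · subst hj; simp
        · simp [hj]
      rw [this]
      refine le_trans ?_ (Finset.single_le_sum (fun _ _ => zero_le) (Finset.mem_univ i))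
      rw [if_pos hk]
    · simp only [Fintype.card_fin]
      exact one_div_pos.2 (by linarith)
  have h4 := ENNReal.rpow_le_rpow h3 (by linarith : (0 : ℝ) ≤ (d : ℝ) - 1)
  rw [← ENNReal.rpow_mul, mul_comm (Real.conjExponent d), hq.sub_one_mul_conj,
    ENNReal.rpow_natCast] at h4
  have : (d : ℝ) - 1 = ((d - 1 : ℕ) : ℝ) := by
    rw [Nat.cast_sub (by omega)]; simp
  rw [this, ENNReal.rpow_natCast] at h4
  exact_mod_cast h4

end

section

variable {d : ℕ}

/-- A sup-norm connected set of sites near the `i₀`-axis, a positive proportion of which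
are in `B`. -/
structure Animal (i₀ : Fin d) (B : Set (Zd d)) (G : Finset (Zd d)) : Prop where
  axis : ∃ k < G.card, (Pi.single i₀ (k : ℤ) : Zd d) ∈ G
  connected : ∀ x ∈ G, ∀ y ∈ G, starConn (G : Set (Zd d)) x y
  card_le : G.card ≤ 6 * d * ((G : Set (Zd d)) ∩ B).ncard

/-- Oriented growth up to level `M` from the origin, with obstacles `B`. -/
structure Growth (R B : Set (Zd d)) (M : ℕ) : Prop where
  oriented : Oriented R
  extend : ∀ x ∈ R, ∀ i, (∑ j, x j) + 1 ≤ M → x + unit i ∈ R ∨ x + unit i ∈ B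

/-- The part of `R` up to level `t`. -/
def upTo (R : Set (Zd d)) (t : ℕ) : Set (Zd d) := {x ∈ R | ∑ j, x j ≤ t}

lemma sum_add_unit (x : Zd d) (i : Fin d) : ∑ j, (x + unit i) j = ∑ j, x j + 1 := by
  simp [Finset.sum_add_distrib]

lemma Oriented.upTo {R : Set (Zd d)} (hR : Oriented R) (t : ℕ) : Oriented (upTo R t) where
  zero_mem := ⟨hR.zero_mem, by simp⟩
  nonneg x hx := hR.nonneg x hx.1
  pred x hx hne := by
    obtain ⟨i, hi⟩ := hR.pred x hx.1 hne
    refine ⟨i, hi, ?_⟩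
    have h1 := sum_add_unit (x - unit i) i
    rw [sub_add_cancel] at h1
    have := hx.2
    omega

lemma Oriented.le_of_mem_upTo {R : Set (Zd d)} (hR : Oriented R) {t : ℕ} {x : Zd d}
    (hx : x ∈ Perco.upTo R t) (i : Fin d) : x i ≤ t :=
  (Finset.single_le_sum (fun j _ => hR.nonneg x hx.1 j) (Finset.mem_univ i)).trans hx.2

lemma Oriented.upTo_finite {R : Set (Zd d)} (hR : Oriented R) (t : ℕ) :
    (Perco.upTo R t).Finite :=
  (Set.finite_Icc (0 : Zd d) (fun _ => (t : ℤ))).subset fun x hx =>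
    ⟨fun i => hR.nonneg x hx.1 i, fun i => hR.le_of_mem_upTo hx i⟩

lemma exists_cut_axis {W : Finset (Zd d)} (h0 : (0 : Zd d) ∈ W) {i j : Fin d} (hij : i ≠ j)
    {G : Finset (Zd d)} (hG : ∀ i, upper W i ⊆ G) :
    ∃ k < G.card, (Pi.single i (k : ℤ) : Zd d) ∈ G := by
  classical
  have hex : ∃ k : ℕ, (Pi.single i (k : ℤ) : Zd d) ∈ upper W i := by
    obtain ⟨k, hk⟩ := exists_upper_on_line h0 i
    exact ⟨k, by simpa using hk⟩
  have hmem : ∀ l ≤ Nat.find hex, (Pi.single i (l : ℤ) : Zd d) ∈ W := by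
    intro l
    induction l with
    | zero => intro _; simpa using h0
    | succ l ih =>
      intro hl
      by_contra hc
      refine Nat.find_min hex (m := l) (by omega) (mem_upper.2 ⟨ih (by omega), ?_⟩)
      rw [← Pi.single_add]
      exact_mod_cast hc
  refine ⟨Nat.find hex, ?_, hG i (Nat.find_spec hex)⟩
  have : ∀ l : ℕ, ∃ y : Zd d, l ≤ Nat.find hex → y ∈ G ∧ y i = l := by
    intro l
    by_cases hl : l ≤ Nat.find hex
    · obtain ⟨k, hk⟩ := exists_upper_on_line (hmem l hl) j
      exact ⟨_, fun _ => ⟨hG j hk, by simp [hij]⟩⟩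
    · exact ⟨0, fun h => absurd h hl⟩
  choose y hy using this
  have hle : (Finset.range (Nat.find hex + 1)).card ≤ G.card := by
    refine Finset.card_le_card_of_injOn y (fun l hl => (hy l ?_).1) ?_
    · simpa [Nat.lt_succ_iff] using hl
    · intro a ha b hb hab
      have h1 := (hy a (by simpa [Nat.lt_succ_iff] using ha)).2
      have h2 := (hy b (by simpa [Nat.lt_succ_iff] using hb)).2
      rw [hab, h2] at h1
      exact_mod_cast h1.symm
  rw [Finset.card_range] at hle
  omega

open Classical in
lemma Growth.step {R B : Set (Zd d)} {M : ℕ} (h : Growth R B M) (hd : 2 ≤ d) (i₀ : Fin d)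
    {t : ℕ} (ht : t + 1 ≤ M) :
    (∃ G, Animal i₀ B G) ∨ ∃ N, (upTo R (t + 1)).ncard = (upTo R t).ncard + N ∧
      (upTo R t).ncard ^ (d - 1) ≤ (2 * d * N) ^ d := by
  have hA := h.oriented.upTo t
  have hfin : (outer (upTo R t))ᶜ.Finite := (Set.finite_Icc _ _).subset
    (hA.compl_outer_subset hd fun y hy i => h.oriented.le_of_mem_upTo hy i)
  obtain ⟨W, hW⟩ : ∃ W : Finset (Zd d), (W : Set (Zd d)) = (outer (upTo R t))ᶜ :=
    ⟨hfin.toFinset, by simp⟩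
  have hWo : ((W : Set (Zd d))ᶜ) = outer (upTo R t) := by rw [hW, compl_compl]
  let β : Finset (Zd d) := Finset.univ.biUnion fun i => upper W i ∪ (shift W i \ W)
  let Y : Finset (Zd d) := Finset.univ.biUnion fun i => (upper W i).image (· + unit i)
  have hβ : (β : Set (Zd d)) = cutBase (outer (upTo R t)) := by
    rw [← hWo, cutBase_compl_eq]
  have hupβ : ∀ i, upper W i ⊆ β := fun i x hx =>
    Finset.mem_biUnion.2 ⟨i, Finset.mem_univ _, Finset.mem_union_left _ hx⟩
  have hup : ∀ i, ∀ x ∈ upper W i, x ∈ upTo R t ∧ x + unit i ∉ upTo R t := by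
    intro i x hx
    obtain ⟨h1, h2⟩ := mem_upper.1 hx
    have h2' : x + unit i ∈ outer (upTo R t) := by rw [← hWo]; exact h2
    have h1' : x ∉ outer (upTo R t) := by rw [← hWo]; simpa using h1
    refine ⟨?_, fun hc => outer_subset _ h2' hc⟩
    by_contra hc
    exact h1' (mem_outer_of_adj h2' hc (latAdj_symm (latAdj_add_unit x i)))
  have hYmem : ∀ y ∈ Y, y ∈ upTo R (t + 1) \ upTo R t ∨ y ∈ B := by
    intro y hy
    simp only [Y, Finset.mem_biUnion, Finset.mem_univ, true_and, Finset.mem_image] at hy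
    obtain ⟨i, x, hx, rfl⟩ := hy
    obtain ⟨h1, h2⟩ := hup i x hx
    have h3 := h1.2
    have h4 := sum_add_unit x i
    rcases h.extend x h1.1 i (by omega) with h5 | h5
    · exact .inl ⟨⟨h5, by push_cast; omega⟩, h2⟩
    · exact .inr h5
  have hfin' := h.oriented.upTo_finite (t + 1)
  have hsub : upTo R t ⊆ upTo R (t + 1) := fun x hx => ⟨hx.1, by have := hx.2; push_cast; omega⟩
  let N := (upTo R (t + 1) \ upTo R t).ncard
  have hN : (upTo R (t + 1)).ncard = (upTo R t).ncard + N := by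
    rw [← Set.ncard_sdiff_add_ncard_of_subset hsub hfin', add_comm]
  have hfY : faces W ≤ d * Y.card := by
    unfold faces
    refine (Finset.sum_le_card_nsmul Finset.univ _ Y.card fun i _ => ?_).trans (by simp)
    rw [← Finset.card_image_of_injective (upper W i) (add_left_injective (unit i))]
    exact Finset.card_le_card fun y hy => Finset.mem_biUnion.2 ⟨i, Finset.mem_univ _, hy⟩
  have hYf : Y.card ≤ faces W := by
    refine Finset.card_biUnion_le.trans (Finset.sum_le_sum fun i _ => Finset.card_image_le)
  have hYN : Y.card ≤ N + ((Y : Set (Zd d)) ∩ B).ncard := by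
    rw [← Set.ncard_coe_finset]
    refine (Set.ncard_le_ncard (t := (upTo R (t + 1) \ upTo R t) ∪ (Y ∩ B)) ?_ ?_).trans
      (Set.ncard_union_le _ _)
    · intro y hy
      rcases hYmem y hy with h1 | h1
      · exact .inl h1
      · exact .inr ⟨hy, h1⟩
    · exact (hfin'.subset Set.sdiff_subset).union (Y.finite_toSet.subset Set.inter_subset_left)
  by_cases hcase : 2 * d * ((Y : Set (Zd d)) ∩ B).ncard ≤ faces W
  · right
    refine ⟨N, hN, ?_⟩
    have h1 : (upTo R t).ncard ≤ W.card := by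
      rw [← Set.ncard_coe_finset, hW]
      exact Set.ncard_le_ncard (subset_compl_outer _) hfin
    have h2 : faces W ≤ 2 * d * N := by nlinarith
    calc _ ≤ W.card ^ (d - 1) := Nat.pow_le_pow_left h1 _
      _ ≤ faces W ^ d := card_pow_le_faces_pow hd W
      _ ≤ _ := Nat.pow_le_pow_left h2 _
  · left
    push Not at hcase
    have : Nontrivial (Fin d) := Fin.nontrivial_iff_two_le.2 hd
    obtain ⟨j, hj⟩ := exists_ne i₀
    have h0W : (0 : Zd d) ∈ W := by
      rw [← Finset.mem_coe, hW]
      exact subset_compl_outer _ hA.zero_mem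
    have hcardβ : β.card ≤ 2 * faces W := card_cut_le W
    refine ⟨β ∪ Y, exists_cut_axis h0W hj.symm fun i =>
      (hupβ i).trans Finset.subset_union_left, ?_, ?_⟩
    · have hto : ∀ x ∈ β ∪ Y, ∃ b ∈ β, starConn (↑(β ∪ Y)) x b := by
        intro x hx
        rcases Finset.mem_union.1 hx with hx | hx
        · exact ⟨x, hx, .refl⟩
        · have hx' := hx
          simp only [Y, Finset.mem_biUnion, Finset.mem_univ, true_and, Finset.mem_image] at hx
          obtain ⟨i, z, hz, rfl⟩ := hx
          exact ⟨z, hupβ i hz, .single ⟨(starAdj_add_unit z i).symm,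
            Finset.mem_union_right _ hx', Finset.mem_union_left _ (hupβ i hz)⟩⟩
      intro x hx y hy
      obtain ⟨b, hb, hxb⟩ := hto x hx
      obtain ⟨c, hc, hyc⟩ := hto y hy
      refine (hxb.trans ?_).trans hyc.symm
      have : starConn (β : Set (Zd d)) b c := by
        rw [hβ]
        refine cutBase_starConn (locConst_outer _) hA.locConst_compl_outer ?_ ?_
        · rw [← hβ]; exact hb
        · rw [← hβ]; exact hc
      exact this.mono (by simp)
    · have h1 := Finset.card_union_le β Y
      have h2 : ((Y : Set (Zd d)) ∩ B).ncard ≤ ((↑(β ∪ Y) : Set (Zd d)) ∩ B).ncard :=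
        Set.ncard_le_ncard (Set.inter_subset_inter_left _ (by simp))
          ((β ∪ Y).finite_toSet.subset Set.inter_subset_left)
      have h3 := Nat.mul_le_mul_left (6 * d) h2
      have h4 : 6 * d * ((Y : Set (Zd d)) ∩ B).ncard = 3 * (2 * d * ((Y : Set (Zd d)) ∩ B).ncard) := by
        ring
      omega

end

section

variable {d : ℕ}

lemma add_pow_le_pow_add {b k : ℝ} (hb : 0 ≤ b) (hk : 0 ≤ k) (n : ℕ) :
    (b + k) ^ (n + 1) ≤ b ^ (n + 1) + (n + 1) * k * (b + k) ^ n := by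
  induction n with
  | zero => simp
  | succ n ih =>
    have h0 : 0 ≤ (n + 1) * k * (b + k) ^ n := by positivity
    calc (b + k) ^ (n + 1 + 1) = b * (b + k) ^ (n + 1) + k * (b + k) ^ (n + 1) := by ring
      _ ≤ b * (b ^ (n + 1) + (n + 1) * k * (b + k) ^ n) + k * (b + k) ^ (n + 1) := by gcongr
      _ ≤ b ^ (n + 1 + 1) + (b + k) * ((n + 1) * k * (b + k) ^ n) + k * (b + k) ^ (n + 1) := by
        have := mul_nonneg hk h0
        linear_combination this
      _ = _ := by push_cast; ring

/-- The growth rate of the coarse-grained cluster. -/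
noncomputable def rate (d : ℕ) : ℝ := 1 / (d ^ 2 * 2 ^ d)

lemma rate_pos (hd : 2 ≤ d) : 0 < rate d := by
  unfold rate
  have : (0 : ℝ) < d := by exact_mod_cast (by omega : 0 < d)
  positivity

lemma rate_le_one (hd : 2 ≤ d) : rate d ≤ 1 := by
  unfold rate
  have : (1 : ℝ) ≤ d := by exact_mod_cast (by omega : 1 ≤ d)
  exact div_le_one_of_le₀ (one_le_mul_of_one_le_of_one_le (one_le_pow₀ this)
    (one_le_pow₀ (by norm_num))) (by positivity)

lemma rate_step (hd : 2 ≤ d) {a N : ℕ} (ha : 1 ≤ a) (h : a ^ (d - 1) ≤ (2 * d * N) ^ d) {c : ℝ}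
    (hc0 : 0 ≤ c) (hc : c ^ d ≤ a) : (c + rate d) ^ d ≤ ((a + N : ℕ) : ℝ) := by
  have hd0 : d ≠ 0 := by omega
  have hκ := rate_pos hd
  have hκ1 := rate_le_one hd
  let b : ℝ := (a : ℝ) ^ ((d : ℝ)⁻¹)
  have hb : b ^ d = a := Real.rpow_inv_natCast_pow (by positivity) hd0
  have hb1 : 1 ≤ b := Real.one_le_rpow (by exact_mod_cast ha) (by positivity)
  have hcb : c ≤ b := le_of_pow_le_pow_left₀ hd0 (by linarith) (by rw [hb]; exact hc)
  have hbN : b ^ (d - 1) ≤ 2 * d * N := by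
    refine le_of_pow_le_pow_left₀ hd0 (by positivity) ?_
    rw [← pow_mul, mul_comm, pow_mul, hb]
    exact_mod_cast h
  obtain ⟨e, rfl⟩ : ∃ e, d = e + 1 := ⟨d - 1, by omega⟩
  simp only [Nat.add_sub_cancel] at hbN
  have h1 : (c + rate (e + 1)) ^ (e + 1) ≤ (b + rate (e + 1)) ^ (e + 1) := by gcongr
  have h2 := add_pow_le_pow_add (b := b) (k := rate (e + 1)) (by linarith) hκ.le e
  have h3 : (b + rate (e + 1)) ^ e ≤ (2 * b) ^ e := by gcongr; linarith
  have h4 : ((e : ℝ) + 1) * rate (e + 1) * (b + rate (e + 1)) ^ e ≤ N := by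
    calc _ ≤ ((e : ℝ) + 1) * rate (e + 1) * (2 * b) ^ e := by gcongr
      _ = ((e : ℝ) + 1) * rate (e + 1) * 2 ^ e * b ^ e := by rw [mul_pow]; ring
      _ ≤ ((e : ℝ) + 1) * rate (e + 1) * 2 ^ e * (2 * (e + 1 : ℕ) * N) := by gcongr
      _ = N := by
        unfold rate
        have : (e : ℝ) + 1 ≠ 0 := by positivity
        push_cast
        field_simp
        ring
  rw [hb] at h2
  push_cast
  linarith

/-- Either the growth is of full dimension, or some animal is blocked. -/
lemma Growth.growth_or_animal {R B : Set (Zd d)} {M : ℕ} (h : Growth R B M) (hd : 2 ≤ d)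
    (i₀ : Fin d) : (∃ G, Animal i₀ B G) ∨
      ∀ t ≤ M, (rate d * (t + 1)) ^ d ≤ ((upTo R t).ncard : ℝ) := by
  by_cases hG : ∃ G, Animal i₀ B G
  · exact .inl hG
  right
  have hpos : ∀ t, 1 ≤ (upTo R t).ncard := fun t =>
    (Set.ncard_pos (h.oriented.upTo_finite t)).2 ⟨0, (h.oriented.upTo t).zero_mem⟩
  intro t
  induction t with
  | zero =>
    intro _
    have h1 : rate d ^ d ≤ 1 := pow_le_one₀ (rate_pos hd).le (rate_le_one hd)
    have h2 : (1 : ℝ) ≤ (upTo R 0).ncard := by exact_mod_cast hpos 0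
    simpa using h1.trans h2
  | succ t ih =>
    intro ht
    obtain hc | ⟨N, hN, hN'⟩ := h.step hd i₀ ht
    · exact absurd hc hG
    have := rate_step hd (hpos t) hN' (by have := rate_pos hd; positivity) (ih (by omega))
    rw [hN]
    convert this using 2
    push_cast
    ring

end

section

variable {d : ℕ}

/-- The sup-norm step coded by `s`. -/
def move (s : Fin d → Fin 3) : Zd d := fun i => (s i : ℤ) - 1

lemma exists_move {x y : Zd d} (h : starAdj x y) : ∃ s, x + move s = y := by
  refine ⟨fun i => ⟨(y i - x i + 1).toNat, ?_⟩, ?_⟩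
  · have := abs_le.1 (h i)
    omega
  · funext i
    have := abs_le.1 (h i)
    simp only [move, Pi.add_apply]
    omega

open Classical in
/-- The sites visited by the walk with steps `σ` from `x`. -/
noncomputable def verts : Zd d → List (Fin d → Fin 3) → Finset (Zd d)
  | x, [] => {x}
  | x, s :: σ => insert x (verts (x + move s) σ)

lemma start_mem_verts (x : Zd d) (σ : List (Fin d → Fin 3)) : x ∈ verts x σ := by
  cases σ <;> simp [verts]

lemma card_verts_le (x : Zd d) (σ : List (Fin d → Fin 3)) :
    (verts x σ).card ≤ σ.length + 1 := by
  induction σ generalizing x with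
  | nil => simp [verts]
  | cons s σ ih =>
    classical
    exact (Finset.card_insert_le _ _).trans (by simpa using ih (x + move s))

open Classical in
lemma exists_detour {x y z : Zd d} {σ : List (Fin d → Fin 3)} (hy : y ∈ verts x σ)
    (hz : starAdj y z) :
    ∃ σ', σ'.length = σ.length + 2 ∧ verts x σ' = insert z (verts x σ) := by
  have key : ∀ (x : Zd d) (σ : List (Fin d → Fin 3)), starAdj x z →
      ∃ σ', σ'.length = σ.length + 2 ∧ verts x σ' = insert z (verts x σ) := by
    intro x σ h
    obtain ⟨s, hs⟩ := exists_move h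
    obtain ⟨s', hs'⟩ := exists_move h.symm
    refine ⟨s :: s' :: σ, rfl, ?_⟩
    simp only [verts, hs, hs']
    rw [Finset.insert_comm, Finset.insert_eq_of_mem (start_mem_verts x σ)]
  induction σ generalizing x with
  | nil =>
    simp only [verts, Finset.mem_singleton] at hy
    subst hy
    exact key _ [] hz
  | cons s σ ih =>
    by_cases hyx : y = x
    · subst hyx; exact key _ _ hz
    · simp only [verts, Finset.mem_insert, hyx, false_or] at hy
      obtain ⟨σ', h1, h2⟩ := ih hy
      refine ⟨s :: σ', by simp [h1], ?_⟩
      simp only [verts, h2]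
      exact Finset.insert_comm _ _ _

lemma starConn.exists_exit {S : Set (Zd d)} {x y : Zd d} (h : starConn S x y) {H : Set (Zd d)}
    (hx : x ∈ H) (hy : y ∉ H) : ∃ a b, starAdj a b ∧ a ∈ H ∧ b ∈ S ∧ b ∉ H := by
  induction h with
  | refl => exact absurd hx hy
  | @tail b c _ hbc ih =>
    by_cases hb : b ∈ H
    · exact ⟨b, c, hbc.1, hb, hbc.2.2, hy⟩
    · exact ih hb

/-- A connected set is covered by a walk of at most twice its cardinality. -/
lemma exists_verts_eq {G : Finset (Zd d)} (hG : ∀ x ∈ G, ∀ y ∈ G, starConn (G : Set (Zd d)) x y)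
    {x : Zd d} (hx : x ∈ G) : ∃ σ, σ.length = 2 * (G.card - 1) ∧ verts x σ = G := by
  classical
  have key : ∀ k, k + 1 ≤ G.card →
      ∃ σ, σ.length = 2 * k ∧ verts x σ ⊆ G ∧ (verts x σ).card = k + 1 := by
    intro k
    induction k with
    | zero => exact fun _ => ⟨[], rfl, by simpa [verts] using hx, by simp [verts]⟩
    | succ k ih =>
      intro hk
      obtain ⟨σ, h1, h2, h3⟩ := ih (by omega)
      obtain ⟨y, hyG, hy⟩ : ∃ y ∈ G, y ∉ verts x σ := by
        by_contra! hc
        have := Finset.card_le_card hc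
        omega
      obtain ⟨a, b, hab, ha, hbG, hb⟩ := (hG x hx y hyG).exists_exit
        (H := (verts x σ : Set (Zd d))) (start_mem_verts x σ) hy
      obtain ⟨σ', h4, h5⟩ := exists_detour ha hab
      refine ⟨σ', by omega, ?_, ?_⟩
      · rw [h5]
        exact Finset.insert_subset hbG h2
      · rw [h5, Finset.card_insert_of_notMem hb, h3]
  have hpos : 0 < G.card := Finset.card_pos.2 ⟨x, hx⟩
  obtain ⟨σ, h1, h2, h3⟩ := key (G.card - 1) (by omega)
  exact ⟨σ, h1, Finset.eq_of_subset_of_card_le h2 (by omega)⟩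

/-- A density of obstacles which makes blocking animals unlikely. -/
noncomputable def thr (d : ℕ) : ℝ := (1 / (32 * 9 ^ d)) ^ (6 * d)

lemma thr_pos (d : ℕ) : 0 < thr d := by unfold thr; positivity

lemma sum_quarter_le (K : ℕ) : ∑ g ∈ Finset.Icc 1 K, (1 / 4 : ℝ) ^ g ≤ 1 / 2 := by
  have : ∑ g ∈ Finset.Icc 1 K, (1 / 4 : ℝ) ^ g = (1 - (1 / 4) ^ K) / 3 := by
    induction K with
    | zero => simp
    | succ K ih =>
      rw [Finset.sum_Icc_succ_top (by omega), ih, pow_succ]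
      ring
  rw [this]
  have : (0 : ℝ) ≤ (1 / 4) ^ K := by positivity
  linarith

lemma animal_prob_le {Ω : Type*} [MeasurableSpace Ω] (μ : Measure Ω) [IsFiniteMeasure μ]
    {B : Ω → Set (Zd d)} {H : Set Ω} {Bmax : Finset (Zd d)} (hmax : ∀ ω, B ω ⊆ Bmax)
    (hB : ∀ S : Finset (Zd d), μ.real (H ∩ {ω | ↑S ⊆ B ω}) ≤ thr d ^ S.card * μ.real H)
    (i₀ : Fin d) :
    μ.real (H ∩ {ω | ∃ G, Animal i₀ (B ω) G}) ≤ μ.real H / 2 := by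
  classical
  let E : Finset (Zd d) → Set Ω := fun T => H ∩ {ω | ↑T ⊆ B ω}
  let K := 6 * d * Bmax.card
  let C : (g : ℕ) → ℕ → List.Vector (Fin d → Fin 3) (2 * (g - 1)) → Finset (Finset (Zd d)) :=
    fun g k σ => (verts (Pi.single i₀ (k : ℤ)) σ.1).powerset.filter fun T => g ≤ 6 * d * T.card
  have hsub : H ∩ {ω | ∃ G, Animal i₀ (B ω) G} ⊆ ⋃ g ∈ Finset.Icc 1 K,
      ⋃ k ∈ Finset.range g, ⋃ σ ∈ (Finset.univ : Finset (List.Vector (Fin d → Fin 3) (2 * (g - 1)))),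
        ⋃ T ∈ C g k σ, E T := by
    rintro ω ⟨hωH, G, hG⟩
    obtain ⟨k, hk, hkG⟩ := hG.axis
    obtain ⟨σ, hσ, hσG⟩ := exists_verts_eq hG.connected hkG
    have hfin : ((G : Set (Zd d)) ∩ B ω).Finite := G.finite_toSet.subset Set.inter_subset_left
    have hcard := hG.card_le
    rw [Set.ncard_eq_toFinset_card _ hfin] at hcard
    have hT : hfin.toFinset.card ≤ Bmax.card :=
      Finset.card_le_card fun y hy => hmax ω ((Set.Finite.mem_toFinset hfin).1 hy).2
    simp only [Set.mem_iUnion]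
    refine ⟨G.card, Finset.mem_Icc.2 ⟨by omega, hcard.trans (Nat.mul_le_mul_left _ hT)⟩, k,
      Finset.mem_range.2 hk, ⟨σ, hσ⟩, Finset.mem_univ _, hfin.toFinset, ?_, hωH, ?_⟩
    · refine Finset.mem_filter.2 ⟨Finset.mem_powerset.2 fun y hy => ?_, hcard⟩
      change y ∈ verts _ σ
      rw [hσG]
      exact ((Set.Finite.mem_toFinset hfin).1 hy).1
    · intro y hy
      exact ((Set.Finite.mem_toFinset hfin).1 hy).2
  have hη0 : (0 : ℝ) < 1 / (32 * 9 ^ d) := by positivity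
  have hη1 : (1 : ℝ) / (32 * 9 ^ d) ≤ 1 := by
    rw [div_le_one (by positivity)]
    have : (1 : ℝ) ≤ 9 ^ d := one_le_pow₀ (by norm_num)
    linarith
  have hE : ∀ g T, g ≤ 6 * d * T.card → μ.real (E T) ≤ (1 / (32 * 9 ^ d)) ^ g * μ.real H := by
    intro g T hT
    refine (hB T).trans ?_
    gcongr
    unfold thr
    rw [← pow_mul]
    exact pow_le_pow_of_le_one hη0.le hη1 hT
  have hC : ∀ g, 1 ≤ g → ∀ k σ, ((C g k σ).card : ℝ) ≤ 4 ^ g := by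
    intro g hg k σ
    have h1 : (C g k σ).card ≤ 2 ^ (2 * g) := by
      refine (Finset.card_filter_le _ _).trans ?_
      rw [Finset.card_powerset]
      refine Nat.pow_le_pow_right (by norm_num) ?_
      have h2 := card_verts_le (Pi.single i₀ (k : ℤ)) σ.1
      rw [σ.2] at h2
      omega
    rw [pow_mul] at h1
    exact_mod_cast h1
  refine (measureReal_mono hsub (measure_ne_top _ _)).trans ?_
  calc _ ≤ ∑ g ∈ Finset.Icc 1 K, ((1 / 4) ^ g * μ.real H) := by
        refine (measureReal_biUnion_finset_le _ _).trans (Finset.sum_le_sum fun g hg => ?_)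
        refine (measureReal_biUnion_finset_le _ _).trans ?_
        have : ∀ k ∈ Finset.range g, μ.real (⋃ σ ∈ (Finset.univ : Finset (List.Vector (Fin d → Fin 3) (2 * (g - 1)))),
            ⋃ T ∈ C g k σ, E T) ≤ (9 ^ d) ^ g * (4 ^ g * ((1 / (32 * 9 ^ d)) ^ g * μ.real H)) := by
          intro k _
          refine (measureReal_biUnion_finset_le _ _).trans ?_
          refine (Finset.sum_le_card_nsmul _ _ (4 ^ g * ((1 / (32 * 9 ^ d)) ^ g * μ.real H))
            fun σ _ => ?_).trans ?_
          · refine (measureReal_biUnion_finset_le _ _).trans ?_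
            refine (Finset.sum_le_card_nsmul _ _ ((1 / (32 * 9 ^ d)) ^ g * μ.real H)
              fun T hT => hE g T (Finset.mem_filter.1 hT).2).trans ?_
            rw [nsmul_eq_mul]
            gcongr
            exact hC g (Finset.mem_Icc.1 hg).1 k σ
          · rw [nsmul_eq_mul, Finset.card_univ, card_vector]
            gcongr
            have h1 : (Fintype.card (Fin d → Fin 3)) ^ (2 * (g - 1)) ≤ (9 ^ d) ^ g := by
              simp only [Fintype.card_fun, Fintype.card_fin]
              rw [pow_mul, show (3 ^ d) ^ 2 = 9 ^ d by rw [← pow_mul, mul_comm, pow_mul]; norm_num]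
              exact Nat.pow_le_pow_right (by positivity) (by omega)
            exact_mod_cast h1
        refine (Finset.sum_le_card_nsmul _ _ _ this).trans ?_
        rw [nsmul_eq_mul, Finset.card_range]
        have hg2 : (g : ℝ) ≤ 2 ^ g := by exact_mod_cast (Nat.lt_two_pow_self).le
        calc _ ≤ (2 : ℝ) ^ g * ((9 ^ d) ^ g * (4 ^ g * ((1 / (32 * 9 ^ d)) ^ g * μ.real H))) := by
              gcongr
          _ = (2 * 9 ^ d * 4 * (1 / (32 * 9 ^ d))) ^ g * μ.real H := by
              simp only [mul_pow]; ring
          _ = _ := by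
              congr 2
              have : (9 : ℝ) ^ d ≠ 0 := by positivity
              field_simp
              norm_num
    _ ≤ _ := by
        rw [← Finset.sum_mul]
        have := mul_le_mul_of_nonneg_right (sum_quarter_le K) (measureReal_nonneg (μ := μ) (s := H))
        linarith

end

section Sites

lemma exists_ordered {J : Type*} [DecidableEq J] (key : J → ℕ) (S : Finset J) :
    ∃ l, Ordered key l ∧ ∀ j, j ∈ l ↔ j ∈ S := by
  induction S using Finset.induction_on_max_value key with
  | empty => exact ⟨[], List.Pairwise.nil, by simp⟩
  | insert a S ha hmax ih =>
    obtain ⟨l, hl, hmem⟩ := ih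
    refine ⟨a :: l, List.pairwise_cons.2 ⟨fun j hj => ⟨hmax j ((hmem j).1 hj), ?_⟩, hl⟩, by simp [hmem]⟩
    rintro rfl
    exact ha ((hmem _).1 hj)

/-- The state of the exploration just before and after a given job. -/
lemma Plan.exists_initial {κ J D : Type*} {d : ℕ} [DecidableEq J] (P : Plan κ J D d) {key : J → ℕ}
    {l : List J} (hl : Ordered key l) {j : J} (hj : j ∈ l) (ω : Option κ × Sym2 (Zd d) → Bool) :
    ∃ l', Ordered key (j :: l') ∧ (P.run (j :: l') ω).2 ⊆ (P.run l ω).2 ∧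
      (∀ j' o, (j', o) ∈ (P.run l ω).2 → key j' < key j → (j', o) ∈ (P.run l' ω).2) ∧
      ∀ o, (j, o) ∈ (P.run l ω).2 → (j, o) ∈ (P.run (j :: l') ω).2 := by
  induction l with
  | nil => simp at hj
  | cons a l ih =>
    obtain ⟨o', ho'⟩ := P.run_snd_cons a l ω
    have hlt := List.pairwise_cons.1 hl
    by_cases hja : j = a
    · subst hja
      refine ⟨l, hl, fun x hx => hx, fun j' o h hlt => ?_, fun o h => h⟩
      rw [ho', List.mem_cons] at h
      rcases h with h | h
      · cases h; exact absurd hlt (lt_irrefl _)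
      · exact h
    · have hjl : j ∈ l := (List.mem_cons.1 hj).resolve_left hja
      obtain ⟨l', h1, h2, h3, h4⟩ := ih hl.tail hjl
      refine ⟨l', h1, ?_, fun j' o h hk => ?_, fun o h => ?_⟩
      · rw [ho']
        exact fun x hx => List.mem_cons_of_mem _ (h2 hx)
      · rw [ho', List.mem_cons] at h
        rcases h with h | h
        · cases h
          exact absurd hk (not_lt.2 (hlt.1 j hjl).1)
        · exact h3 j' o h hk
      · rw [ho', List.mem_cons] at h
        rcases h with h | h
        · cases h
          exact absurd rfl hja
        · exact h4 o h

variable {d : ℕ}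

/-- The coarse sites reached in a history. -/
def Site (h : List (Job d × Out (Col d) d (Datum d))) (v : Fin d → ℕ) : Prop :=
  v = 0 ∨ ∃ x D, ((v, nst d - 1), some (x, some D)) ∈ h

/-- The coarse sites at which the exploration failed. -/
def Bad (h : List (Job d × Out (Col d) d (Datum d))) (v : Fin d → ℕ) : Prop :=
  ∃ s < nst d, ∃ I, look h (v, s) = some (some I, none)

lemma nst_pos : 0 < nst d := by unfold nst; omega

variable {n m : ℕ}

/-- A job whose control is not idle succeeds or fails. -/
lemma entry_of_ctrl {l : List (Job d)} {j : Job d} {ω : Option (Col d) × Sym2 (Zd d) → Bool}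
    (h : ctrl n m j (look ((steer d n m).run l ω).2) ≠ none) :
    (∃ I, (j, some (some I, none)) ∈ ((steer d n m).run (j :: l) ω).2) ∨
      ∃ x D, (j, some (x, some D)) ∈ ((steer d n m).run (j :: l) ω).2 := by
  rcases (steer d n m).adv_cases j ((steer d n m).run l ω) ω with ⟨hc, _⟩ | ⟨x, _, hr⟩ | ⟨x, I, _, hr⟩
  · exact absurd hc h
  · right
    refine ⟨none, x, ?_⟩
    change _ ∈ ((steer d n m).adv j _ ω).2
    rw [hr]
    exact List.mem_cons_self
  · rcases ho : (steer d n m).result I x (grow ω I.1 ((steer d n m).run l ω).1 ((steer d n m).izone I)) with _ | D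
    · left
      refine ⟨I, ?_⟩
      change _ ∈ ((steer d n m).adv j _ ω).2
      rw [hr, ho]
      exact List.mem_cons_self
    · right
      refine ⟨some I, D, ?_⟩
      change _ ∈ ((steer d n m).adv j _ ω).2
      rw [hr, ho]
      exact List.mem_cons_self

/-- A successor of a reached site is reached or bad. -/
lemma site_or_bad {l : List (Job d)} (hl : Ordered jkey l) {v : Fin d → ℕ} {i : Fin d} (hv : 0 < v i)
    (hmem : ∀ s < nst d, (v, s) ∈ l) {ω : Option (Col d) × Sym2 (Zd d) → Bool}
    (hp : Site ((steer d n m).run l ω).2 (pre v i)) :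
    Site ((steer d n m).run l ω).2 v ∨ Bad ((steer d n m).run l ω).2 v := by
  have hnd : ∀ {l : List (Job d)}, Ordered jkey l → (((steer d n m).run l ω).2.map Prod.fst).Nodup := by
    intro l hl
    rw [Plan.map_fst_run]
    exact hl.nodup
  have key : ∀ s < nst d, Bad ((steer d n m).run l ω).2 v ∨
      ∃ x D, ((v, s), some (x, some D)) ∈ ((steer d n m).run l ω).2 := by
    intro s
    induction s with
    | zero =>
      intro hs
      obtain ⟨l', hl', hsub, hlt, -⟩ := (steer d n m).exists_initial hl (hmem 0 hs) ω
      have hstart : ∃ D, IsStart n m v (look ((steer d n m).run l' ω).2) D := by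
        rcases hp with hp | ⟨x, ⟨a, a', c', q⟩, hD⟩
        · exact ⟨(i, ⟨0, i.pos⟩, cpos n m 0, cpos n m 0), hv, rfl, Or.inl ⟨hp, rfl, rfl⟩⟩
        · refine ⟨(i, a, q, q), hv, rfl, Or.inr ⟨x, a', c', ?_⟩⟩
          refine look_of_mem (hnd hl'.tail) (hlt _ _ hD ?_)
          have := nst_pos (d := d)
          refine jkey_lt_of_height_lt ?_ (by omega)
          have := height_pre hv
          change height (pre v i) < height v
          omega
      have hc : ctrl n m (v, 0) (look ((steer d n m).run l' ω).2) ≠ none := by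
        unfold ctrl datum
        simp [hstart, nst_pos.ne']
      rcases entry_of_ctrl hc with ⟨I, hI⟩ | ⟨x, D, hD⟩
      · exact Or.inl ⟨0, hs, I, look_of_mem (hnd hl) (hsub hI)⟩
      · exact Or.inr ⟨x, D, hsub hD⟩
    | succ s ih =>
      intro hs
      rcases ih (by omega) with ih | ⟨x, D, hD⟩
      · exact Or.inl ih
      obtain ⟨l', hl', hsub, hlt, -⟩ := (steer d n m).exists_initial hl (hmem _ hs) ω
      have hlook := look_of_mem (hnd hl'.tail) (hlt _ _ hD (by unfold jkey; simp))
      have hc : ctrl n m (v, s + 1) (look ((steer d n m).run l' ω).2) ≠ none := by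
        unfold ctrl datum
        simp [hlook, not_le.2 hs]
      rcases entry_of_ctrl hc with ⟨I, hI⟩ | ⟨x, D, hD⟩
      · exact Or.inl ⟨s + 1, hs, I, look_of_mem (hnd hl) (hsub hI)⟩
      · exact Or.inr ⟨x, D, hsub hD⟩
  rcases key (nst d - 1) (by have := nst_pos (d := d); omega) with h | h
  · exact Or.inr h
  · exact Or.inl (Or.inr h)

/-- The embedding of coarse sites in the lattice. -/
def up (v : Fin d → ℕ) : Zd d := fun i => v i

lemma up_zero : up (0 : Fin d → ℕ) = 0 := by
  funext i
  simp [up]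

lemma pre_add_single (v : Fin d → ℕ) (i : Fin d) : pre (v + Pi.single i 1) i = v := by
  funext j
  by_cases h : j = i
  · subst h; simp [pre]
  · simp [pre, h]

lemma up_add_single (v : Fin d → ℕ) (i : Fin d) : up (v + Pi.single i 1) = up v + unit i := by
  funext j
  by_cases h : j = i
  · subst h; simp [up]
  · simp [up, h]

lemma up_pre {v : Fin d → ℕ} {i : Fin d} (hv : 0 < v i) : up (pre v i) = up v - unit i := by
  funext j
  by_cases h : j = i
  · subst h
    simp only [up, pre, if_true, Pi.sub_apply, Pi.single_eq_same]
    omega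
  · simp [up, pre, h]

/-- The jobs of the sites of bounded coordinates. -/
def jobs (d M : ℕ) : Finset (Job d) :=
  (Fintype.piFinset fun _ => Finset.range (M + 1)) ×ˢ Finset.range (nst d)

lemma mem_jobs {M : ℕ} {v : Fin d → ℕ} {s : ℕ} : (v, s) ∈ jobs d M ↔ (∀ i, v i ≤ M) ∧ s < nst d := by
  simp [jobs]

/-- The exploration produces an oriented growth. -/
lemma growth_run (hnm : 2 * m + 1 ≤ n) {M : ℕ} {l : List (Job d)} (hl : Ordered jkey l)
    (hmem : ∀ j, j ∈ l ↔ j ∈ jobs d M) (ω : Option (Col d) × Sym2 (Zd d) → Bool) :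
    Growth (up '' {v | Site ((steer d n m).run l ω).2 v})
      (up '' {v | Bad ((steer d n m).run l ω).2 v}) M where
  oriented :=
    { zero_mem := ⟨0, Or.inl rfl, up_zero⟩
      nonneg := by
        rintro _ ⟨v, _, rfl⟩ i
        exact Int.natCast_nonneg _
      pred := by
        rintro _ ⟨v, hv, rfl⟩ h0
        rcases hv with rfl | ⟨x, D, hD⟩
        · exact absurd up_zero h0
        · obtain ⟨-, hT, -⟩ := (histInv_run hnm l ω hl).done _ _ _ _ hD
          refine ⟨D.1, pre v D.1, ?_, up_pre hT.pos⟩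
          rcases hT.root with ⟨h, _⟩ | ⟨x', a', c', h⟩
          · exact Or.inl h
          · exact Or.inr ⟨_, _, h⟩ }
  extend := by
    rintro _ ⟨v, hv, rfl⟩ i hM
    rw [← up_add_single]
    have hbd : ∀ j, (v + Pi.single i 1 : Fin d → ℕ) j ≤ M := by
      intro j
      have h1 : ∑ j, v j + 1 ≤ M := by
        simp only [up] at hM
        exact_mod_cast hM
      have h2 : v j ≤ ∑ j, v j := Finset.single_le_sum (fun _ _ => Nat.zero_le _) (Finset.mem_univ j)
      have h3 : (Pi.single i 1 : Fin d → ℕ) j ≤ 1 := by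
        by_cases h : j = i
        · subst h; simp
        · simp [h]
      simp only [Pi.add_apply]
      omega
    rcases site_or_bad (n := n) (m := m) (ω := ω) hl (v := v + Pi.single i 1) (i := i) (by simp)
      (fun s hs => (hmem _).2 (mem_jobs.2 ⟨hbd, hs⟩)) (by rw [pre_add_single]; exact hv) with h | h
    · exact Or.inl ⟨_, h, rfl⟩
    · exact Or.inr ⟨_, h, rfl⟩

lemma height_le (v : Fin d → ℕ) : height v ≤ d * ∑ i, v i := by
  unfold height
  rw [Finset.mul_sum]
  exact Finset.sum_le_sum fun i _ => Nat.mul_le_mul_right _ i.2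

/-- A reached site has a point of the cluster nearby. -/
lemma Site.exists_point (hnm : 2 * m + 1 ≤ n) {l : List (Job d)} (hl : Ordered jkey l)
    {ω : Option (Col d) × Sym2 (Zd d) → Bool} {v : Fin d → ℕ} {χ : Config d}
    (hχ : ∀ o e, ω (o, e) = true → χ e = true) {x0 : Zd d} {N0 Zc : ℕ}
    (hZ : ∀ I, ((steer d n m).izone I).card ≤ Zc)
    (hN0 : ((steer d n m).V0 : Set (Zd d)) ⊆ ball χ {x | ∀ j, 0 ≤ x j} x0 N0)
    (hv : Site ((steer d n m).run l ω).2 v) :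
    ∃ q, (∀ j, -(n : ℤ) ≤ q j - cpos n m v j ∧ q j - cpos n m v j ≤ n) ∧
      q ∈ ball χ {x | ∀ j, 0 ≤ x j} x0 (N0 + (Zc + 1) * ((d * ∑ i, v i + 1) * nst d)) := by
  rcases hv with rfl | ⟨x, D, hD⟩
  · refine ⟨cpos n m 0, fun j => by simp, ball_mono _ _ _ (Nat.le_add_right _ _) (hN0 ?_)⟩
    rw [Finset.mem_coe, mem_V0]
    intro j
    simp only [cpos, Pi.zero_apply, Nat.cast_zero, mul_zero, add_zero]
    omega
  have hj : (v, nst d - 1) ∈ l := by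
    have := List.mem_map_of_mem (f := Prod.fst) hD
    rwa [Plan.map_fst_run] at this
  obtain ⟨l', hl', -, -, h4⟩ := (steer d n m).exists_initial hl hj ω
  obtain ⟨-, hT, hsub⟩ := (histInv_run hnm _ ω hl').done _ _ _ _ (h4 _ hD)
  rw [Nat.sub_add_cancel nst_pos] at hT
  refine ⟨D.2.2.2, (hT.arrive (by omega)).1, ?_⟩
  have hkey : jkey (v, nst d - 1) + 1 ≤ (d * ∑ i, v i + 1) * nst d := by
    have h1 := Nat.mul_le_mul_right (nst d) (height_le v)
    have h2 := nst_pos (d := d)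
    unfold jkey
    simp only
    rw [add_mul, one_mul]
    omega
  rcases (valid_steer hnm).dist_le hZ hχ hN0 _ hl' D.2.2.2 (hsub (mem_bx_self _ _)) with h |
    ⟨j, I, o, h, -, h'⟩
  · exact ball_mono _ _ _ (Nat.le_add_right _ _) h
  · refine ball_mono _ _ _ (Nat.add_le_add_left (Nat.mul_le_mul_left _ (le_trans ?_ hkey)) _) h'
    have hjm : j ∈ (v, nst d - 1) :: l' := by
      have := List.mem_map_of_mem (f := Prod.fst) h
      rwa [Plan.map_fst_run] at this
    rcases List.mem_cons.1 hjm with rfl | hjm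
    · exact le_rfl
    · exact Nat.succ_le_succ ((List.pairwise_cons.1 hl').1 j hjm).1

lemma ball_subset_bx (χ : Config d) (O : Set (Zd d)) (x : Zd d) (k : ℕ) : ball χ O x k ⊆ bx x k := by
  induction k with
  | zero =>
    rintro y rfl
    exact mem_bx_self _ _
  | succ k ih =>
    rintro y (hy | ⟨_, z, hz, hzy⟩)
    · exact bx_mono x (Nat.le_succ k) (ih hy)
    · intro i
      have h1 := ih hz i
      have h2 := hzy.1.abs_sub_le i
      rw [abs_le] at *
      push_cast
      omega

lemma ball_finite (χ : Config d) (O : Set (Zd d)) (x : Zd d) (k : ℕ) : (ball χ O x k).Finite :=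
  (bx_finite x k).subset (ball_subset_bx χ O x k)

/-- The number of reached sites bounds from below the volume of the balls. -/
lemma ncard_upTo_le (hnm : 2 * m + 1 ≤ n) {l : List (Job d)} (hl : Ordered jkey l)
    {ω : Option (Col d) × Sym2 (Zd d) → Bool} {χ : Config d}
    (hχ : ∀ o e, ω (o, e) = true → χ e = true) {x0 : Zd d} {N0 Zc : ℕ}
    (hZ : ∀ I, ((steer d n m).izone I).card ≤ Zc)
    (hN0 : ((steer d n m).V0 : Set (Zd d)) ⊆ ball χ {x | ∀ j, 0 ≤ x j} x0 N0) (t : ℕ) :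
    (upTo (up '' {v | Site ((steer d n m).run l ω).2 v}) t).ncard ≤
      (ball χ {x | ∀ j, 0 ≤ x j} x0 (N0 + (Zc + 1) * ((d * t + 1) * nst d))).ncard := by
  have key : ∀ x ∈ upTo (up '' {v | Site ((steer d n m).run l ω).2 v}) t, ∃ q,
      (∀ j, -(n : ℤ) ≤ q j - (6 * n + spacing d n m * x j) ∧ q j - (6 * n + spacing d n m * x j) ≤ n) ∧
      q ∈ ball χ {x | ∀ j, 0 ≤ x j} x0 (N0 + (Zc + 1) * ((d * t + 1) * nst d)) := by
    rintro _ ⟨⟨v, hv, rfl⟩, ht⟩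
    obtain ⟨q, h1, h2⟩ := Site.exists_point hnm hl hχ hZ hN0 hv
    refine ⟨q, h1, ball_mono _ _ _ ?_ h2⟩
    have ht' : ∑ i, v i ≤ t := by
      simp only [up] at ht
      exact_mod_cast ht
    gcongr
  choose! f hf1 hf2 using key
  refine Set.ncard_le_ncard_of_injOn f hf2 ?_ (ball_finite _ _ _ _)
  intro x hx y hy hxy
  have hs : 2 * (n : ℤ) < spacing d n m := by
    have hh : stepLen n m = n + m + 1 := rfl
    unfold spacing
    rw [hh]
    nlinarith [Int.natCast_nonneg d, Int.natCast_nonneg n, Int.natCast_nonneg m,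
      mul_nonneg (Int.natCast_nonneg d) (Int.natCast_nonneg n),
      mul_nonneg (Int.natCast_nonneg d) (Int.natCast_nonneg m)]
  funext j
  have h1 := hf1 x hx j
  have h2 := hf1 y hy j
  rw [hxy] at h1
  by_contra hne
  rcases lt_or_gt_of_ne hne with h | h <;> nlinarith

end Sites

section Orthant

variable {d : ℕ}

/-- The orthant. -/
def orth (d : ℕ) : Set (Zd d) := {x | ∀ j, 0 ≤ x j}

/-- Large balls up to time `M` inside `O`. -/
def Fat (O : Set (Zd d)) (x : Zd d) (a b M : ℕ) : Set (Config d) :=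
  {χ | ∀ t ≤ M, (rate d * (t + 1)) ^ d ≤ ((ball χ O x (a * t + b)).ncard : ℝ)}

open Classical in
/-- The union of the layers. -/
noncomputable def merge {κ : Type*} (ω : Option κ × Sym2 (Zd d) → Bool) : Config d :=
  fun e => decide (∃ k, ω (k, e) = true)

lemma izone_card_le {n m : ℕ} (I : Ins (Col d) d) :
    ((steer d n m).izone I).card ≤ (2 * (n + 2 * m + 1) + 1) ^ d := by
  rw [← bx_ncard I.2.1 (n + 2 * m + 1), ← Set.ncard_coe_finset]
  refine Set.ncard_le_ncard (fun x hx => ?_) (bx_finite _ _)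
  rcases mem_zone.1 (Finset.mem_coe.1 hx) with h | h
  · exact bx_mono _ (by change n ≤ _; omega) h
  · exact Tset_subset_bx _ _ _ _ _ h

section Failures

variable {n m : ℕ} {p' ε' : unitInterval}

/-- Given sites are bad with exponentially small probability. -/
lemma bad_le (hnm : 2 * m + 1 ≤ n) {ε : ℝ} (hε0 : 0 ≤ ε)
    (hε : ∀ q i σ (V : Finset (Zd d)) (k : Col d), bx q m ⊆ V →
      Disjoint (V : Set (Zd d)) (Tset q n m i σ) →
      (prodM (layerQ (d := d) p' ε')).real
        {ω | ¬ growOK q n m i σ (grow ω k V (zone q n m i σ))} ≤ ε)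
    {M : ℕ} {l : List (Job d)} (hl : Ordered jkey l) (hmem : ∀ j, j ∈ l ↔ j ∈ jobs d M)
    (S : Finset (Zd d)) :
    (prodM (layerQ p' ε')).real ((steer d n m).H0 ∩
      {ω | ↑S ⊆ up '' {v | Bad ((steer d n m).run l ω).2 v}}) ≤
      (nst d * ε) ^ S.card * (prodM (layerQ p' ε')).real (steer d n m).H0 := by
  classical
  set μ := prodM (layerQ (d := d) (κ := Col d) p' ε') with hμ
  rcases Set.eq_empty_or_nonempty
    {ω | ↑S ⊆ up '' {v | Bad ((steer d n m).run l ω).2 v}} with he | ⟨ω₀, hω₀⟩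
  · rw [he, Set.inter_empty, measureReal_empty]
    positivity
  have hin : ∀ {ω v s I o}, look ((steer d n m).run l ω).2 (v, s) = some (some I, o) → (v, s) ∈ l := by
    intro ω v s I o h
    have := List.mem_map_of_mem (f := Prod.fst) (mem_of_look h)
    rwa [Plan.map_fst_run] at this
  let down : Zd d → Fin d → ℕ := fun x i => (x i).toNat
  have hdown : ∀ v, down (up v) = v := fun v => by funext i; simp [down, up]
  have hS : ∀ x ∈ S, up (down x) = x ∧ ∀ s < nst d, (down x, s) ∈ l := by
    intro x hx
    obtain ⟨v, ⟨s, hs, I, hI⟩, rfl⟩ := hω₀ hx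
    rw [hdown]
    refine ⟨rfl, fun s' hs' => (hmem _).2 (mem_jobs.2 ⟨?_, hs'⟩)⟩
    exact (mem_jobs.1 ((hmem _).1 (hin hI))).1
  let T : (S → Fin (nst d)) → Finset (Job d) := fun f => Finset.univ.image fun x : S => (down x, (f x : ℕ))
  have hT : ∀ f, (T f).card = S.card := by
    intro f
    rw [Finset.card_image_of_injective, Finset.card_univ, Fintype.card_coe]
    intro x y hxy
    apply Subtype.ext
    rw [← (hS x x.2).1, ← (hS y y.2).1]
    exact congrArg up (Prod.ext_iff.1 hxy).1
  have hsub : (steer d n m).H0 ∩ {ω | ↑S ⊆ up '' {v | Bad ((steer d n m).run l ω).2 v}} ⊆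
      ⋃ f ∈ (Finset.univ : Finset (S → Fin (nst d))), (steer d n m).H0 ∩
        {ω | ∀ j ∈ T f, ∃ I, look ((steer d n m).run l ω).2 j = some (some I, none)} := by
    rintro ω ⟨h0, hω⟩
    have : ∀ x : S, ∃ s : Fin (nst d), ∃ I,
        look ((steer d n m).run l ω).2 (down x, (s : ℕ)) = some (some I, none) := by
      intro x
      obtain ⟨v, ⟨s, hs, I, hI⟩, hv⟩ := hω x.2
      exact ⟨⟨s, hs⟩, I, by rw [← hv, hdown]; exact hI⟩
    choose f hf using this
    simp only [Set.mem_iUnion]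
    refine ⟨f, Finset.mem_univ _, h0, ?_⟩
    intro j hj
    obtain ⟨x, -, rfl⟩ := Finset.mem_image.1 hj
    exact hf x
  calc μ.real ((steer d n m).H0 ∩ {ω | ↑S ⊆ up '' {v | Bad ((steer d n m).run l ω).2 v}})
      ≤ _ := measureReal_mono hsub (measure_ne_top _ _)
    _ ≤ _ := measureReal_biUnion_finset_le _ _
    _ ≤ ∑ f : S → Fin (nst d), ε ^ S.card * μ.real (steer d n m).H0 := by
        refine Finset.sum_le_sum fun f _ => ?_
        rw [← hT f]
        refine (valid_steer hnm).fail_le hε0 hε l hl (T f) fun j hj => ?_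
        obtain ⟨x, -, rfl⟩ := Finset.mem_image.1 hj
        exact (hS x x.2).2 _ (f x).2
    _ = _ := by
        rw [Finset.sum_const, Finset.card_univ, Fintype.card_fun, Fintype.card_fin, Fintype.card_coe,
          nsmul_eq_mul, mul_pow]
        push_cast
        ring

lemma orth_V0_subset_ball {n m : ℕ} {χ : Config d} (h : full χ (steer d n m).V0) :
    ((steer d n m).V0 : Set (Zd d)) ⊆ ball χ (orth d) 0 (steer d n m).V0.card := by
  intro x hx
  have h0 : (0 : Zd d) ∈ (steer d n m).V0 := by
    rw [mem_V0]
    intro j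
    simp only [Pi.zero_apply]
    omega
  have hc : conn χ (steer d n m).V0 0 x := by
    have e : ((steer d n m).V0 : Set (Zd d)) = 
        Set.Icc 0 fun _ => 6 * (n : ℤ) + m := by
      simp [steer]
    rw [e] at h hx ⊢
    exact conn_of_full_Icc h (by rw [← e]; exact h0) hx
  have hsub : ((steer d n m).V0 : Set (Zd d)) ⊆ orth d := fun y hy j => (mem_V0.1 hy j).1
  have := ball_conn (x := 0) (n := 0) hsub rfl hc
  rwa [zero_add] at this

/-- With probability bounded from below, the balls in the orthant are large up to time `M`. -/
lemma fat_ge (hd : 2 ≤ d) (hnm : 2 * m + 1 ≤ n) {ε : ℝ} (hε0 : 0 ≤ ε) (hthr : nst d * ε ≤ thr d)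
    (hε : ∀ q i σ (V : Finset (Zd d)) (k : Col d), bx q m ⊆ V →
      Disjoint (V : Set (Zd d)) (Tset q n m i σ) →
      (prodM (layerQ (d := d) p' ε')).real
        {ω | ¬ growOK q n m i σ (grow ω k V (zone q n m i σ))} ≤ ε) :
    ∃ a b : ℕ, ∀ M, (prodM (layerQ (κ := Col d) p' ε')).real (steer d n m).H0 / 2 ≤
      (prodM (layerQ (κ := Col d) p' ε')).real (merge ⁻¹' Fat (orth d) 0 a b M) := by
  set Zc := (2 * (n + 2 * m + 1) + 1) ^ d
  refine ⟨(Zc + 1) * (d * nst d), (steer d n m).V0.card + (Zc + 1) * nst d, fun M => ?_⟩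
  set μ := prodM (layerQ (d := d) (κ := Col d) p' ε') with hμ
  obtain ⟨l, hl, hmem⟩ := exists_ordered jkey (jobs d M)
  let i₀ : Fin d := ⟨0, by omega⟩
  have hanimal := animal_prob_le μ (B := fun ω => up '' {v | Bad ((steer d n m).run l ω).2 v})
    (H := (steer d n m).H0) (Bmax := (jobs d M).image fun j => up j.1) (by
      rintro ω _ ⟨v, ⟨s, hs, I, hI⟩, rfl⟩
      have := List.mem_map_of_mem (f := Prod.fst) (mem_of_look hI)
      rw [Plan.map_fst_run] at this
      exact Finset.mem_coe.2 (Finset.mem_image.2 ⟨_, (hmem _).1 this, rfl⟩))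
    (fun S => (bad_le hnm hε0 hε hl hmem S).trans (by gcongr)) i₀
  have hsub : (steer d n m).H0 ⊆
      merge ⁻¹' Fat (orth d) 0 ((Zc + 1) * (d * nst d)) ((steer d n m).V0.card + (Zc + 1) * nst d) M ∪
      ((steer d n m).H0 ∩ {ω | ∃ G, Animal i₀ (up '' {v | Bad ((steer d n m).run l ω).2 v}) G}) := by
    intro ω h0
    rcases (growth_run hnm hl hmem ω).growth_or_animal hd i₀ with h | h
    · exact Or.inr ⟨h0, h⟩
    left
    intro t ht
    refine (h t ht).trans ?_
    have hχ : ∀ o e, ω (o, e) = true → merge ω e = true := by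
      intro o e hoe
      simp only [merge, decide_eq_true_eq]
      exact ⟨o, hoe⟩
    have := ncard_upTo_le (χ := merge ω) hnm hl hχ izone_card_le
      (orth_V0_subset_ball fun e he => hχ none e (h0 e he)) t
    refine le_trans (Nat.cast_le.2 this) (le_of_eq ?_)
    rw [show (steer d n m).V0.card + (Zc + 1) * ((d * t + 1) * nst d) =
      (Zc + 1) * (d * nst d) * t + ((steer d n m).V0.card + (Zc + 1) * nst d) by ring]
    rfl
  have h1 := (measureReal_mono hsub (measure_ne_top μ _)).trans (measureReal_union_le _ _)
  linarith

end Failures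

lemma Fat_anti (O : Set (Zd d)) (x : Zd d) (a b : ℕ) : Antitone (Fat O x a b) :=
  fun _ _ h _ hχ t ht => hχ t (ht.trans h)

lemma measurableSet_mem_ball (O : Set (Zd d)) (x : Zd d) (k : ℕ) (y : Zd d) :
    MeasurableSet {χ | y ∈ ball χ O x k} := by
  induction k generalizing y with
  | zero => exact MeasurableSet.const _
  | succ k ih =>
    have : {χ : Config d | y ∈ ball χ O x (k + 1)} = {χ | y ∈ ball χ O x k} ∪
        ⋃ z, ({χ | y ∈ O} ∩ {χ | z ∈ ball χ O x k}) ∩ ({χ | latAdj z y} ∩ {χ | χ s(z, y) = true}) := by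
      ext χ
      simp only [Set.mem_union, Set.mem_iUnion, Set.mem_inter_iff]
      constructor
      · rintro (h | ⟨h1, z, h2, h3⟩)
        · exact Or.inl h
        · exact Or.inr ⟨z, ⟨h1, h2⟩, h3⟩
      · rintro (h | ⟨z, ⟨h1, h2⟩, h3⟩)
        · exact Or.inl h
        · exact Or.inr ⟨h1, z, h2, h3⟩
    rw [this]
    refine (ih y).union (MeasurableSet.iUnion fun z => ((MeasurableSet.const _).inter (ih z)).inter
      ((MeasurableSet.const _).inter ?_))
    exact measurableSet_coord _ _

lemma measurable_ncard_ball (O : Set (Zd d)) (x : Zd d) (k : ℕ) :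
    Measurable fun χ : Config d => (ball χ O x k).ncard := by
  classical
  have e : (fun χ : Config d => (ball χ O x k).ncard) = fun χ => ∑ y ∈ (bx_finite x k).toFinset,
      if y ∈ ball χ O x k then 1 else 0 := by
    funext χ
    rw [← Finset.card_filter, ← Set.ncard_coe_finset]
    congr 1
    ext y
    simp only [Finset.coe_filter, Set.Finite.mem_toFinset]
    exact ⟨fun h => ⟨ball_subset_bx _ _ _ _ h, h⟩, fun h => h.2⟩
  rw [e]
  exact Finset.measurable_sum _ fun y _ => Measurable.ite (measurableSet_mem_ball O x k y)
    measurable_const measurable_const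

lemma measurableSet_Fat (O : Set (Zd d)) (x : Zd d) (a b M : ℕ) : MeasurableSet (Fat O x a b M) := by
  unfold Fat
  simp_rw [Set.ofPred_forall]
  refine MeasurableSet.iInter fun t => MeasurableSet.iInter fun _ => ?_
  have : Measurable fun χ : Config d => ((ball χ O x (a * t + b)).ncard : ℝ) :=
    (measurable_from_top (f := fun k : ℕ => (k : ℝ))).comp (measurable_ncard_ball _ _ _)
  exact measurableSet_le measurable_const this

/-- Sprinkling parameters. -/
lemma exists_sprinkle {p p' : ℝ} (hp' : p' < p) (hp1 : p ≤ 1) {N : ℕ} (hN : 0 < N) :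
    ∃ ε : unitInterval, 0 < (ε : ℝ) ∧ 1 - p = (1 - p') * (1 - ε) ^ N := by
  have h1 : 0 < 1 - p' := by linarith
  have h2 : 0 ≤ (1 - p) / (1 - p') := div_nonneg (by linarith) h1.le
  have h3 : (1 - p) / (1 - p') < 1 := by rw [div_lt_one h1]; linarith
  have h4 : 0 ≤ ((1 - p) / (1 - p')) ^ (1 / N : ℝ) := Real.rpow_nonneg h2 _
  have h5 : ((1 - p) / (1 - p')) ^ (1 / N : ℝ) < 1 := Real.rpow_lt_one h2 h3 (by positivity)
  refine ⟨⟨1 - ((1 - p) / (1 - p')) ^ (1 / N : ℝ), by linarith, by linarith⟩, by simpa using h5, ?_⟩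
  simp only [sub_sub_cancel]
  rw [one_div, Real.rpow_inv_natCast_pow h2 hN.ne']
  field_simp

/-- Linear growth of radii gives fat balls in the orthant with positive probability. -/
theorem exists_fat (hd : 2 ≤ d) {p : unitInterval} (hp : pc d < p) :
    ∃ δ > 0, ∃ a b : ℕ, δ ≤ (prodM fun _ : Sym2 (Zd d) => p).real (⋂ M, Fat (orth d) 0 a b M) := by
  have hpc : 0 ≤ pc d := Real.sSup_nonneg fun x hx => hx.1
  have hp1 : (p : ℝ) ≤ 1 := p.2.2
  let p' : unitInterval := ⟨(pc d + p) / 2, by linarith, by linarith⟩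
  have hp'0 : (0 : ℝ) < p' := by change 0 < (pc d + p) / 2; linarith
  have hp'p : (p' : ℝ) < p := by change (pc d + p) / 2 < _; linarith
  have hpp' : pc d < p' := by change _ < (pc d + p) / 2; linarith
  have hinf : prodM (fun _ => p') {ω : Config d | ∃ x, (clus ω x).Infinite} = 1 := by
    refine zero_one _ fun h => ?_
    refine not_le.2 hpp' ?_
    unfold pc
    refine le_csSup ⟨1, fun x hx => hx.2.1⟩ ⟨p'.2.1, p'.2.2, fun Q hQ => ?_⟩
    rw [eq_prodM (fun _ => p') Q hQ.2]
    refine measure_mono_null (fun ω hω => ?_) h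
    exact ⟨0, by rw [clus_zero]; exact hω⟩
  have hcol : Nonempty (Col d) :=
    ⟨(fun _ => 0, (⟨0, by omega⟩ : Fin d), (⟨0, nst_pos⟩ : Fin (nst d)))⟩
  obtain ⟨ε', hε'0, hε'⟩ := exists_sprinkle hp'p hp1 (N := Fintype.card (Col d)) Fintype.card_pos
  have hnst : (0 : ℝ) < nst d := by exact_mod_cast nst_pos
  obtain ⟨m, n, hmn, hgrow⟩ := exists_growFail_le (κ := Col d) (d := d) p' ε' hp'0 (by linarith) hε'0
    (by omega) hinf (div_pos (thr_pos d) hnst) 2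
  obtain ⟨a, b, hab⟩ := fat_ge hd (n := n) (m := m) (by omega) (div_pos (thr_pos d) hnst).le
    (mul_div_cancel₀ _ hnst.ne').le hgrow
  set μ := prodM (layerQ (d := d) (κ := Col d) p' ε') with hμ
  have hmerge : μ.map merge = prodM fun _ => p := by
    rw [← prodM_map_or (κ := Col d) p p' ε' hε']
    congr 1
    funext ω e
    unfold merge
    congr
  have hmeas : Measurable (merge (d := d) (κ := Col d)) := by
    refine measurable_pi_lambda _ fun e => measurable_to_bool ?_
    have : (fun ω => merge ω e) ⁻¹' {true} =
        ⋃ k : Option (Col d), {ω | ω (k, e) = true} := by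
      ext ω
      simp [merge]
    rw [this]
    exact MeasurableSet.iUnion fun k => measurableSet_coord _ _
  have hH0 : 0 < μ.real (steer d n m).H0 := by
    have e : (steer d n m).H0 = {ω : Option (Col d) × Sym2 (Zd d) → Bool |
        ∀ e ∈ (edgesIn_finite (steer d n m).V0.finite_toSet).toFinset.map
          ⟨fun e => ((none : Option (Col d)), e), Prod.mk_right_injective _⟩, ω e = true} := by
      ext ω
      simp only [Finset.mem_map, Set.Finite.mem_toFinset, Function.Embedding.coeFn_mk,
        forall_exists_index, and_imp, forall_apply_eq_imp_iff₂]
      rfl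
    rw [e, prodM_real_true]
    refine Finset.prod_pos fun e he => ?_
    obtain ⟨e, -, rfl⟩ := Finset.mem_map.1 he
    exact hp'0
  refine ⟨_, half_pos hH0, a, b, ?_⟩
  have hlim := tendsto_measure_iInter_atTop (μ := prodM fun _ : Sym2 (Zd d) => p)
    (fun M => (measurableSet_Fat (orth d) 0 a b M).nullMeasurableSet) (Fat_anti _ _ _ _)
    ⟨0, measure_ne_top _ _⟩
  have hlim' := (ENNReal.tendsto_toReal (measure_ne_top _ _)).comp hlim
  refine ge_of_tendsto' hlim' fun M => (hab M).trans (le_of_eq ?_)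
  rw [← hmerge]
  simp only [Function.comp, Measure.real]
  rw [Measure.map_apply hmeas (measurableSet_Fat _ _ _ _ _)]

end Orthant

section Levy

variable {d : ℕ}

lemma ball_subset {χ : Config d} {O : Set (Zd d)} {x : Zd d} (hx : x ∈ O) (k : ℕ) :
    ball χ O x k ⊆ O := by
  induction k with
  | zero => exact Set.singleton_subset_iff.2 hx
  | succ k ih => exact Set.union_subset ih fun y hy => hy.1

lemma ball_congr {χ χ' : Config d} {O : Set (Zd d)} {x : Zd d} (hx : x ∈ O)
    (h : ∀ e : Sym2 (Zd d), (∀ v ∈ e, v ∈ O) → χ e = χ' e) (k : ℕ) :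
    ball χ O x k = ball χ' O x k := by
  induction k with
  | zero => rfl
  | succ k ih =>
    unfold ball
    rw [ih]
    congr 1
    ext y
    refine and_congr_right fun hy => exists_congr fun z => and_congr_right fun hz => ?_
    refine and_congr_right fun _ => ?_
    rw [h s(z, y)]
    rintro v hv
    rcases Sym2.mem_iff.1 hv with rfl | rfl
    · exact ball_subset hx k hz
    · exact hy

lemma det_Fat {O : Set (Zd d)} {x : Zd d} (hx : x ∈ O) (a b : ℕ) :
    Det (⋂ M, Fat O x a b M) {e | ∀ v ∈ e, v ∈ O} := by
  intro ω ω' h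
  simp only [Set.mem_iInter, Fat, Set.mem_ofPred_eq, ball_congr hx h]

lemma ball_act {g : Zd d ≃ Zd d} (hg : LatAut g) (ω : Config d) {O O' : Set (Zd d)}
    (hO : ∀ x, x ∈ O ↔ g x ∈ O') (x : Zd d) (k : ℕ) :
    ball (act g ω) O x k = g ⁻¹' ball ω O' (g x) k := by
  induction k with
  | zero =>
    ext y
    exact g.injective.eq_iff.symm
  | succ k ih =>
    unfold ball
    rw [ih]
    ext y
    refine or_congr Iff.rfl (and_congr (hO y) ?_)
    refine g.exists_congr fun z => and_congr Iff.rfl (openAdj_act hg)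

lemma Fat_symm (p : unitInterval) (y : Zd d) (σ : ℤˣ) (a b : ℕ) :
    (prodM fun _ : Sym2 (Zd d) => p).real (⋂ M, Fat (orth d) 0 a b M) ≤
    (prodM fun _ : Sym2 (Zd d) => p).real
      (⋂ M, Fat {z | ∀ j, 0 ≤ (σ : ℤ) * (z j - y j)} y a b M) := by
  set g : Zd d ≃ Zd d := (trans (-y)).trans (sperm 1 fun _ => σ) with hg
  have hga : ∀ z j, g z j = σ * (z j - y j) := fun z j => by
    simp [hg, sperm_apply, sub_eq_add_neg]
  have hgl : LatAut g := fun u v => (latAut_sperm 1 _ _ _).trans (latAut_trans (-y) u v)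
  have hgy : g y = 0 := by ext j; simp [hga]
  refine measure_le_act p g fun ω hω => ?_
  simp only [Set.mem_iInter] at hω ⊢
  intro M t ht
  rw [ball_act hgl ω (O' := orth d) (fun z => by simp [orth, hga]), hgy,
    Set.ncard_preimage_of_injective_subset_range g.injective (by simp [g.surjective.range_eq])]
  exact hω M t ht

lemma ball_subset_ball {ω : Config d} {O : Set (Zd d)} {y : Zd d} {L : ℕ}
    (hy : y ∈ ball ω Set.univ 0 L) (k : ℕ) : ball ω O y k ⊆ ball ω Set.univ 0 (L + k) := by
  induction k with
  | zero => exact Set.singleton_subset_iff.2 hy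
  | succ k ih =>
    rintro z (hz | ⟨_, u, hu, huz⟩)
    · exact Or.inl (ih hz)
    · exact Or.inr ⟨trivial, u, ih hu, huz⟩

/-- The balls around the origin grow like `c * r ^ d`. -/
def Growing (d : ℕ) (c : ℝ) : Set (Config d) :=
  {ω | ∃ R : ℕ, ∀ r ≥ R, c * (r : ℝ) ^ d ≤ ((ball ω Set.univ 0 r).ncard : ℝ)}

lemma measurableSet_Growing (c : ℝ) : MeasurableSet (Growing d c) := by
  unfold Growing
  simp_rw [Set.ofPred_exists, Set.ofPred_forall]
  refine MeasurableSet.iUnion fun R => MeasurableSet.iInter fun r => MeasurableSet.iInter fun _ => ?_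
  have : Measurable fun χ : Config d => ((ball χ Set.univ 0 r).ncard : ℝ) :=
    (measurable_from_top (f := fun k : ℕ => (k : ℝ))).comp (measurable_ncard_ball _ _ _)
  exact measurableSet_le measurable_const this

lemma growing_of_Fat (hd : 2 ≤ d) {ω : Config d} {O : Set (Zd d)} {y : Zd d} {L a b : ℕ}
    (hy : y ∈ ball ω Set.univ 0 L) (hω : ω ∈ ⋂ M, Fat O y a b M) :
    ω ∈ Growing d ((rate d / (2 * (a + 1))) ^ d) := by
  refine ⟨2 * (b + L), fun r hr => ?_⟩
  have hrate := rate_pos hd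
  set t := (r - b - L) / (a + 1) with ht
  have h1 : (a + 1) * t ≤ r - b - L := Nat.mul_div_le _ _
  have h2 : r - b - L < (a + 1) * (t + 1) := by
    rw [mul_comm]; exact Nat.lt_mul_of_div_lt (Nat.lt_succ_self _) (Nat.succ_pos _)
  have h3 : r ≤ 2 * ((a + 1) * (t + 1)) := by omega
  have h4 : L + (a * t + b) ≤ r := by
    have : a * t ≤ (a + 1) * t := Nat.mul_le_mul_right _ (Nat.le_succ a)
    omega
  have h5 := Set.mem_iInter.1 hω t t le_rfl
  have h6 : ((ball ω O y (a * t + b)).ncard : ℝ) ≤ (ball ω Set.univ 0 r).ncard := by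
    exact_mod_cast Set.ncard_le_ncard ((ball_subset_ball hy _).trans (ball_mono _ _ _ h4))
      (ball_finite _ _ _ _)
  refine le_trans ?_ (h5.trans h6)
  rw [← mul_pow]
  refine pow_le_pow_left₀ (by positivity) ?_ d
  have h7 : (r : ℝ) ≤ 2 * ((a + 1) * (t + 1)) := by exact_mod_cast h3
  rw [div_mul_eq_mul_div, div_le_iff₀ (by positivity)]
  nlinarith

/-- Conditionally on the edges inside a box reached by the cluster of the origin, the balls grow
fast with probability bounded from below. -/
lemma growing_inter_ge (hd : 2 ≤ d) (p : unitInterval) {δ : ℝ} {a b : ℕ} (hδ0 : 0 ≤ δ)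
    (hδ : δ ≤ (prodM fun _ : Sym2 (Zd d) => p).real (⋂ M, Fat (orth d) 0 a b M)) {N : ℕ}
    {G : Set (Config d)} (hG : MeasurableSet G) (hGN : Det G {e | ∀ v ∈ e, v ∈ bx (0 : Zd d) N}) :
    p * δ * (prodM fun _ : Sym2 (Zd d) => p).real (G ∩ {ω | (reach 0 N ω).Nonempty}) ≤
      (prodM fun _ : Sym2 (Zd d) => p).real (Growing d ((rate d / (2 * (a + 1))) ^ d) ∩ G) := by
  set μ := prodM fun _ : Sym2 (Zd d) => p with hμ
  set A := Growing d ((rate d / (2 * (a + 1))) ^ d)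
  have hp0 : (0 : ℝ) ≤ p := p.2.1
  rw [← one_mul (μ.real (A ∩ G))]
  refine fiber_le (reach 0 N) (fun s => measurableSet_reach 0 N fun X => X = s)
    (mul_nonneg hp0 hδ0) zero_le_one fun s => ?_
  rw [one_mul]
  rcases s.eq_empty_or_nonempty with rfl | ⟨x, hx⟩
  · have : G ∩ {ω : Config d | (reach 0 N ω).Nonempty} ∩ reach 0 N ⁻¹' {∅} = ∅ := by
      ext ω
      simp only [Set.mem_inter_iff, Set.mem_preimage, Set.mem_singleton_iff, Set.mem_empty_iff_false,
        iff_false]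
      rintro ⟨⟨_, h1⟩, h2⟩
      exact h1.ne_empty h2
    rw [this, measureReal_empty, mul_zero]
    exact measureReal_nonneg
  set G' := G ∩ reach 0 N ⁻¹' {s} with hG'
  have hG'm : MeasurableSet G' := hG.inter (measurableSet_reach 0 N fun X => X = s)
  have hG'd : Det G' {e | ∀ v ∈ e, v ∈ bx (0 : Zd d) N} := by
    refine hGN.inter ((det_reach 0 N fun X => X = s).mono ?_)
    rintro e ⟨u, v, rfl, -, hu, hv⟩ w hw
    rcases Sym2.mem_iff.1 hw with rfl | rfl
    · exact hu
    · exact hv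
  rcases G'.eq_empty_or_nonempty with he | ⟨ω₀, hω₀⟩
  · have : G ∩ {ω : Config d | (reach 0 N ω).Nonempty} ∩ reach 0 N ⁻¹' {s} = ∅ :=
      Set.subset_eq_empty (Set.inter_subset_inter_left _ Set.inter_subset_left) he
    rw [this, measureReal_empty, mul_zero]
    exact measureReal_nonneg
  have hxr : x ∈ reach 0 N ω₀ := by rw [show reach 0 N ω₀ = s from hω₀.2]; exact hx
  obtain ⟨hxN, ⟨i, hi⟩, -⟩ := mem_reach.1 hxr
  obtain ⟨σ, hσ⟩ : ∃ σ : ℤˣ, (σ : ℤ) * x i = N := by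
    rcases abs_cases (x i) with h | h
    · exact ⟨1, by rw [← hi, h.1]; simp⟩
    · exact ⟨-1, by rw [← hi, h.1]; simp⟩
  set y : Zd d := x + Pi.single i (σ : ℤ) with hy
  set O : Set (Zd d) := {z | ∀ j, 0 ≤ (σ : ℤ) * (z j - y j)} with hO
  have hσ2 : (σ : ℤ) * σ = 1 := by rw [← Units.val_mul, Int.units_mul_self]; rfl
  have hyO : y ∈ O := fun j => by simp
  have hOd : ∀ z ∈ O, z ∉ bx 0 N := by
    intro z hz hzN
    have h1 := hz i
    have h2 := hzN i
    have h3 : (σ : ℤ) * z i ≤ N := by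
      refine (le_abs_self _).trans ?_
      rw [abs_units]
      simpa using h2
    simp only [hy, Pi.add_apply, Pi.single_eq_same] at h1
    have h4 : (σ : ℤ) * (z i - (x i + σ)) = σ * z i - σ * x i - σ * σ := by ring
    rw [h4, hσ, hσ2] at h1
    omega
  have hxy : latAdj x y := latAdj_add_single x i (by
    rcases Int.units_eq_one_or σ with h | h <;> simp [h])
  set F := ⋂ M, Fat O y a b M with hF
  have hFm : MeasurableSet F := MeasurableSet.iInter fun M => measurableSet_Fat _ _ _ _ M
  have hFd := det_Fat hyO a b
  have hFδ : δ ≤ μ.real F := hδ.trans (Fat_symm p y σ a b)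
  have hxO : x ∉ O := fun h => hOd x h hxN
  have hEF : μ.real ({ω | ω s(x, y) = true} ∩ F) = p * μ.real F := by
    rw [indep_det _ (measurableSet_coord _ _) hFm (det_coord _ _) hFd, prodM_real_eq]
    · rfl
    · rw [Set.disjoint_singleton_left]
      exact fun h => hxO (h x (Sym2.mem_mk_left _ _))
  have hind : μ.real (G' ∩ ({ω | ω s(x, y) = true} ∩ F)) = μ.real G' * (p * μ.real F) := by
    rw [indep_det (T := {e | ∃ v ∈ e, v ∈ O}) _ hG'm ((measurableSet_coord _ _).inter hFm) hG'd, hEF]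
    · refine ((det_coord _ _).mono ?_).inter (hFd.mono ?_)
      · rintro e rfl
        exact ⟨y, Sym2.mem_mk_right _ _, hyO⟩
      · intro e he
        induction e with | h u v => exact ⟨u, Sym2.mem_mk_left _ _, he u (Sym2.mem_mk_left _ _)⟩
    · rw [Set.disjoint_left]
      rintro e h1 ⟨v, hv, hvO⟩
      exact hOd v hvO (h1 v hv)
  calc p * δ * μ.real (G ∩ {ω | (reach 0 N ω).Nonempty} ∩ reach 0 N ⁻¹' {s})
      ≤ p * μ.real F * μ.real G' := by
        refine mul_le_mul (mul_le_mul_of_nonneg_left hFδ hp0)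
          (measureReal_mono fun ω h => ⟨h.1.1, h.2⟩) measureReal_nonneg
          (mul_nonneg hp0 measureReal_nonneg)
    _ = μ.real (G' ∩ ({ω | ω s(x, y) = true} ∩ F)) := by rw [hind]; ring
    _ ≤ _ := by
        refine measureReal_mono ?_
        rintro ω ⟨⟨hωG, hωs⟩, hωe, hωF⟩
        refine ⟨⟨?_, hωG⟩, hωs⟩
        have hxr : x ∈ reach 0 N ω := by rw [show reach 0 N ω = s from hωs]; exact hx
        obtain ⟨-, -, z, hz, hc⟩ := mem_reach.1 hxr
        have hz0 : z = 0 := by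
          funext j
          have := hz j
          simpa using this
        rw [hz0] at hc
        have hx0 := ball_conn (O := Set.univ) (x := (0 : Zd d)) (n := 0)
          (S := (bx_finite (0 : Zd d) N).toFinset) (Set.subset_univ _) rfl
          (by rw [Set.Finite.coe_toFinset]; exact hc)
        have hy0 : y ∈ ball ω Set.univ 0 (0 + (bx_finite (0 : Zd d) N).toFinset.card + 1) :=
          Or.inr ⟨trivial, x, hx0, hxy, hωe⟩
        exact growing_of_Fat hd hy0 hωF

lemma exists_bx_of_finset (s : Finset (Sym2 (Zd d))) : ∃ N, ∀ e ∈ s, ∀ v ∈ e, v ∈ bx 0 N := by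
  classical
  obtain ⟨N, hN⟩ := exists_bx_of_finite (Finset.finite_toSet (s.biUnion fun e => e.toFinset))
  exact ⟨N, fun e he v hv => hN (Finset.mem_coe.2 (Finset.mem_biUnion.2 ⟨e, he, by simpa using hv⟩))⟩

/-- On the event that the cluster of the origin is infinite, the balls almost surely grow fast. -/
lemma infinite_diff_growing (hd : 2 ≤ d) {p : unitInterval} (hp0 : (0 : ℝ) < p) {δ : ℝ} {a b : ℕ}
    (hδ0 : 0 < δ) (hδ : δ ≤ (prodM fun _ : Sym2 (Zd d) => p).real (⋂ M, Fat (orth d) 0 a b M)) :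
    prodM (fun _ : Sym2 (Zd d) => p)
      ({ω | (clus ω 0).Infinite} \ Growing d ((rate d / (2 * (a + 1))) ^ d)) = 0 := by
  set μ := prodM fun _ : Sym2 (Zd d) => p with hμ
  set A := Growing d ((rate d / (2 * (a + 1))) ^ d)
  set D := {ω : Config d | (clus ω 0).Infinite} \ A with hDdef
  have hD : MeasurableSet D := (measurableSet_clus_infinite 0).diff (measurableSet_Growing _)
  have key : ∀ η > 0, p * δ * (μ.real D - η) ≤ η := by
    intro η hη
    obtain ⟨G, hG𝒜, -, hGη⟩ := (Measure.MeasureDense.of_generateFrom_isSetAlgebra_finite μ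
      isSetAlgebra_measurableCylinders generateFrom_measurableCylinders.symm).fin_meas_approx hD
      (measure_ne_top _ _) η hη
    obtain ⟨s, S, hS, rfl⟩ := (mem_measurableCylinders _).1 hG𝒜
    obtain ⟨N, hN⟩ := exists_bx_of_finset s
    have hGd : Det (cylinder s S) {e | ∀ v ∈ e, v ∈ bx (0 : Zd d) N} := by
      intro ω ω' h
      rw [mem_cylinder, mem_cylinder, show s.restrict ω = s.restrict ω' from
        funext fun e => h e (hN e e.2)]
    have h1 := growing_inter_ge hd p hδ0.le hδ (MeasurableSet.cylinder s hS) hGd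
    have hη' : μ.real (symmDiff D (cylinder s S)) ≤ η :=
      ENNReal.toReal_le_of_le_ofReal hη.le hGη.le
    have h2 : μ.real (A ∩ cylinder s S) ≤ η := by
      refine (measureReal_mono fun ω hω => ?_).trans hη'
      exact Or.inr ⟨hω.2, fun h => h.2 hω.1⟩
    have h3 : μ.real D ≤ μ.real (cylinder s S ∩ {ω | (reach 0 N ω).Nonempty}) + η := by
      refine (measureReal_mono fun ω hω => ?_ :
        μ.real D ≤ μ.real ((cylinder s S ∩ {ω | (reach 0 N ω).Nonempty}) ∪
          symmDiff D (cylinder s S))).trans ((measureReal_union_le _ _).trans (by linarith))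
      by_cases h : ω ∈ cylinder s S
      · exact Or.inl ⟨h, reach_nonempty_of_infinite (Nat.zero_le N) (mem_bx_self 0 0) hω.1⟩
      · exact Or.inr (Or.inl ⟨hω, h⟩)
    refine le_trans ?_ (h1.trans h2)
    exact mul_le_mul_of_nonneg_left (by linarith) (by positivity)
  have hD0 : μ.real D = 0 := by
    by_contra hne
    have hpos : 0 < μ.real D := lt_of_le_of_ne measureReal_nonneg (Ne.symm hne)
    have hc : 0 < p * δ := by positivity
    have h := key (p * δ * μ.real D / (2 * (1 + p * δ))) (by positivity)
    have h4 : p * δ * μ.real D / (2 * (1 + p * δ)) * (1 + p * δ) = p * δ * μ.real D / 2 := by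
      field_simp
    nlinarith [mul_pos hc hpos]
  exact (measureReal_eq_zero_iff).1 hD0

lemma chemLE_of_mem_ball {ω : Config d} {x : Zd d} {r : ℕ} (h : x ∈ ball ω Set.univ 0 r) :
    chemLE ω x r := by
  induction r generalizing x with
  | zero =>
    obtain rfl : x = 0 := h
    exact ⟨0, le_rfl, fun _ => 0, rfl, rfl, fun i hi => absurd hi (Nat.not_lt_zero i)⟩
  | succ r ih =>
    rcases h with h | ⟨-, z, hz, hzx⟩
    · obtain ⟨m, hm, h⟩ := ih h
      exact ⟨m, hm.trans (Nat.le_succ r), h⟩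
    · obtain ⟨m, hm, γ, h0, hγ, hs⟩ := ih hz
      refine ⟨m + 1, Nat.succ_le_succ hm, fun i => if i ≤ m then γ i else x, ?_, ?_, fun i hi => ?_⟩
      · simpa using h0
      · simp
      · rcases Nat.lt_or_ge i m with h | h
        · simpa [h.le, Nat.succ_le_of_lt h] using hs i h
        · obtain rfl : i = m := by omega
          simpa [hγ] using hzx

lemma chemBall_eq (ω : Config d) (r : ℕ) : chemBall ω r = ball ω Set.univ 0 r := by
  refine Set.Subset.antisymm ?_ fun x => chemLE_of_mem_ball
  rintro x ⟨m, hm, γ, h0, rfl, hs⟩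
  refine ball_mono ω _ 0 hm ?_
  have : ∀ i ≤ m, γ i ∈ ball ω Set.univ 0 i := by
    intro i
    induction i with
    | zero => exact fun _ => h0
    | succ i ih => exact fun hi => Or.inr ⟨trivial, γ i, ih (by omega), hs i hi⟩
  exact this m le_rfl

end Levy

/-- volume lower bound for chemical balls. -/
theorem stmt18 (d : ℕ) (hd : 2 ≤ d) (p : ℝ) (hp : pc d < p) (hp1 : p ≤ 1) :
    ∃ c > (0 : ℝ),
      ∀ Q : Measure (Config d), IsBernoulli p Q →
        ∀ᵐ ω ∂Q, (cluster ω).Infinite →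
          ∃ R : ℕ, ∀ r ≥ R,
            c * (r : ℝ) ^ d ≤ ((chemBall ω r).ncard : ℝ) := by
  have hp0 : 0 < p := lt_of_le_of_lt (Real.sSup_nonneg fun x hx => hx.1) hp
  obtain ⟨δ, hδ0, a, b, hδ⟩ := exists_fat hd (p := ⟨p, hp0.le, hp1⟩) hp
  have hrate := rate_pos hd
  refine ⟨(rate d / (2 * (a + 1))) ^ d, by positivity, fun Q hQ => ?_⟩
  rw [eq_prodM (fun _ => ⟨p, hp0.le, hp1⟩) Q hQ.2, ae_iff]
  refine measure_mono_null (fun ω hω => ?_) (infinite_diff_growing hd hp0 hδ0 hδ)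
  obtain ⟨h1, h2⟩ := Classical.not_imp.1 hω
  refine ⟨?_, fun ⟨R, hR⟩ => h2 ⟨R, fun r hr => ?_⟩⟩
  · rw [← clus_zero] at h1
    exact h1
  · rw [chemBall_eq]
    exact hR r hr

end Perco
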